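/- Let ρ : Q → ℝ be a Lipschitz continuous function on the unit square Q = [0,1]² with ρ(x) ≥ a for some constant a > 0 and ∫_Q ρ(x) dx = 1, and let μ be the probability measure on Q with density ρ. For each N, let (x_1,…,x_N, y_1,…,y_N) be 2N points sampled independently with distribution μ, and let C_N = min_π Σ_{i=1}^N |x_i − y_{π(i)}|² be the optimal matching cost. Then limsup_{N→∞} (2π / log N) · E_μ[C_N] ≤ 1, where E_μ denotes expectation with respect to the product measure μ^{⊗2N}. -/

import Mathlib

open MeasureTheory Filter
open scoped ENNReal NNReal Topology

noncomputable section

/-- The plane, with the Euclidean norm. -/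
abbrev E2 : Type := EuclideanSpace ℝ (Fin 2)

/-- The unit square `Q = [0,1]²`. -/
def unitSq : Set E2 := {x | ∀ i, x i ∈ Set.Icc (0 : ℝ) 1}

/-- The optimal matching cost
`C_N = min_π Σ_i |x_i − y_{π(i)}|²`. -/
def matchCost {N : ℕ} (x y : Fin N → E2) : ℝ :=
  ⨅ π : Equiv.Perm (Fin N), ∑ i, ‖x i - y (π i)‖ ^ 2

section Part1
def thF (m k : ℕ) : ℝ := Real.pi * k / (2 * m)
def nrmF (m k : ℕ) : ℝ := if k = 0 then √(1 / m) else √(2 / m)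
def phiF (m k j : ℕ) : ℝ := nrmF m k * Real.cos (thF m k * (2 * j + 1))
def ssF (m k j : ℕ) : ℝ := nrmF m k * (2 * Real.sin (thF m k) * Real.sin (thF m k * (2 * j)))
def lamF (m k : ℕ) : ℝ := 4 * Real.sin (thF m k) ^ 2

lemma lamF_nonneg (m k : ℕ) : 0 ≤ lamF m k := by unfold lamF; positivity

lemma ssF_zero (m k : ℕ) : ssF m k 0 = 0 := by simp [ssF]

lemma ssF_last (m k : ℕ) (hm : 0 < m) : ssF m k m = 0 := by
  have : thF m k * (2 * m) = k * Real.pi := by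
    unfold thF; field_simp
  simp [ssF, this]

lemma ssF_succ_sub (m k j : ℕ) : ssF m k (j + 1) - ssF m k j = lamF m k * phiF m k j := by
  unfold ssF lamF phiF
  have h1 : thF m k * (2 * ((j + 1 : ℕ) : ℝ)) = thF m k * (2 * j + 1) + thF m k := by
    push_cast; ring
  have h2 : thF m k * (2 * (j : ℝ)) = thF m k * (2 * j + 1) - thF m k := by ring
  rw [h1, h2, Real.sin_add, Real.sin_sub]; ring

lemma ssF_succ (m k j : ℕ) : ssF m k (j + 1) = phiF m k j - phiF m k (j + 1) := by
  unfold ssF phiF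
  have h1 : thF m k * (2 * (j : ℝ) + 1) = thF m k * (2 * ((j + 1 : ℕ) : ℝ)) - thF m k := by
    push_cast; ring
  have h2 : thF m k * (2 * ((j + 1 : ℕ) : ℝ) + 1) = thF m k * (2 * ((j + 1 : ℕ) : ℝ)) + thF m k := by
    ring
  rw [h1, h2, Real.cos_add, Real.cos_sub]; ring

/-- the basic vanishing cosine sum -/
lemma cos_sum_tele (θ : ℝ) (n : ℕ) :
    2 * Real.sin θ * ∑ j ∈ Finset.range n, Real.cos (θ * (2 * j + 1)) = Real.sin (θ * (2 * n)) := by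
  induction n with
  | zero => simp
  | succ n ih =>
    rw [Finset.sum_range_succ, mul_add, ih]
    have h1 : θ * (2 * ((n + 1 : ℕ) : ℝ)) = θ * (2 * n + 1) + θ := by push_cast; ring
    have h2 : θ * (2 * (n : ℝ)) = θ * (2 * n + 1) - θ := by ring
    rw [h1, h2, Real.sin_add, Real.sin_sub]; ring

lemma cos_sum_zero (m : ℕ) (hm : 0 < m) (r : ℤ) (hr : r ≠ 0) (hr2 : |r| < 2 * m) :
    ∑ j ∈ Finset.range m, Real.cos (Real.pi * r / (2 * m) * (2 * j + 1)) = 0 := by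
  have h := cos_sum_tele (Real.pi * r / (2 * m)) m
  have hm' : (0 : ℝ) < m := by exact_mod_cast hm
  have e : Real.pi * r / (2 * m) * (2 * (m : ℝ)) = r * Real.pi := by field_simp
  rw [e, Real.sin_int_mul_pi] at h
  have hs : Real.sin (Real.pi * r / (2 * m)) ≠ 0 := by
    intro h0
    rw [Real.sin_eq_zero_iff_of_lt_of_lt] at h0
    · rw [div_eq_zero_iff] at h0
      rcases h0 with h0 | h0
      · rcases mul_eq_zero.1 h0 with h0 | h0
        · exact Real.pi_ne_zero h0
        · exact hr (by exact_mod_cast h0)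
      · linarith
    · rw [lt_div_iff₀ (by positivity)]
      have : -(2 * (m : ℝ)) < r := by
        have := (abs_lt.1 hr2).1; exact_mod_cast this
      nlinarith [Real.pi_pos]
    · rw [div_lt_iff₀ (by positivity)]
      have : (r : ℝ) < (2 * (m : ℝ)) := by
        have := (abs_lt.1 hr2).2; exact_mod_cast this
      nlinarith [Real.pi_pos]
  rcases mul_eq_zero.1 h with h | h
  · exact absurd h (by simpa using hs)
  · exact h

lemma phiF_orth (m k l : ℕ) (hk : k < m) (hl : l < m) :
    ∑ j ∈ Finset.range m, phiF m k j * phiF m l j = if k = l then 1 else 0 := by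
  have hm : 0 < m := by omega
  have hm' : (0 : ℝ) < m := by exact_mod_cast hm
  have key : ∀ j : ℕ, phiF m k j * phiF m l j = nrmF m k * nrmF m l / 2 *
      (Real.cos (Real.pi * ((k - l : ℤ) : ℝ) / (2 * m) * (2 * j + 1)) +
        Real.cos (Real.pi * ((k + l : ℤ) : ℝ) / (2 * m) * (2 * j + 1))) := by
    intro j
    have h1 : Real.pi * ((k - l : ℤ) : ℝ) / (2 * m) * (2 * (j : ℝ) + 1) =
      thF m k * (2 * j + 1) - thF m l * (2 * j + 1) := by
        unfold thF; push_cast; ring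
    have h2 : Real.pi * ((k + l : ℤ) : ℝ) / (2 * m) * (2 * (j : ℝ) + 1) =
      thF m k * (2 * j + 1) + thF m l * (2 * j + 1) := by
        unfold thF; push_cast; ring
    rw [h1, h2, Real.cos_add, Real.cos_sub]
    unfold phiF; ring
  simp_rw [key]
  rw [← Finset.mul_sum, Finset.sum_add_distrib]
  by_cases hkl : k = l
  · subst hkl
    rw [if_pos rfl]
    by_cases h0 : k = 0
    · subst h0
      simp [nrmF]
      rw [← mul_inv, Real.mul_self_sqrt hm'.le]
      field_simp; norm_num
    · rw [cos_sum_zero m hm (k + k) (by omega) (by rw [abs_lt]; omega)]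
      simp [nrmF, h0]
      rw [div_mul_div_comm, Real.mul_self_sqrt hm'.le, Real.mul_self_sqrt (by norm_num)]
      field_simp
  · rw [if_neg hkl, cos_sum_zero m hm (k + l) (by omega) (by rw [abs_lt]; omega),
      cos_sum_zero m hm (k - l) (by omega) (by rw [abs_lt]; omega)]
    simp

lemma phiF_compl (m i j : ℕ) (hi : i < m) (hj : j < m) :
    ∑ k ∈ Finset.range m, phiF m k i * phiF m k j = if i = j then 1 else 0 := by
  let U : Matrix (Fin m) (Fin m) ℝ := Matrix.of fun k j => phiF m k j
  have h : U * U.transpose = 1 := by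
    ext k l
    rw [Matrix.mul_apply, Matrix.one_apply]
    have := phiF_orth m k l k.2 l.2
    rw [Finset.sum_range] at this
    simp only [U, Matrix.transpose_apply, Matrix.of_apply]
    rw [this]; simp [Fin.ext_iff]
  have h2 := mul_eq_one_comm.1 h
  have h3 := congrFun (congrFun h2 ⟨i, hi⟩) ⟨j, hj⟩
  rw [Matrix.mul_apply, Matrix.one_apply] at h3
  rw [Finset.sum_range]
  simpa [U, Fin.ext_iff] using h3

lemma ssF_orth (m k l : ℕ) (hk : k < m) (hl : l < m) :
    ∑ j ∈ Finset.range m, ssF m k j * ssF m l j = if k = l then lamF m k else 0 := by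
  have hm : 0 < m := by omega
  have key : ∀ n : ℕ, ∑ j ∈ Finset.range (n + 1), ssF m k j * ssF m l j =
      ∑ j ∈ Finset.range n, lamF m k * (phiF m k j * phiF m l j) - ssF m k n * phiF m l n := by
    intro n
    induction n with
    | zero => simp [ssF_zero]
    | succ n ih =>
      rw [Finset.sum_range_succ, ih, Finset.sum_range_succ]
      have h1 := ssF_succ m l n
      have h2 := ssF_succ_sub m k n
      rw [h1, show lamF m k * (phiF m k n * phiF m l n) = (lamF m k * phiF m k n) * phiF m l n by ring,
        ← h2]
      ring
  have := key m
  rw [Finset.sum_range_succ, ssF_last m k hm, ← Finset.mul_sum, phiF_orth m k l hk hl] at this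
  simpa using this

lemma parsevalF {ι κ : Type*} [DecidableEq κ] (C : Finset ι) (S : Finset κ) (ψ : κ → ι → ℝ)
    (w : κ → ℝ)
    (h : ∀ a ∈ S, ∀ b ∈ S, ∑ c ∈ C, ψ a c * ψ b c = if a = b then w a else 0) (t : κ → ℝ) :
    ∑ c ∈ C, (∑ a ∈ S, t a * ψ a c) ^ 2 = ∑ a ∈ S, t a ^ 2 * w a := by
  have : ∀ c, (∑ a ∈ S, t a * ψ a c) ^ 2 =
      ∑ a ∈ S, ∑ b ∈ S, t a * t b * (ψ a c * ψ b c) := by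
    intro c
    rw [sq, Finset.sum_mul_sum]
    refine Finset.sum_congr rfl fun a _ => Finset.sum_congr rfl fun b _ => by ring
  simp_rw [this]
  rw [Finset.sum_comm]
  refine Finset.sum_congr rfl fun a ha => ?_
  rw [Finset.sum_comm]
  simp_rw [← Finset.mul_sum]
  rw [Finset.sum_congr rfl fun b hb => by rw [h a ha b hb]]
  simp only [mul_ite, mul_zero, Finset.sum_ite_eq, ha, if_true]; ring

end Part1

section Part2
/-- index square -/
def sqI (m : ℕ) : Finset (ℕ × ℕ) := Finset.range m ×ˢ Finset.range m

lemma mem_sqI {m : ℕ} {c : ℕ × ℕ} : c ∈ sqI m ↔ c.1 < m ∧ c.2 < m := by simp [sqI]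

def psiF (m : ℕ) (k c : ℕ × ℕ) : ℝ := phiF m k.1 c.1 * phiF m k.2 c.2
def LamF (m : ℕ) (k : ℕ × ℕ) : ℝ := lamF m k.1 + lamF m k.2
def hatF (m : ℕ) (z : ℕ × ℕ → ℝ) (k : ℕ × ℕ) : ℝ := ∑ c ∈ sqI m, psiF m k c * z c
def J1F (m : ℕ) (z : ℕ × ℕ → ℝ) (c : ℕ × ℕ) : ℝ :=
  ∑ k ∈ sqI m, (hatF m z k / LamF m k) * (ssF m k.1 c.1 * phiF m k.2 c.2)
def J2F (m : ℕ) (z : ℕ × ℕ → ℝ) (c : ℕ × ℕ) : ℝ :=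
  ∑ k ∈ sqI m, (hatF m z k / LamF m k) * (phiF m k.1 c.1 * ssF m k.2 c.2)
def HF (m : ℕ) (c d : ℕ × ℕ) : ℝ :=
  ∑ k ∈ sqI m, (lamF m k.1 / LamF m k * psiF m k c) * psiF m k d

lemma prod_orth (m : ℕ) (f g : ℕ → ℕ → ℝ) (u v : ℕ → ℝ)
    (hf : ∀ k l, k < m → l < m → ∑ j ∈ Finset.range m, f k j * f l j = if k = l then u k else 0)
    (hg : ∀ k l, k < m → l < m → ∑ j ∈ Finset.range m, g k j * g l j = if k = l then v k else 0)
    (a b : ℕ × ℕ) (ha : a ∈ sqI m) (hb : b ∈ sqI m) :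
    ∑ c ∈ sqI m, (f a.1 c.1 * g a.2 c.2) * (f b.1 c.1 * g b.2 c.2) =
      if a = b then u a.1 * v a.2 else 0 := by
  rw [mem_sqI] at ha hb
  unfold sqI
  rw [Finset.sum_product]
  have : ∀ x y, f a.1 x * g a.2 y * (f b.1 x * g b.2 y) =
      (f a.1 x * f b.1 x) * (g a.2 y * g b.2 y) := by intros; ring
  simp_rw [this, ← Finset.mul_sum, ← Finset.sum_mul]
  rw [hf _ _ ha.1 hb.1, hg _ _ ha.2 hb.2]
  by_cases h1 : a.1 = b.1 <;> by_cases h2 : a.2 = b.2 <;> simp [h1, h2, Prod.ext_iff]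

lemma psiF_orth (m : ℕ) (a b : ℕ × ℕ) (ha : a ∈ sqI m) (hb : b ∈ sqI m) :
    ∑ c ∈ sqI m, psiF m a c * psiF m b c = if a = b then 1 else 0 := by
  have := prod_orth m (phiF m) (phiF m) (fun _ => 1) (fun _ => 1)
    (fun k l hk hl => phiF_orth m k l hk hl) (fun k l hk hl => phiF_orth m k l hk hl) a b ha hb
  simpa [psiF] using this

lemma psiF_compl (m : ℕ) (c d : ℕ × ℕ) (hc : c ∈ sqI m) (hd : d ∈ sqI m) :
    ∑ k ∈ sqI m, psiF m k c * psiF m k d = if c = d then 1 else 0 := by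
  have := prod_orth m (fun i k => phiF m k i) (fun i k => phiF m k i) (fun _ => 1) (fun _ => 1)
    (fun k l hk hl => phiF_compl m k l hk hl) (fun k l hk hl => phiF_compl m k l hk hl) c d hc hd
  simpa [psiF] using this

lemma LamF_pos (m : ℕ) (k : ℕ × ℕ) (hk : k ∈ sqI m) (h0 : k ≠ (0, 0)) : 0 < LamF m k := by
  rw [mem_sqI] at hk
  have key : ∀ l, l < m → l ≠ 0 → 0 < lamF m l := by
    intro l hl hl0
    unfold lamF
    have hm : (0 : ℝ) < m := by exact_mod_cast (by omega : 0 < m)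
    have hl' : (0 : ℝ) < l := by exact_mod_cast (by omega : 0 < l)
    have : (l : ℝ) < m := by exact_mod_cast hl
    have : 0 < Real.sin (thF m l) := by
      apply Real.sin_pos_of_pos_of_lt_pi
      · unfold thF; have := Real.pi_pos; positivity
      · unfold thF
        rw [div_lt_iff₀ (by positivity)]
        nlinarith [Real.pi_pos]
    positivity
  unfold LamF
  by_cases h1 : k.1 = 0
  · have h2 : k.2 ≠ 0 := fun h2 => h0 (Prod.ext h1 h2)
    have := key _ hk.2 h2
    have := lamF_nonneg m k.1
    linarith
  · have := key _ hk.1 h1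
    have := lamF_nonneg m k.2
    linarith

lemma LamF_zero (m : ℕ) : LamF m (0, 0) = 0 := by simp [LamF, lamF, thF]

lemma psiF_zero (m : ℕ) (c : ℕ × ℕ) (hm : 0 < m) : psiF m (0, 0) c = 1 / m := by
  have hm' : (0 : ℝ) < m := by exact_mod_cast hm
  simp [psiF, phiF, nrmF, thF]
  rw [← mul_inv, Real.mul_self_sqrt hm'.le]

lemma J1F_sub (m : ℕ) (z : ℕ × ℕ → ℝ) (i j : ℕ) :
    J1F m z (i + 1, j) - J1F m z (i, j) =
      ∑ k ∈ sqI m, (hatF m z k / LamF m k) * (lamF m k.1 * psiF m k (i, j)) := by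
  unfold J1F
  rw [← Finset.sum_sub_distrib]
  refine Finset.sum_congr rfl fun k _ => ?_
  have := ssF_succ_sub m k.1 i
  simp only [psiF]
  rw [← mul_assoc (lamF m k.1), ← this]; ring

lemma J2F_sub (m : ℕ) (z : ℕ × ℕ → ℝ) (i j : ℕ) :
    J2F m z (i, j + 1) - J2F m z (i, j) =
      ∑ k ∈ sqI m, (hatF m z k / LamF m k) * (lamF m k.2 * psiF m k (i, j)) := by
  unfold J2F
  rw [← Finset.sum_sub_distrib]
  refine Finset.sum_congr rfl fun k _ => ?_
  have := ssF_succ_sub m k.2 j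
  simp only [psiF]
  rw [show lamF m k.2 * (phiF m k.1 i * phiF m k.2 j) = phiF m k.1 i * (lamF m k.2 * phiF m k.2 j) by ring,
    ← this]; ring

lemma JF_div (m : ℕ) (z : ℕ × ℕ → ℝ) (i j : ℕ) (hi : i < m) (hj : j < m) :
    (J1F m z (i + 1, j) - J1F m z (i, j)) + (J2F m z (i, j + 1) - J2F m z (i, j)) =
      z (i, j) - (∑ c ∈ sqI m, z c) / (m : ℝ) ^ 2 := by
  have hm : 0 < m := by omega
  have hc : (i, j) ∈ sqI m := by rw [mem_sqI]; exact ⟨hi, hj⟩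
  have h00 : ((0 : ℕ), (0 : ℕ)) ∈ sqI m := by rw [mem_sqI]; exact ⟨hm, hm⟩
  rw [J1F_sub, J2F_sub, ← Finset.sum_add_distrib]
  have h1 : ∀ k ∈ sqI m, hatF m z k / LamF m k * (lamF m k.1 * psiF m k (i, j)) +
      hatF m z k / LamF m k * (lamF m k.2 * psiF m k (i, j)) =
      hatF m z k * psiF m k (i, j) - if k = (0, 0) then hatF m z k * psiF m k (i, j) else 0 := by
    intro k hk
    by_cases h0 : k = (0, 0)
    · subst h0; simp [LamF_zero]
    · have := LamF_pos m k hk h0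
      rw [if_neg h0]
      have e : lamF m k.1 + lamF m k.2 = LamF m k := rfl
      field_simp
      rw [← e]; ring
  rw [Finset.sum_congr rfl h1, Finset.sum_sub_distrib, Finset.sum_ite_eq' , if_pos h00, psiF_zero _ _ hm]
  congr 1
  · unfold hatF
    simp_rw [Finset.sum_mul]
    rw [Finset.sum_comm]
    have : ∀ c ∈ sqI m, ∑ k ∈ sqI m, psiF m k c * z c * psiF m k (i, j) =
        if c = (i, j) then z c else 0 := by
      intro c hcc
      have := psiF_compl m c (i, j) hcc hc
      calc _ = z c * ∑ k ∈ sqI m, psiF m k c * psiF m k (i, j) := by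
            rw [Finset.mul_sum]; refine Finset.sum_congr rfl fun k _ => by ring
        _ = _ := by rw [this]; simp
    rw [Finset.sum_congr rfl this, Finset.sum_ite_eq', if_pos hc]
  · unfold hatF
    simp_rw [psiF_zero m _ hm]
    rw [← Finset.mul_sum]; field_simp

lemma JF_energy (m : ℕ) (z : ℕ × ℕ → ℝ) :
    ∑ c ∈ sqI m, J1F m z c ^ 2 + ∑ c ∈ sqI m, J2F m z c ^ 2 =
      ∑ k ∈ sqI m, hatF m z k ^ 2 / LamF m k := by
  unfold J1F J2F
  rw [parsevalF (sqI m) (sqI m) (fun k c => ssF m k.1 c.1 * phiF m k.2 c.2)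
    (fun k => lamF m k.1 * 1)
    (fun a ha b hb => prod_orth m (ssF m) (phiF m) (lamF m) (fun _ => 1)
      (ssF_orth m) (phiF_orth m) a b ha hb),
    parsevalF (sqI m) (sqI m) (fun k c => phiF m k.1 c.1 * ssF m k.2 c.2)
    (fun k => 1 * lamF m k.2)
    (fun a ha b hb => prod_orth m (phiF m) (ssF m) (fun _ => 1) (lamF m)
      (phiF_orth m) (ssF_orth m) a b ha hb), ← Finset.sum_add_distrib]
  refine Finset.sum_congr rfl fun k hk => ?_
  by_cases h0 : k = (0, 0)
  · subst h0; simp [LamF_zero]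
  · have := LamF_pos m k hk h0
    have e : lamF m k.1 + lamF m k.2 = LamF m k := rfl
    field_simp
    rw [← e]

lemma J1F_sub_eq_HF (m : ℕ) (z : ℕ × ℕ → ℝ) (i j : ℕ) :
    J1F m z (i + 1, j) - J1F m z (i, j) = ∑ d ∈ sqI m, HF m (i, j) d * z d := by
  rw [J1F_sub]
  unfold hatF HF
  simp_rw [Finset.sum_mul]
  rw [Finset.sum_comm]
  refine Finset.sum_congr rfl fun k _ => ?_
  rw [Finset.sum_div, Finset.sum_mul]
  refine Finset.sum_congr rfl fun d _ => by ring

lemma HF_sq_sum (m : ℕ) (c : ℕ × ℕ) (hc : c ∈ sqI m) : ∑ d ∈ sqI m, HF m c d ^ 2 ≤ 1 := by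
  unfold HF
  rw [parsevalF (sqI m) (sqI m) (psiF m) (fun _ => 1) (fun a ha b hb => psiF_orth m a b ha hb)]
  have := psiF_compl m c c hc hc
  rw [if_pos rfl] at this
  rw [← this]
  refine Finset.sum_le_sum fun k hk => ?_
  have h1 := lamF_nonneg m k.1
  have h2 := lamF_nonneg m k.2
  have h3 : lamF m k.1 / LamF m k ≤ 1 := div_le_one_of_le₀ (by unfold LamF; linarith) (by unfold LamF; linarith)
  have h4 : 0 ≤ lamF m k.1 / LamF m k := div_nonneg h1 (by unfold LamF; linarith)
  have h5 : (lamF m k.1 / LamF m k) ^ 2 ≤ 1 := by nlinarith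
  nlinarith [sq_nonneg (psiF m k c)]

lemma HF_abs_le (m : ℕ) (c d : ℕ × ℕ) (hc : c ∈ sqI m) (hd : d ∈ sqI m) : |HF m c d| ≤ 1 := by
  have := HF_sq_sum m c hc
  have h2 : HF m c d ^ 2 ≤ ∑ d ∈ sqI m, HF m c d ^ 2 :=
    Finset.single_le_sum (f := fun d => HF m c d ^ 2) (fun _ _ => sq_nonneg _) hd
  rw [abs_le]; constructor <;> nlinarith

lemma J1F_bdry0 (m : ℕ) (z : ℕ × ℕ → ℝ) (j : ℕ) : J1F m z (0, j) = 0 := by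
  simp [J1F, ssF_zero]
lemma J1F_bdry1 (m : ℕ) (hm : 0 < m) (z : ℕ × ℕ → ℝ) (j : ℕ) : J1F m z (m, j) = 0 := by
  simp [J1F, ssF_last m _ hm]
lemma J2F_bdry0 (m : ℕ) (z : ℕ × ℕ → ℝ) (j : ℕ) : J2F m z (j, 0) = 0 := by
  simp [J2F, ssF_zero]
lemma J2F_bdry1 (m : ℕ) (hm : 0 < m) (z : ℕ × ℕ → ℝ) (j : ℕ) : J2F m z (j, m) = 0 := by
  simp [J2F, ssF_last m _ hm]

end Part2

section Part3
lemma arctan_diff_ge (a b : ℝ) (ha : 0 ≤ a) (hab : a ≤ b) :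
    (b - a) / (1 + b ^ 2) ≤ Real.arctan b - Real.arctan a := by
  have hmono : MonotoneOn (fun x => Real.arctan x - x / (1 + b ^ 2)) (Set.Icc a b) := by
    apply monotoneOn_of_deriv_nonneg (convex_Icc a b)
    · apply Continuous.continuousOn
      exact Real.continuous_arctan.sub (continuous_id.div_const _)
    · intro x _
      exact (Real.differentiableAt_arctan x).sub (differentiableAt_id.div_const _) |>.differentiableWithinAt
    · intro x hx
      rw [interior_Icc] at hx
      have : deriv (fun x => Real.arctan x - x / (1 + b ^ 2)) x = 1 / (1 + x ^ 2) - 1 / (1 + b ^ 2) :=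
        ((Real.hasDerivAt_arctan x).sub ((hasDerivAt_id x).div_const _)).deriv
      rw [this, sub_nonneg]
      apply one_div_le_one_div_of_le (by positivity)
      nlinarith [hx.1, hx.2]
  have := hmono (Set.left_mem_Icc.2 hab) (Set.right_mem_Icc.2 hab) hab
  simp only at this
  have e : (b - a) / (1 + b ^ 2) = b / (1 + b ^ 2) - a / (1 + b ^ 2) := by ring
  linarith

lemma inner_sum_le (k n : ℕ) (hk : 0 < k) :
    ∑ j ∈ Finset.range (n + 1), 1 / ((k : ℝ) ^ 2 + (j : ℝ) ^ 2) ≤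
      1 / (k : ℝ) ^ 2 + Real.arctan (n / k) / k := by
  have hk' : (0 : ℝ) < k := by exact_mod_cast hk
  induction n with
  | zero => simp
  | succ n ih =>
    rw [Finset.sum_range_succ]
    have h := arctan_diff_ge (n / k) ((n + 1 : ℕ) / k) (by positivity)
      (by gcongr; simp)
    have e : ((n + 1 : ℕ) / (k : ℝ) - n / k) / (1 + ((n + 1 : ℕ) / (k : ℝ)) ^ 2) =
        k * (1 / ((k : ℝ) ^ 2 + ((n + 1 : ℕ) : ℝ) ^ 2)) := by
      push_cast; field_simp; ring
    rw [e] at h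
    have h2 : 1 / ((k : ℝ) ^ 2 + ((n + 1 : ℕ) : ℝ) ^ 2) ≤
        (Real.arctan ((n + 1 : ℕ) / k) - Real.arctan (n / k)) / k := by
      rw [le_div_iff₀ hk']; linarith
    rw [sub_div] at h2
    linarith

lemma inv_sq_sum_le' (n : ℕ) : ∑ j ∈ Finset.range (n + 2), 1 / ((j : ℝ) ^ 2) ≤ 2 - 1 / ((n : ℝ) + 1) := by
  induction n with
  | zero => simp [Finset.sum_range_succ]; norm_num
  | succ n ih =>
    rw [Finset.sum_range_succ]
    have : 1 / (((n + 2 : ℕ) : ℝ)) ^ 2 ≤ 1 / ((n : ℝ) + 1) - 1 / (((n + 1 : ℕ) : ℝ) + 1) := by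
      push_cast
      rw [div_sub_div _ _ (by positivity) (by positivity), div_le_div_iff₀ (by positivity) (by positivity)]
      nlinarith [(Nat.cast_nonneg n : (0 : ℝ) ≤ n)]
    linarith

lemma inv_sq_sum_le (m : ℕ) : ∑ j ∈ Finset.range m, 1 / ((j : ℝ) ^ 2) ≤ 2 := by
  have h1 : ∑ j ∈ Finset.range m, 1 / ((j : ℝ) ^ 2) ≤ ∑ j ∈ Finset.range (m + 2), 1 / ((j : ℝ) ^ 2) :=
    Finset.sum_le_sum_of_subset_of_nonneg (Finset.range_mono (by omega)) (fun _ _ _ => by positivity)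
  have h2 := inv_sq_sum_le' m
  have : (0 : ℝ) ≤ 1 / (m + 1) := by positivity
  linarith

lemma inv_sum_le (m : ℕ) (hm : 0 < m) : ∑ j ∈ Finset.range m, 1 / (j : ℝ) ≤ 1 + Real.log m := by
  obtain ⟨n, rfl⟩ : ∃ n, m = n + 1 := ⟨m - 1, by omega⟩
  have h := harmonic_le_one_add_log n
  rw [Finset.sum_range_succ']
  have e : ((harmonic n : ℚ) : ℝ) = ∑ j ∈ Finset.range n, 1 / ((j + 1 : ℕ) : ℝ) := by
    simp [harmonic]
  rw [← e]
  simp only [Nat.cast_zero, div_zero, add_zero]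
  refine h.trans ?_
  rcases Nat.eq_zero_or_pos n with rfl | hn
  · simp
  · have hn' : (0 : ℝ) < n := by exact_mod_cast hn
    have := Real.log_le_log hn' (by push_cast; linarith : (n : ℝ) ≤ ((n + 1 : ℕ) : ℝ))
    linarith

lemma latt_sum_le (m : ℕ) (hm : 0 < m) :
    ∑ k ∈ sqI m, 1 / ((k.1 : ℝ) ^ 2 + (k.2 : ℝ) ^ 2) ≤ Real.pi / 2 * Real.log m + 6 := by
  obtain ⟨n, rfl⟩ : ∃ n, m = n + 1 := ⟨m - 1, by omega⟩
  have hpi := Real.pi_pos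
  unfold sqI
  rw [Finset.sum_product]
  have key : ∀ k ∈ Finset.range (n + 1), ∑ j ∈ Finset.range (n + 1), 1 / ((k : ℝ) ^ 2 + (j : ℝ) ^ 2) ≤
      (if k = 0 then 2 else 0) + (1 / (k : ℝ) ^ 2 + Real.pi / 2 * (1 / k)) := by
    intro k _
    by_cases hk : k = 0
    · subst hk
      have := inv_sq_sum_le (n + 1)
      simpa using this
    · rw [if_neg hk, zero_add]
      have h := inner_sum_le k n (by omega)
      have h2 := (Real.arctan_lt_pi_div_two (n / k)).le
      have h3 : Real.arctan (n / k) / k ≤ Real.pi / 2 * (1 / k) := by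
        rw [mul_one_div]; gcongr
      linarith
  refine (Finset.sum_le_sum key).trans ?_
  rw [Finset.sum_add_distrib, Finset.sum_add_distrib, ← Finset.mul_sum]
  have h1 := inv_sq_sum_le (n + 1)
  have h2 := inv_sum_le (n + 1) hm
  have h3 : ∑ k ∈ Finset.range (n + 1), (if k = 0 then (2 : ℝ) else 0) = 2 := by simp
  rw [h3]
  have h4 : Real.pi / 2 * ∑ j ∈ Finset.range (n + 1), 1 / (j : ℝ) ≤ Real.pi / 2 * (1 + Real.log (n + 1 : ℕ)) := by
    gcongr
  have := Real.pi_lt_four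
  linarith

lemma lamF_ge1 (m k : ℕ) (hk : k < m) : 4 * ((k : ℝ) / m) ^ 2 ≤ lamF m k := by
  have hm : (0 : ℝ) < m := by exact_mod_cast (by omega : 0 < m)
  have hk' : (k : ℝ) ≤ m := by exact_mod_cast hk.le
  have hpi := Real.pi_pos
  have h := Real.mul_le_sin (x := thF m k) (by unfold thF; positivity)
    (by unfold thF; rw [div_le_div_iff₀ (by positivity) (by positivity)]; nlinarith)
  have e : 2 / Real.pi * thF m k = k / m := by unfold thF; field_simp
  rw [e] at h
  unfold lamF
  have : (0 : ℝ) ≤ (k : ℝ) / m := by positivity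
  nlinarith

lemma lamF_ge2 (ε c : ℝ) (hε : 0 < ε) (hc : 0 < c) (hc1 : c ≤ 1 / 2) (hcε : 1 ≤ (1 + ε) * (1 - 2 * c ^ 2))
    (m k : ℕ) (hm : 0 < m) (hk : (k : ℝ) ≤ c * m) :
    Real.pi ^ 2 * (k : ℝ) ^ 2 / (m : ℝ) ^ 2 ≤ (1 + ε) * lamF m k := by
  have hm' : (0 : ℝ) < m := by exact_mod_cast hm
  have hpi := Real.pi_pos
  have hpi4 := Real.pi_lt_four
  set x := thF m k with hx
  have hx0 : 0 ≤ x := by rw [hx]; unfold thF; positivity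
  have hkm : (k : ℝ) / m ≤ c := by rw [div_le_iff₀ hm']; exact hk
  have ex : x = Real.pi / 2 * (k / m) := by rw [hx]; unfold thF; ring
  have hxc : x ≤ 2 * c := by
    rw [ex]; have : (0 : ℝ) ≤ k / m := by positivity
    nlinarith
  have e : Real.pi ^ 2 * (k : ℝ) ^ 2 / (m : ℝ) ^ 2 = 4 * x ^ 2 := by rw [ex]; ring
  rw [e]; unfold lamF; rw [← hx]
  rcases hx0.eq_or_lt with h0 | h0
  · rw [← h0]; simp
  · have hs := (Real.sin_gt_sub_cube h0).le
    have h1 : x * (1 - x ^ 2 / 4) ≤ Real.sin x := by nlinarith [pow_pos h0 3]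
    have hp : 0 ≤ 1 - x ^ 2 / 4 := by nlinarith
    have h2 : (x * (1 - x ^ 2 / 4)) ^ 2 ≤ Real.sin x ^ 2 := by
      apply pow_le_pow_left₀ (by positivity) h1
    have h3 : x ^ 2 * (1 - 2 * c ^ 2) ≤ (x * (1 - x ^ 2 / 4)) ^ 2 := by
      rw [mul_pow]
      apply mul_le_mul_of_nonneg_left _ (sq_nonneg x)
      nlinarith [sq_nonneg (x ^ 2)]
    have h4 : x ^ 2 * 1 ≤ x ^ 2 * ((1 + ε) * (1 - 2 * c ^ 2)) := by gcongr
    nlinarith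

lemma Lam_sum_le (ε : ℝ) (hε : 0 < ε) : ∃ C : ℝ, 0 ≤ C ∧ ∀ m : ℕ, 0 < m →
    ∑ k ∈ sqI m, 1 / LamF m k ≤ (m : ℝ) ^ 2 * ((1 + ε) * Real.log m / (2 * Real.pi) + C) := by
  obtain ⟨c, hc, hc1, hcε⟩ : ∃ c : ℝ, 0 < c ∧ c ≤ 1 / 2 ∧ 1 ≤ (1 + ε) * (1 - 2 * c ^ 2) := by
    refine ⟨min (1 / 2) (ε / (2 * (1 + ε))), by positivity, min_le_left _ _, ?_⟩
    set c := min (1 / 2) (ε / (2 * (1 + ε))) with hcd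
    have h1 : c ≤ 1 / 2 := min_le_left _ _
    have h2 : c ≤ ε / (2 * (1 + ε)) := min_le_right _ _
    have h0 : 0 < c := by positivity
    have h3 : c * (2 * (1 + ε)) ≤ ε := by rwa [le_div_iff₀ (by positivity)] at h2
    nlinarith
  refine ⟨(1 + ε) / Real.pi ^ 2 * 6 + 1 / (4 * c ^ 2), by positivity, fun m hm => ?_⟩
  have hm' : (0 : ℝ) < m := by exact_mod_cast hm
  have hpi := Real.pi_pos
  have key : ∀ k ∈ sqI m, 1 / LamF m k ≤
      (1 + ε) * (m : ℝ) ^ 2 / Real.pi ^ 2 * (1 / ((k.1 : ℝ) ^ 2 + (k.2 : ℝ) ^ 2)) + 1 / (4 * c ^ 2) := by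
    intro k hk
    by_cases h0 : k = (0, 0)
    · subst h0; rw [LamF_zero]; simp; positivity
    have hpos := LamF_pos m k hk h0
    have hk2 := mem_sqI.1 hk
    have hl1 := lamF_nonneg m k.1
    have hl2 := lamF_nonneg m k.2
    by_cases hsm : (k.1 : ℝ) ≤ c * m ∧ (k.2 : ℝ) ≤ c * m
    · have h1 := lamF_ge2 ε c hε hc hc1 hcε m k.1 hm hsm.1
      have h2 := lamF_ge2 ε c hε hc hc1 hcε m k.2 hm hsm.2
      have hk0 : 0 < (k.1 : ℝ) ^ 2 + (k.2 : ℝ) ^ 2 := by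
        have : k.1 ≠ 0 ∨ k.2 ≠ 0 := by
          by_contra hcon; push Not at hcon; exact h0 (Prod.ext hcon.1 hcon.2)
        rcases this with h | h
        · have : (0 : ℝ) < k.1 := by exact_mod_cast (by omega : 0 < k.1)
          positivity
        · have : (0 : ℝ) < k.2 := by exact_mod_cast (by omega : 0 < k.2)
          positivity
      have h3 : Real.pi ^ 2 * ((k.1 : ℝ) ^ 2 + (k.2 : ℝ) ^ 2) / (m : ℝ) ^ 2 ≤ (1 + ε) * LamF m k := by
        unfold LamF
        have : Real.pi ^ 2 * ((k.1 : ℝ) ^ 2 + (k.2 : ℝ) ^ 2) / (m : ℝ) ^ 2 =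
          Real.pi ^ 2 * (k.1 : ℝ) ^ 2 / (m : ℝ) ^ 2 + Real.pi ^ 2 * (k.2 : ℝ) ^ 2 / (m : ℝ) ^ 2 := by ring
        linarith
      have h4 : 1 / LamF m k ≤ (1 + ε) * (m : ℝ) ^ 2 / Real.pi ^ 2 * (1 / ((k.1 : ℝ) ^ 2 + (k.2 : ℝ) ^ 2)) := by
        rw [div_mul_div_comm, mul_one, div_le_div_iff₀ hpos (by positivity)]
        rw [div_le_iff₀ (by positivity)] at h3
        linarith
      have : 0 ≤ 1 / (4 * c ^ 2) := by positivity
      linarith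
    · have h1 := lamF_ge1 m k.1 hk2.1
      have h2 := lamF_ge1 m k.2 hk2.2
      have h3 : 4 * c ^ 2 ≤ LamF m k := by
        have aux : ∀ l : ℕ, c * m < l → c ^ 2 ≤ ((l : ℝ) / m) ^ 2 := by
          intro l hl
          apply pow_le_pow_left₀ hc.le
          rw [le_div_iff₀ hm']; exact hl.le
        unfold LamF
        rw [not_and_or, not_le, not_le] at hsm
        rcases hsm with h | h
        · have := aux _ h; linarith
        · have := aux _ h; linarith
      have h4 : 1 / LamF m k ≤ 1 / (4 * c ^ 2) := one_div_le_one_div_of_le (by positivity) h3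
      have : 0 ≤ (1 + ε) * (m : ℝ) ^ 2 / Real.pi ^ 2 * (1 / ((k.1 : ℝ) ^ 2 + (k.2 : ℝ) ^ 2)) := by positivity
      linarith
  refine (Finset.sum_le_sum key).trans ?_
  rw [Finset.sum_add_distrib, ← Finset.mul_sum, Finset.sum_const]
  have hcard : (sqI m).card = m ^ 2 := by simp [sqI, sq]
  rw [hcard, nsmul_eq_mul]
  have h := latt_sum_le m hm
  have h2 : (1 + ε) * (m : ℝ) ^ 2 / Real.pi ^ 2 * ∑ k ∈ sqI m, 1 / ((k.1 : ℝ) ^ 2 + (k.2 : ℝ) ^ 2) ≤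
      (1 + ε) * (m : ℝ) ^ 2 / Real.pi ^ 2 * (Real.pi / 2 * Real.log m + 6) := by gcongr
  refine (add_le_add_left h2 _).trans (le_of_eq ?_)
  push_cast
  field_simp; ring

end Part3

section Part4
lemma iInf_perm_le_doubly {N : ℕ} (c P : Fin N → Fin N → ℝ)
    (hP : Matrix.of P ∈ doublyStochastic ℝ (Fin N)) :
    ⨅ π : Equiv.Perm (Fin N), ∑ i, c i (π i) ≤ ∑ i, ∑ j, P i j * c i j := by
  obtain ⟨w, hw0, hw1, hw⟩ := exists_eq_sum_perm_of_mem_doublyStochastic hP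
  set A := ⨅ π : Equiv.Perm (Fin N), ∑ i, c i (π i) with hA
  have hle : ∀ σ : Equiv.Perm (Fin N), A ≤ ∑ i, c i (σ i) := fun σ =>
    ciInf_le (Set.finite_range _).bddBelow σ
  have hPe : ∀ i j, P i j = ∑ σ : Equiv.Perm (Fin N), w σ * (if σ i = j then 1 else 0) := by
    intro i j
    have h1 : Matrix.of P i j = (∑ σ : Equiv.Perm (Fin N), w σ • σ.permMatrix ℝ) i j := by rw [hw]
    rw [Matrix.of_apply] at h1
    rw [h1, Matrix.sum_apply]
    refine Finset.sum_congr rfl fun σ _ => ?_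
    rw [Matrix.smul_apply, smul_eq_mul]
    congr 1
    simp [Equiv.Perm.permMatrix, PEquiv.toMatrix_apply, eq_comm]
  have h1 : ∑ i, ∑ j, P i j * c i j = ∑ σ : Equiv.Perm (Fin N), w σ * ∑ i, c i (σ i) := by
    simp_rw [hPe, Finset.sum_mul]
    calc _ = ∑ i, ∑ σ : Equiv.Perm (Fin N), ∑ j, w σ * (if σ i = j then 1 else 0) * c i j :=
          Finset.sum_congr rfl fun i _ => Finset.sum_comm
      _ = ∑ σ : Equiv.Perm (Fin N), ∑ i, ∑ j, w σ * (if σ i = j then 1 else 0) * c i j :=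
          Finset.sum_comm
      _ = _ := by
          refine Finset.sum_congr rfl fun σ _ => ?_
          rw [Finset.mul_sum]
          refine Finset.sum_congr rfl fun i _ => ?_
          simp
  rw [h1]
  calc A = ∑ σ : Equiv.Perm (Fin N), w σ * A := by rw [← Finset.sum_mul, hw1, one_mul]
    _ ≤ _ := Finset.sum_le_sum fun σ _ => mul_le_mul_of_nonneg_left (hle σ) (hw0 σ)

/-- squared distance in the plane -/
def d2 (u v : ℝ × ℝ) : ℝ := (u.1 - v.1) ^ 2 + (u.2 - v.2) ^ 2

lemma d2_nonneg (u v : ℝ × ℝ) : 0 ≤ d2 u v := by unfold d2; positivity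

lemma measurable_d2 : Measurable (fun p : (ℝ × ℝ) × (ℝ × ℝ) => d2 p.1 p.2) := by
  unfold d2; fun_prop

lemma sq_three (ε : ℝ) (hε : 0 < ε) (a b c : ℝ) :
    (a + b + c) ^ 2 ≤ (1 + ε) * b ^ 2 + (2 * (1 + 1 / ε)) * (a ^ 2 + c ^ 2) := by
  have h1 : 2 * (b * (a + c)) ≤ ε * b ^ 2 + 1 / ε * (a + c) ^ 2 := by
    have := sq_nonneg (ε * b - (a + c))
    have h2 : 0 ≤ (1 / ε) * (ε * b - (a + c)) ^ 2 := by positivity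
    have h3 : (1 / ε) * (ε * b - (a + c)) ^ 2 = ε * b ^ 2 - 2 * (b * (a + c)) + 1 / ε * (a + c) ^ 2 := by
      field_simp; ring
    linarith
  have h4 : (a + c) ^ 2 ≤ 2 * (a ^ 2 + c ^ 2) := by nlinarith [sq_nonneg (a - c)]
  have h5 : (1 + 1 / ε) * (a + c) ^ 2 ≤ (1 + 1 / ε) * (2 * (a ^ 2 + c ^ 2)) := by gcongr
  nlinarith

lemma d2_three (ε : ℝ) (hε : 0 < ε) (x u v y : ℝ × ℝ) :
    d2 x y ≤ (1 + ε) * d2 u v + (2 * (1 + 1 / ε)) * (d2 x u + d2 y v) := by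
  have h1 := sq_three ε hε (x.1 - u.1) (u.1 - v.1) (v.1 - y.1)
  have h2 := sq_three ε hε (x.2 - u.2) (u.2 - v.2) (v.2 - y.2)
  unfold d2
  have e1 : x.1 - u.1 + (u.1 - v.1) + (v.1 - y.1) = x.1 - y.1 := by ring
  have e2 : x.2 - u.2 + (u.2 - v.2) + (v.2 - y.2) = x.2 - y.2 := by ring
  rw [e1] at h1; rw [e2] at h2
  nlinarith

lemma density_sum_one {N : ℕ} (α : Measure (ℝ × ℝ)) [IsFiniteMeasure α]
    (κ : Fin N → Measure (ℝ × ℝ)) (hα : ∑ i, κ i = α) :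
    (∀ i, α.withDensity ((κ i).rnDeriv α) = κ i) ∧ ∀ᵐ u ∂α, ∑ i, (κ i).rnDeriv α u = 1 := by
  have hle : ∀ i, κ i ≤ α := by
    intro i
    rw [← hα]
    intro s
    rw [Measure.finsetSum_apply]
    exact Finset.single_le_sum (f := fun i => κ i s) (fun _ _ => zero_le) (Finset.mem_univ i)
  have hfin : ∀ i, IsFiniteMeasure (κ i) := fun i => isFiniteMeasure_of_le α (hle i)
  have h1 : ∀ i, α.withDensity ((κ i).rnDeriv α) = κ i := fun i =>
    Measure.withDensity_rnDeriv_eq _ _ (Measure.absolutelyContinuous_of_le (hle i))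
  refine ⟨h1, ?_⟩
  have hm : ∀ i, Measurable ((κ i).rnDeriv α) := fun i => Measure.measurable_rnDeriv _ _
  have h2 : α.withDensity (fun u => ∑ i, (κ i).rnDeriv α u) = α.withDensity 1 := by
    rw [withDensity_one]
    ext s hs
    rw [withDensity_apply _ hs, lintegral_finsetSum _ (fun i _ => hm i)]
    conv_rhs => rw [← hα]
    rw [Measure.finsetSum_apply]
    refine Finset.sum_congr rfl fun i _ => ?_
    conv_rhs => rw [← h1 i]
    rw [withDensity_apply _ hs]
  have h3 := (withDensity_eq_iff (μ := α) (f := fun u => ∑ i, (κ i).rnDeriv α u) (g := 1)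
    (by fun_prop) (by fun_prop) (by
      rw [← setLIntegral_univ, ← withDensity_apply _ MeasurableSet.univ, h2, withDensity_one]
      exact measure_ne_top _ _)).1 h2
  filter_upwards [h3] with u hu using hu

lemma glue {N : ℕ} (X Y : Fin N → ℝ × ℝ) (α : Measure (ℝ × ℝ)) [IsFiniteMeasure α]
    (κ κ' : Fin N → Measure (ℝ × ℝ)) (hκ : ∀ i, κ i Set.univ = 1) (hκ' : ∀ i, κ' i Set.univ = 1)
    (T : ℝ × ℝ → ℝ × ℝ) (hT : Measurable T) (hα : ∑ i, κ i = α) (hβ : ∑ i, κ' i = α.map T)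
    (ε : ℝ) (hε : 0 < ε) :
    ENNReal.ofReal (⨅ π : Equiv.Perm (Fin N), ∑ i, d2 (X i) (Y (π i))) ≤
      ENNReal.ofReal (1 + ε) * ∫⁻ u, ENNReal.ofReal (d2 u (T u)) ∂α +
      ENNReal.ofReal (2 * (1 + 1 / ε)) * (∑ i, ∫⁻ u, ENNReal.ofReal (d2 (X i) u) ∂(κ i) +
        ∑ i, ∫⁻ u, ENNReal.ofReal (d2 (Y i) u) ∂(κ' i)) := by
  set β := α.map T with hβd
  have : IsFiniteMeasure β := by rw [hβd]; infer_instance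
  obtain ⟨hd, hs⟩ := density_sum_one α κ hα
  obtain ⟨hd', hs'⟩ := density_sum_one β κ' hβ
  set w : Fin N → ℝ × ℝ → ℝ≥0∞ := fun i => (κ i).rnDeriv α with hw
  set w' : Fin N → ℝ × ℝ → ℝ≥0∞ := fun i => (κ' i).rnDeriv β with hw'
  have hm : ∀ i, Measurable (w i) := fun i => Measure.measurable_rnDeriv _ _
  have hm' : ∀ i, Measurable (w' i) := fun i => Measure.measurable_rnDeriv _ _
  have hs'' : ∀ᵐ u ∂α, ∑ i, w' i (T u) = 1 := ae_of_ae_map hT.aemeasurable hs'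
  have hmT : ∀ i, Measurable (fun u => w' i (T u)) := fun i => (hm' i).comp hT
  have hmm : ∀ i j, Measurable (fun u => w i u * w' j (T u)) := fun i j => (hm i).mul (hmT j)
  have hI : ∀ i (f : ℝ × ℝ → ℝ≥0∞), Measurable f → ∫⁻ u, w i u * f u ∂α = ∫⁻ u, f u ∂(κ i) := by
    intro i f hf
    conv_rhs => rw [← hd i]
    rw [lintegral_withDensity_eq_lintegral_mul _ (hm i) hf]; rfl
  have hI' : ∀ i (f : ℝ × ℝ → ℝ≥0∞), Measurable f →
      ∫⁻ u, w' i (T u) * f (T u) ∂α = ∫⁻ u, f u ∂(κ' i) := by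
    intro i f hf
    conv_rhs => rw [← hd' i]
    rw [lintegral_withDensity_eq_lintegral_mul _ (hm' i) hf, hβd, lintegral_map ((hm' i).mul hf) hT]
    rfl
  set P : Fin N → Fin N → ℝ≥0∞ := fun i j => ∫⁻ u, w i u * w' j (T u) ∂α with hP
  have hrow : ∀ i, ∑ j, P i j = 1 := by
    intro i
    rw [hP]
    simp only
    rw [← lintegral_finsetSum _ (fun j _ => hmm i j), ← hκ i, ← lintegral_one,
      ← hI i (fun _ => 1) measurable_const]
    apply lintegral_congr_ae
    filter_upwards [hs''] with u hu
    rw [← Finset.mul_sum, hu]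
  have hcol : ∀ j, ∑ i, P i j = 1 := by
    intro j
    rw [hP]
    simp only
    rw [← lintegral_finsetSum _ (fun i _ => hmm i j), ← hκ' j, ← lintegral_one,
      ← hI' j (fun _ => 1) measurable_const]
    apply lintegral_congr_ae
    filter_upwards [hs] with u hu
    rw [← Finset.sum_mul, hu, one_mul, mul_one]
  have hPfin : ∀ i j, P i j ≠ ∞ := by
    intro i j
    have : P i j ≤ 1 := by
      rw [← hrow i]; exact Finset.single_le_sum (f := fun j => P i j) (fun _ _ => zero_le) (Finset.mem_univ j)
    exact ne_top_of_le_ne_top ENNReal.one_ne_top this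
  have hds : (Matrix.of fun i j => (P i j).toReal) ∈ doublyStochastic ℝ (Fin N) := by
    rw [mem_doublyStochastic_iff_sum]
    refine ⟨fun i j => ENNReal.toReal_nonneg, fun i => ?_, fun j => ?_⟩
    · simp only [Matrix.of_apply]
      rw [← ENNReal.toReal_sum (fun j _ => hPfin i j), hrow]; simp
    · simp only [Matrix.of_apply]
      rw [← ENNReal.toReal_sum (fun i _ => hPfin i j), hcol]; simp
  have hB := iInf_perm_le_doubly (fun i j => d2 (X i) (Y j)) (fun i j => (P i j).toReal) hds
  refine (ENNReal.ofReal_le_ofReal hB).trans ?_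
  have e1 : ENNReal.ofReal (∑ i, ∑ j, (P i j).toReal * d2 (X i) (Y j)) =
      ∑ i, ∑ j, ∫⁻ u, w i u * w' j (T u) * ENNReal.ofReal (d2 (X i) (Y j)) ∂α := by
    rw [ENNReal.ofReal_sum_of_nonneg
      (fun i _ => Finset.sum_nonneg fun j _ => mul_nonneg ENNReal.toReal_nonneg (d2_nonneg _ _))]
    refine Finset.sum_congr rfl fun i _ => ?_
    rw [ENNReal.ofReal_sum_of_nonneg
      (fun j _ => mul_nonneg ENNReal.toReal_nonneg (d2_nonneg _ _))]
    refine Finset.sum_congr rfl fun j _ => ?_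
    rw [ENNReal.ofReal_mul ENNReal.toReal_nonneg, ENNReal.ofReal_toReal (hPfin i j),
      lintegral_mul_const _ (hmm i j)]
  rw [e1]
  have hdX : ∀ i, Measurable fun u => ENNReal.ofReal (d2 (X i) u) := fun i => by
    unfold d2; fun_prop
  have hdY : ∀ i, Measurable fun u => ENNReal.ofReal (d2 (Y i) u) := fun i => by
    unfold d2; fun_prop
  have hdT : Measurable fun u => ENNReal.ofReal (d2 u (T u)) := by
    unfold d2; fun_prop
  have e2 : ∑ i, ∑ j, ∫⁻ u, w i u * w' j (T u) * ENNReal.ofReal (d2 (X i) (Y j)) ∂α =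
      ∫⁻ u, ∑ i, ∑ j, w i u * w' j (T u) * ENNReal.ofReal (d2 (X i) (Y j)) ∂α := by
    have hq : ∀ i j, Measurable (fun u => w i u * w' j (T u) * ENNReal.ofReal (d2 (X i) (Y j))) :=
      fun i j => (hmm i j).mul_const _
    rw [lintegral_finsetSum _ (fun i _ => Finset.measurable_fun_sum _ fun j _ => hq i j)]
    refine Finset.sum_congr rfl fun i _ => ?_
    rw [lintegral_finsetSum _ (fun j _ => hq i j)]
  rw [e2]
  set c1 := ENNReal.ofReal (1 + ε)
  set c2 := ENNReal.ofReal (2 * (1 + 1 / ε)) with hc2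
  have hpt : ∀ᵐ u ∂α, ∑ i, ∑ j, w i u * w' j (T u) * ENNReal.ofReal (d2 (X i) (Y j)) ≤
      c1 * ENNReal.ofReal (d2 u (T u)) + c2 * (∑ i, w i u * ENNReal.ofReal (d2 (X i) u) +
        ∑ j, w' j (T u) * ENNReal.ofReal (d2 (Y j) (T u))) := by
    filter_upwards [hs, hs''] with u hu hu'
    have hb : ∀ i j, ENNReal.ofReal (d2 (X i) (Y j)) ≤ c1 * ENNReal.ofReal (d2 u (T u)) +
        c2 * (ENNReal.ofReal (d2 (X i) u) + ENNReal.ofReal (d2 (Y j) (T u))) := by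
      intro i j
      rw [← ENNReal.ofReal_add (d2_nonneg _ _) (d2_nonneg _ _), ← ENNReal.ofReal_mul (by positivity),
        ← ENNReal.ofReal_mul (by positivity),
        ← ENNReal.ofReal_add (mul_nonneg (by positivity) (d2_nonneg _ _))
          (mul_nonneg (by positivity) (add_nonneg (d2_nonneg _ _) (d2_nonneg _ _)))]
      exact ENNReal.ofReal_le_ofReal (d2_three ε hε _ _ _ _)
    calc _ ≤ ∑ i, ∑ j, w i u * w' j (T u) * (c1 * ENNReal.ofReal (d2 u (T u)) +
        c2 * (ENNReal.ofReal (d2 (X i) u) + ENNReal.ofReal (d2 (Y j) (T u)))) := by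
          gcongr with i _ j _; exact hb i j
      _ = ∑ i, (w i u * (c1 * ENNReal.ofReal (d2 u (T u)) + c2 * ENNReal.ofReal (d2 (X i) u)) * ∑ j, w' j (T u)
          + w i u * (c2 * ∑ j, w' j (T u) * ENNReal.ofReal (d2 (Y j) (T u)))) := by
          refine Finset.sum_congr rfl fun i _ => ?_
          rw [Finset.mul_sum, Finset.mul_sum, Finset.mul_sum, ← Finset.sum_add_distrib]
          refine Finset.sum_congr rfl fun j _ => by ring
      _ = _ := by
          have hu2 : ∑ i, w i u = 1 := hu
          rw [hu']
          simp only [mul_one]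
          rw [Finset.sum_add_distrib, ← Finset.sum_mul Finset.univ (fun i => w i u)
            (c2 * ∑ j, w' j (T u) * ENNReal.ofReal (d2 (Y j) (T u))), hu2, one_mul]
          simp only [mul_add, Finset.sum_add_distrib]
          rw [← Finset.sum_mul Finset.univ (fun i => w i u), hu2, one_mul, add_assoc]
          congr 2
          rw [Finset.mul_sum]
          refine Finset.sum_congr rfl fun i _ => by ring
  have hA : ∀ i, Measurable (fun u => w i u * ENNReal.ofReal (d2 (X i) u)) := fun i =>
    (hm i).mul (hdX i)
  have hB' : ∀ i, Measurable (fun u => w' i (T u) * ENNReal.ofReal (d2 (Y i) (T u))) := fun i =>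
    (hmT i).mul ((hdY i).comp hT)
  have hAs : Measurable (fun u => ∑ i, w i u * ENNReal.ofReal (d2 (X i) u)) :=
    Finset.measurable_fun_sum _ fun i _ => hA i
  have hBs : Measurable (fun u => ∑ i, w' i (T u) * ENNReal.ofReal (d2 (Y i) (T u))) :=
    Finset.measurable_fun_sum _ fun i _ => hB' i
  have hABs : Measurable (fun u => (∑ i, w i u * ENNReal.ofReal (d2 (X i) u)) +
      ∑ i, w' i (T u) * ENNReal.ofReal (d2 (Y i) (T u))) := hAs.add hBs
  refine (lintegral_mono_ae hpt).trans (le_of_eq ?_)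
  rw [lintegral_add_left (hdT.const_mul _), lintegral_const_mul _ hdT,
    lintegral_const_mul _ hABs, lintegral_add_left hAs,
    lintegral_finsetSum _ (fun i _ => hA i), lintegral_finsetSum _ (fun i _ => hB' i)]
  congr 3
  · exact Finset.sum_congr rfl fun i _ => hI i _ (hdX i)
  · exact Finset.sum_congr rfl fun i _ => hI' i _ (hdY i)

end Part4

section Part5
/-! ### One dimensional transport -/

def clp (t : ℝ) : ℝ := max 0 (min 1 t)

lemma clp_mono : Monotone clp := by
  intro a b h; unfold clp; gcongr
lemma clp_cont : Continuous clp := by unfold clp; fun_prop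
lemma clp_nonneg (t : ℝ) : 0 ≤ clp t := le_max_left _ _
lemma clp_le (t : ℝ) : clp t ≤ 1 := by unfold clp; simp
lemma clp_one {t : ℝ} (h : 1 ≤ t) : clp t = 1 := by unfold clp; simp [h]
lemma clp_zero {t : ℝ} (h : t ≤ 0) : clp t = 0 := by
  unfold clp; rw [min_eq_right (by linarith), max_eq_left h]
lemma clp_self {t : ℝ} (h : 0 ≤ t) (h1 : t ≤ 1) : clp t = t := by
  unfold clp; rw [min_eq_right h1, max_eq_right h]

lemma sum_clp (h : ℕ → ℝ) (G i : ℕ) (hi : i < G) (x : ℝ) (hx : (i : ℝ) ≤ x) (hx1 : x ≤ i + 1) :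
    ∑ j ∈ Finset.range G, h j * clp (x - j) = ∑ j ∈ Finset.range i, h j + h i * (x - i) := by
  induction G, hi using Nat.le_induction with
  | base =>
    rw [Finset.sum_range_succ, clp_self (by linarith) (by linarith)]
    congr 1
    refine Finset.sum_congr rfl fun j hj => ?_
    have : (j : ℝ) + 1 ≤ i := by exact_mod_cast Finset.mem_range.1 hj
    rw [clp_one (by linarith), mul_one]
  | succ n hn ih =>
    rw [Finset.sum_range_succ, ih, clp_zero, mul_zero, add_zero]
    have : (i : ℝ) + 1 ≤ n := by exact_mod_cast hn
    linarith

def FF (G : ℕ) (c : ℝ) (f : ℕ → ℝ) (x : ℝ) : ℝ :=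
  c * x + ∑ j ∈ Finset.range G, (f j - c) * clp (x - j)

def nu (G : ℕ) (f : ℕ → ℝ) : Measure ℝ :=
  ∑ i ∈ Finset.range G, ENNReal.ofReal (f i) • (volume.restrict (Set.Ico (i : ℝ) (i + 1)))

lemma FF_on (G : ℕ) (c : ℝ) (f : ℕ → ℝ) (i : ℕ) (hi : i < G) (x : ℝ) (hx : (i : ℝ) ≤ x)
    (hx1 : x ≤ i + 1) : FF G c f x = ∑ j ∈ Finset.range i, f j + f i * (x - i) := by
  unfold FF
  rw [sum_clp _ G i hi x hx hx1, Finset.sum_sub_distrib]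
  simp; ring

lemma FF_strictMono (G : ℕ) (c : ℝ) (hc : 0 < c) (f : ℕ → ℝ) (hf : ∀ j < G, c ≤ f j) :
    StrictMono (FF G c f) := by
  intro x y h
  unfold FF
  apply add_lt_add_of_lt_of_le (by gcongr)
  refine Finset.sum_le_sum fun j hj => ?_
  have := hf j (Finset.mem_range.1 hj)
  exact mul_le_mul_of_nonneg_left (clp_mono (by linarith)) (by linarith)

lemma FF_cont (G : ℕ) (c : ℝ) (f : ℕ → ℝ) : Continuous (FF G c f) := by
  unfold FF
  have := clp_cont
  fun_prop

lemma FF_surj (G : ℕ) (c : ℝ) (hc : 0 < c) (f : ℕ → ℝ) (hf : ∀ j < G, c ≤ f j) :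
    Function.Surjective (FF G c f) := by
  have h1 : ∀ x, c * x ≤ FF G c f x := by
    intro x
    unfold FF
    have : 0 ≤ ∑ j ∈ Finset.range G, (f j - c) * clp (x - j) :=
      Finset.sum_nonneg fun j hj => mul_nonneg (by linarith [hf j (Finset.mem_range.1 hj)]) (clp_nonneg _)
    linarith
  have h2 : ∀ x, FF G c f x ≤ c * x + ∑ j ∈ Finset.range G, (f j - c) := by
    intro x
    unfold FF
    have : ∑ j ∈ Finset.range G, (f j - c) * clp (x - j) ≤ ∑ j ∈ Finset.range G, (f j - c) :=
      Finset.sum_le_sum fun j hj =>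
        mul_le_of_le_one_right (by linarith [hf j (Finset.mem_range.1 hj)]) (clp_le _)
    linarith
  refine (FF_cont G c f).surjective ?_ ?_
  · exact tendsto_atTop_mono h1 (tendsto_id.const_mul_atTop hc)
  · refine tendsto_atBot_mono h2 (tendsto_atBot_add_const_right _ _ (tendsto_id.const_mul_atBot hc))

lemma map_piece (c0 : ℝ) (hc0 : 0 < c0) (S i : ℝ) :
    (ENNReal.ofReal c0 • (volume.restrict (Set.Ico i (i + 1)))).map (fun x => S + c0 * (x - i)) =
      volume.restrict (Set.Ico S (S + c0)) := by
  have hm : Measurable (fun x : ℝ => S + c0 * (x - i)) := by fun_prop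
  ext s hs
  rw [Measure.map_apply hm hs, Measure.smul_apply, Measure.restrict_apply (hm hs),
    Measure.restrict_apply hs, smul_eq_mul]
  have e : (fun x : ℝ => S + c0 * (x - i)) ⁻¹' s ∩ Set.Ico i (i + 1) =
      (fun x => c0 * x) ⁻¹' ((fun x => x + (S - c0 * i)) ⁻¹' (s ∩ Set.Ico S (S + c0))) := by
    ext x
    simp only [Set.mem_inter_iff, Set.mem_preimage, Set.mem_Ico]
    have : c0 * x + (S - c0 * i) = S + c0 * (x - i) := by ring
    rw [this]
    refine and_congr Iff.rfl (and_congr ?_ ?_)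
    · constructor
      · intro h; nlinarith
      · intro h; by_contra h'; push Not at h'; nlinarith
    · constructor
      · intro h; nlinarith
      · intro h; by_contra h'; push Not at h'; nlinarith
  rw [e, Real.volume_preimage_mul_left hc0.ne', measure_preimage_add_right, ← mul_assoc,
    ← ENNReal.ofReal_mul hc0.le, abs_of_pos (by positivity), mul_inv_cancel₀ hc0.ne']
  simp

lemma sum_restrict (f : ℕ → ℝ) (G : ℕ) (hf : ∀ j < G, 0 < f j) :
    ∑ i ∈ Finset.range G, (volume : Measure ℝ).restrict (Set.Ico (∑ j ∈ Finset.range i, f j)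
      (∑ j ∈ Finset.range i, f j + f i)) =
      volume.restrict (Set.Ico 0 (∑ j ∈ Finset.range G, f j)) := by
  induction G with
  | zero => simp
  | succ n ih =>
    rw [Finset.sum_range_succ, ih (fun j hj => hf j (by omega)), ← Measure.restrict_union,
      Set.Ico_union_Ico_eq_Ico, Finset.sum_range_succ]
    · exact Finset.sum_nonneg fun j hj => (hf j (by have := Finset.mem_range.1 hj; omega)).le
    · linarith [hf n (by omega)]
    · rw [Set.disjoint_left]
      intro x hx hx'
      exact absurd hx.2 (not_lt.2 hx'.1)
    · exact measurableSet_Ico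

lemma map_fsum {α β ι : Type*} [MeasurableSpace α] [MeasurableSpace β] (s : Finset ι)
    (ν : ι → Measure α) (f : α → β) (hf : Measurable f) :
    (∑ i ∈ s, ν i).map f = ∑ i ∈ s, (ν i).map f := by
  ext t ht
  rw [Measure.map_apply hf ht, Measure.finsetSum_apply, Measure.finsetSum_apply]
  refine Finset.sum_congr rfl fun i _ => ?_
  rw [Measure.map_apply hf ht]

lemma nu_map (G : ℕ) (c : ℝ) (hc : 0 < c) (f : ℕ → ℝ) (hf : ∀ j < G, c ≤ f j) :
    (nu G f).map (FF G c f) = volume.restrict (Set.Ico 0 (∑ j ∈ Finset.range G, f j)) := by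
  rw [← sum_restrict f G (fun j hj => hc.trans_le (hf j hj)), nu,
    map_fsum _ _ _ (FF_cont G c f).measurable]
  refine Finset.sum_congr rfl fun i hi => ?_
  have hi' := Finset.mem_range.1 hi
  rw [← map_piece (f i) (hc.trans_le (hf i hi')) (∑ j ∈ Finset.range i, f j) i]
  apply Measure.map_congr
  refine Measure.ae_smul_measure ?_ _
  filter_upwards [ae_restrict_mem measurableSet_Ico] with x hx
  exact FF_on G c f i hi' x hx.1 hx.2.le

lemma oneD (G : ℕ) (f g : ℕ → ℝ) (c : ℝ) (hc : 0 < c) (hf : ∀ j < G, c ≤ f j)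
    (hg : ∀ j < G, c ≤ g j) (D : ℕ → ℝ) (hD0 : D 0 = 0) (hDG : D G = 0)
    (hD : ∀ j < G, D (j + 1) - D j = f j - g j)
    (η : ℝ) (hη : ∀ p ≤ G, |D p| ≤ c * η) :
    ∃ τ : ℝ → ℝ, Measurable τ ∧ (nu G f).map τ = nu G g ∧
      ∀ i < G, ∀ ℓ : ℝ, 0 < ℓ → (∀ j < G, |(j : ℝ) - i| ≤ η + 1 → ℓ ≤ g j) →
        ∀ x ∈ Set.Ico (i : ℝ) (i + 1),
          ℓ * |τ x - x| ≤ |(1 - (x - i)) * D i + (x - i) * D (i + 1)| := by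
  have hDs : ∀ p ≤ G, D p = ∑ j ∈ Finset.range p, (f j - g j) := by
    intro p
    induction p with
    | zero => simp [hD0]
    | succ p ih =>
      intro hp
      rw [Finset.sum_range_succ, ← ih (by omega), ← hD p (by omega)]; ring
  have hS : ∑ j ∈ Finset.range G, f j = ∑ j ∈ Finset.range G, g j := by
    have := hDs G le_rfl
    rw [hDG, Finset.sum_sub_distrib] at this; linarith
  set Fi := StrictMono.orderIsoOfSurjective (FF G c f) (FF_strictMono G c hc f hf) (FF_surj G c hc f hf)
    with hFi
  set Gi := StrictMono.orderIsoOfSurjective (FF G c g) (FF_strictMono G c hc g hg) (FF_surj G c hc g hg)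
    with hGi
  have hGimeas : Measurable Gi.symm := Gi.symm.monotone.measurable
  have hGG : ∀ y, FF G c g (Gi.symm y) = y := fun y => Gi.apply_symm_apply y
  have hGG' : ∀ y, Gi.symm (FF G c g y) = y := fun y => Gi.symm_apply_apply y
  have hFm := (FF_cont G c f).measurable
  have hGm := (FF_cont G c g).measurable
  refine ⟨fun x => Gi.symm (FF G c f x), hGimeas.comp hFm, ?_, ?_⟩
  · have : (nu G f).map (fun x => Gi.symm (FF G c f x)) = ((nu G f).map (FF G c f)).map Gi.symm :=
      (Measure.map_map hGimeas hFm).symm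
    rw [this, nu_map G c hc f hf, hS, ← nu_map G c hc g hg, Measure.map_map hGimeas hGm]
    have : (Gi.symm ∘ FF G c g : ℝ → ℝ) = id := funext hGG'
    rw [this, Measure.map_id]
  · intro i hi ℓ hℓ hlg x hx
    set y := Gi.symm (FF G c f x) with hy
    have hyx : FF G c g y = FF G c f x := hGG _
    have hdiff : FF G c f x - FF G c g x = (1 - (x - i)) * D i + (x - i) * D (i + 1) := by
      rw [FF_on G c f i hi x hx.1 hx.2.le, FF_on G c g i hi x hx.1 hx.2.le, hDs i hi.le,
        hDs (i + 1) hi, Finset.sum_range_succ, Finset.sum_sub_distrib]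
      ring
    set Dx := (1 - (x - i)) * D i + (x - i) * D (i + 1) with hDx
    have hx0 : 0 ≤ x - i := by linarith [hx.1]
    have hx1 : 0 ≤ 1 - (x - i) := by linarith [hx.2]
    have hDxle : |Dx| ≤ c * η := by
      calc |Dx| ≤ |(1 - (x - i)) * D i| + |(x - i) * D (i + 1)| := abs_add_le _ _
        _ = (1 - (x - i)) * |D i| + (x - i) * |D (i + 1)| := by
            rw [abs_mul, abs_mul, abs_of_nonneg hx0, abs_of_nonneg hx1]
        _ ≤ (1 - (x - i)) * (c * η) + (x - i) * (c * η) := by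
            gcongr
            · exact hη _ hi.le
            · exact hη _ hi
        _ = _ := by ring
    have hxG : x ≤ G := by
      have : (i : ℝ) + 1 ≤ G := by exact_mod_cast hi
      linarith [hx.2]
    have hxnn : 0 ≤ x := le_trans (Nat.cast_nonneg i) hx.1
    -- y in [0,G]
    have hF0 : ∀ h : ℕ → ℝ, FF G c h 0 = 0 := by
      intro h
      rw [FF_on G c h 0 (by omega) 0 (by simp) (by simp)]; simp
    have hFG : ∀ h : ℕ → ℝ, FF G c h G = ∑ j ∈ Finset.range G, h j := by
      intro h
      obtain ⟨G', rfl⟩ : ∃ G', G = G' + 1 := ⟨G - 1, by omega⟩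
      rw [FF_on (G' + 1) c h G' (by omega) _ (by push_cast; linarith) (by push_cast; linarith),
        Finset.sum_range_succ]
      push_cast; ring
    have hy0 : 0 ≤ y := by
      rw [← (FF_strictMono G c hc g hg).le_iff_le, hyx, hF0, ← hF0 f]
      exact (FF_strictMono G c hc f hf).monotone hxnn
    have hyG : y ≤ G := by
      rw [← (FF_strictMono G c hc g hg).le_iff_le, hyx, hFG, ← hS, ← hFG f]
      exact (FF_strictMono G c hc f hf).monotone hxG
    have hsc : ∀ t : ℝ, 0 ≤ t → t ≤ G → ∑ j ∈ Finset.range G, clp (t - j) = t := by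
      intro t h0 h1
      have hG : 0 < G := by omega
      have key : ∀ k < G, (k : ℝ) ≤ t → t ≤ k + 1 → ∑ j ∈ Finset.range G, clp (t - j) = t := by
        intro k hk h2 h3
        have := sum_clp (fun _ => 1) G k hk t h2 h3
        simp at this
        exact this
      rcases h1.lt_or_eq with h1 | h1
      · exact key ⌊t⌋₊ ((Nat.floor_lt h0).2 h1) (Nat.floor_le h0) (Nat.lt_floor_add_one t).le
      · obtain ⟨G', rfl⟩ : ∃ G', G = G' + 1 := ⟨G - 1, by omega⟩
        push_cast at h1
        exact key G' (by omega) (by linarith) (by linarith)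
    -- general lower bound
    have low : ∀ u v : ℝ, 0 ≤ u → u ≤ v → v ≤ G → ∀ ℓ' : ℝ,
        (∀ j < G, clp (v - j) ≠ clp (u - j) → ℓ' ≤ g j) → ℓ' * (v - u) ≤ FF G c g v - FF G c g u := by
      intro u v hu huv hv ℓ' hl
      unfold FF
      have e : ∀ t, ∑ j ∈ Finset.range G, (g j - c) * clp (t - j) =
          ∑ j ∈ Finset.range G, g j * clp (t - j) - c * ∑ j ∈ Finset.range G, clp (t - j) := by
        intro t
        rw [Finset.mul_sum, ← Finset.sum_sub_distrib]
        exact Finset.sum_congr rfl fun j _ => by ring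
      rw [e v, e u, hsc v (hu.trans huv) hv, hsc u hu (huv.trans hv)]
      have : ℓ' * (v - u) ≤ ∑ j ∈ Finset.range G, g j * clp (v - j) - ∑ j ∈ Finset.range G, g j * clp (u - j) := by
        nth_rewrite 1 [← hsc v (hu.trans huv) hv]
        nth_rewrite 1 [← hsc u hu (huv.trans hv)]
        rw [← Finset.sum_sub_distrib, ← Finset.sum_sub_distrib, Finset.mul_sum]
        refine Finset.sum_le_sum fun j hj => ?_
        rw [← mul_sub]
        by_cases hh : clp (v - j) = clp (u - j)
        · rw [hh]; simp
        · exact mul_le_mul_of_nonneg_right (hl j (Finset.mem_range.1 hj) hh)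
            (by linarith [clp_mono (show u - j ≤ v - j by linarith)])
      linarith
    have hDxy : FF G c g y - FF G c g x = Dx := by rw [hyx, hdiff]
    have lowabs : ∀ ℓ' : ℝ, 0 ≤ ℓ' → (∀ j < G, clp (y - j) ≠ clp (x - j) → ℓ' ≤ g j) →
        ℓ' * |y - x| ≤ |Dx| := by
      intro ℓ' h0 hl
      rcases le_total x y with h | h
      · rw [abs_of_nonneg (sub_nonneg.2 h)]
        exact (low x y hxnn h hyG ℓ' hl).trans (hDxy ▸ le_abs_self _)
      · rw [abs_sub_comm, abs_of_nonneg (sub_nonneg.2 h)]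
        refine (low y x hy0 h hxG ℓ' (fun j hj hne => hl j hj hne.symm)).trans ?_
        rw [← abs_neg Dx, ← hDxy, neg_sub]
        exact le_abs_self _
    have hyx_le : |y - x| ≤ η := by
      have := (lowabs c hc.le (fun j hj _ => hg j hj)).trans hDxle
      exact le_of_mul_le_mul_left this hc
    apply lowabs ℓ hℓ.le
    intro j hj hne
    apply hlg j hj
    have h3 := abs_le.1 hyx_le
    have hx2 := hx.2
    have hx3 := hx.1
    rw [abs_le]
    constructor
    · by_contra hcon
      push Not at hcon
      apply hne
      rw [clp_one (by linarith), clp_one (by linarith)]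
    · by_contra hcon
      push Not at hcon
      apply hne
      rw [clp_zero (by linarith), clp_zero (by linarith)]

end Part5

section Part6
/-! ### Two dimensional transport -/

abbrev Iu (i : ℕ) : Set ℝ := Set.Ico (i : ℝ) (i + 1)

def uc (c : ℕ × ℕ) : Measure (ℝ × ℝ) := (volume.restrict (Iu c.1)).prod (volume.restrict (Iu c.2))

instance (c : ℕ × ℕ) : IsProbabilityMeasure (uc c) := by
  constructor
  unfold uc
  rw [← Set.univ_prod_univ, Measure.prod_prod]
  simp

def alphaM (G : ℕ) (a : ℕ × ℕ → ℝ) : Measure (ℝ × ℝ) :=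
  ∑ c ∈ sqI G, ENNReal.ofReal (a c) • uc c

instance (G : ℕ) (a : ℕ × ℕ → ℝ) : IsFiniteMeasure (alphaM G a) := by
  unfold alphaM
  constructor
  rw [Measure.finsetSum_apply]
  refine ENNReal.sum_lt_top.2 fun c _ => ?_
  rw [Measure.smul_apply]
  simp

lemma piece_cost (i : ℕ) (τ : ℝ → ℝ) (hτ : Measurable τ) (ℓ A B : ℝ) (hℓ : 0 < ℓ)
    (h : ∀ x ∈ Iu i, ℓ * |τ x - x| ≤ |(1 - (x - i)) * A + (x - i) * B|) :
    ∫⁻ x in Iu i, ENNReal.ofReal ((x - τ x) ^ 2) ≤ ENNReal.ofReal ((A ^ 2 + B ^ 2) / (2 * ℓ ^ 2)) := by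
  have h1 : ∀ x ∈ Iu i, (x - τ x) ^ 2 ≤ ((1 - (x - i)) * A ^ 2 + (x - i) * B ^ 2) / ℓ ^ 2 := by
    intro x hx
    have hx0 : 0 ≤ x - i := by linarith [hx.1]
    have hx1 : 0 ≤ 1 - (x - i) := by linarith [hx.2]
    rw [le_div_iff₀ (by positivity)]
    have h2 := h x hx
    have h3 : (ℓ * |τ x - x|) ^ 2 ≤ |(1 - (x - i)) * A + (x - i) * B| ^ 2 := by
      gcongr
    rw [mul_pow, sq_abs, sq_abs] at h3
    have h4 : ((1 - (x - i)) * A + (x - i) * B) ^ 2 ≤ (1 - (x - i)) * A ^ 2 + (x - i) * B ^ 2 := by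
      nlinarith [mul_nonneg (mul_nonneg hx0 hx1) (sq_nonneg (A - B))]
    calc (x - τ x) ^ 2 * ℓ ^ 2 = ℓ ^ 2 * (τ x - x) ^ 2 := by ring
      _ ≤ _ := h3.trans h4
  calc ∫⁻ x in Iu i, ENNReal.ofReal ((x - τ x) ^ 2)
      ≤ ∫⁻ x in Iu i, ENNReal.ofReal (((1 - (x - i)) * A ^ 2 + (x - i) * B ^ 2) / ℓ ^ 2) := by
        refine lintegral_mono_ae ?_
        filter_upwards [ae_restrict_mem measurableSet_Ico] with x hx
        exact ENNReal.ofReal_le_ofReal (h1 x hx)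
    _ = ENNReal.ofReal (∫ x in Iu i, ((1 - (x - i)) * A ^ 2 + (x - i) * B ^ 2) / ℓ ^ 2) := by
        rw [ofReal_integral_eq_lintegral_ofReal]
        · have hc : Continuous fun x : ℝ => ((1 - (x - i)) * A ^ 2 + (x - i) * B ^ 2) / ℓ ^ 2 := by
            fun_prop
          exact (hc.integrableOn_Icc (a := (i : ℝ)) (b := i + 1)).mono_set Set.Ico_subset_Icc_self
        · filter_upwards [ae_restrict_mem measurableSet_Ico] with x hx
          exact le_trans (sq_nonneg _) (h1 x hx)
    _ = _ := by
        congr 1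
        rw [integral_Ico_eq_integral_Ioc, ← intervalIntegral.integral_of_le (by linarith)]
        have e : ∀ x : ℝ, ((1 - (x - i)) * A ^ 2 + (x - i) * B ^ 2) / ℓ ^ 2 =
          ((1 + i) * A ^ 2 - i * B ^ 2) / ℓ ^ 2 + (B ^ 2 - A ^ 2) / ℓ ^ 2 * x := by intro x; ring
        simp only [e]
        rw [intervalIntegral.integral_add (by simp) (by
          apply Continuous.intervalIntegrable; fun_prop), intervalIntegral.integral_const,
          intervalIntegral.integral_const_mul, integral_id]
        simp only [smul_eq_mul]
        field_simp
        ring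

lemma alphaM_rows (G : ℕ) (a : ℕ × ℕ → ℝ) :
    alphaM G a = ∑ j ∈ Finset.range G, ∑ i ∈ Finset.range G, ENNReal.ofReal (a (i, j)) • uc (i, j) := by
  unfold alphaM sqI
  rw [Finset.sum_product_right]

instance (G : ℕ) (f : ℕ → ℝ) : IsFiniteMeasure (nu G f) := by
  unfold nu
  constructor
  rw [Measure.finsetSum_apply]
  refine ENNReal.sum_lt_top.2 fun c _ => ?_
  rw [Measure.smul_apply]
  simp

lemma nu_succ (G : ℕ) (f : ℕ → ℝ) : nu (G + 1) f = nu G f +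
    ENNReal.ofReal (f G) • (volume.restrict (Iu G)) := by
  unfold nu; rw [Finset.sum_range_succ]

lemma nu_prod (G : ℕ) (f : ℕ → ℝ) (j : ℕ) :
    (nu G f).prod (volume.restrict (Iu j)) =
      ∑ i ∈ Finset.range G, ENNReal.ofReal (f i) • uc (i, j) := by
  induction G with
  | zero => simp [nu]
  | succ n ih =>
    rw [nu_succ, Measure.add_prod, ih, Finset.sum_range_succ, Measure.prod_smul_left]
    rfl

lemma ae_uc (c : ℕ × ℕ) : ∀ᵐ u ∂(uc c), u.1 ∈ Iu c.1 ∧ u.2 ∈ Iu c.2 := by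
  unfold uc
  rw [Measure.prod_restrict]
  filter_upwards [ae_restrict_mem (measurableSet_Ico.prod measurableSet_Ico)] with u hu
  exact hu

lemma floor_of_Iu {i : ℕ} {x : ℝ} (h : x ∈ Iu i) : ⌊x⌋₊ = i := by
  rw [Nat.floor_eq_iff (le_trans (Nat.cast_nonneg i) h.1)]
  exact h

lemma ae_fsum_iff {ι Ω : Type*} [MeasurableSpace Ω] (s : Finset ι) (ν : ι → Measure Ω) (P : Ω → Prop) :
    (∀ᵐ u ∂(∑ i ∈ s, ν i), P u) ↔ ∀ i ∈ s, ∀ᵐ u ∂(ν i), P u := by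
  simp only [ae_iff, Measure.finsetSum_apply, Finset.sum_eq_zero_iff]

lemma horiz (G : ℕ) (a σ J : ℕ × ℕ → ℝ) (c : ℝ) (hc : 0 < c) (ha : ∀ i < G, ∀ j < G, c ≤ a (i, j))
    (hσ : ∀ i < G, ∀ j < G, c ≤ σ (i, j)) (hJ0 : ∀ q < G, J (0, q) = 0) (hJG : ∀ q < G, J (G, q) = 0)
    (hdiv : ∀ i < G, ∀ j < G, J (i + 1, j) - J (i, j) = a (i, j) - σ (i, j)) (η : ℝ)
    (hη : ∀ p ≤ G, ∀ q < G, |J (p, q)| ≤ c * η) (ℓ : ℕ × ℕ → ℝ)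
    (hℓ : ∀ i < G, ∀ j < G, 0 < ℓ (i, j))
    (hl : ∀ i < G, ∀ j < G, ∀ i' < G, |(i' : ℝ) - i| ≤ η + 1 → ℓ (i, j) ≤ σ (i', j)) :
    ∃ t : ℝ × ℝ → ℝ, Measurable t ∧ (alphaM G a).map (fun u => (t u, u.2)) = alphaM G σ ∧
      ∫⁻ u, ENNReal.ofReal ((u.1 - t u) ^ 2) ∂(alphaM G a) ≤
        ENNReal.ofReal (∑ p ∈ sqI G, a p * ((J p ^ 2 + J (p.1 + 1, p.2) ^ 2) / (2 * ℓ p ^ 2))) := by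
  have H : ∀ j, ∃ τ : ℝ → ℝ, Measurable τ ∧ (j < G → ((nu G (fun i => a (i, j))).map τ = nu G (fun i => σ (i, j)) ∧
      ∀ i < G, ∀ l : ℝ, 0 < l → (∀ k < G, |(k : ℝ) - i| ≤ η + 1 → l ≤ σ (k, j)) →
        ∀ x ∈ Set.Ico (i : ℝ) (i + 1),
          l * |τ x - x| ≤ |(1 - (x - i)) * J (i, j) + (x - i) * J (i + 1, j)|)) := by
    intro j
    by_cases hj : j < G
    · obtain ⟨τ, h1, h2, h3⟩ := oneD G (fun i => a (i, j)) (fun i => σ (i, j)) c hc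
        (fun i hi => ha i hi j hj) (fun i hi => hσ i hi j hj) (fun p => J (p, j)) (hJ0 j hj) (hJG j hj)
        (fun i hi => hdiv i hi j hj) η (fun p hp => hη p hp j hj)
      exact ⟨τ, h1, fun _ => ⟨h2, h3⟩⟩
    · exact ⟨id, measurable_id, fun h => absurd h hj⟩
  choose τ hτm hτ using H
  have htm : Measurable (fun u : ℝ × ℝ => τ ⌊u.2⌋₊ u.1) := by
    have : Measurable (fun v : ℕ × ℝ => τ v.1 v.2) := measurable_from_prod_countable_right hτm
    exact this.comp ((Nat.measurable_floor.comp measurable_snd).prodMk measurable_fst)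
  refine ⟨fun u => τ ⌊u.2⌋₊ u.1, htm, ?_, ?_⟩
  · rw [alphaM_rows, alphaM_rows, map_fsum _ _ _ (htm.prodMk measurable_snd)]
    refine Finset.sum_congr rfl fun j hj => ?_
    have hj' := Finset.mem_range.1 hj
    rw [← nu_prod G (fun i => σ (i, j)), ← (hτ j hj').1, ← nu_prod G (fun i => a (i, j))]
    have e : ((nu G fun i => a (i, j)).map (τ j)).prod (volume.restrict (Iu j)) =
        ((nu G fun i => a (i, j)).prod (volume.restrict (Iu j))).map (Prod.map (τ j) id) := by
      rw [← Measure.map_prod_map _ _ (hτm j) measurable_id, Measure.map_id]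
    rw [e]
    apply Measure.map_congr
    rw [nu_prod]
    rw [Filter.EventuallyEq, ae_fsum_iff]
    intro i _
    refine Measure.ae_smul_measure ?_ _
    filter_upwards [ae_uc (i, j)] with u hu
    rw [floor_of_Iu hu.2]; rfl
  · unfold alphaM
    rw [lintegral_finsetSum_measure, ENNReal.ofReal_sum_of_nonneg]
    · refine Finset.sum_le_sum fun p hp => ?_
      obtain ⟨i, j⟩ := p
      obtain ⟨hi, hj⟩ := mem_sqI.1 hp
      simp only at hi hj
      rw [lintegral_smul_measure, ENNReal.ofReal_mul (hc.le.trans (ha i hi j hj)), smul_eq_mul]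
      gcongr
      have hf : Measurable fun u : ℝ × ℝ => ENNReal.ofReal ((u.1 - τ j u.1) ^ 2) := by
        have := hτm j
        fun_prop
      calc _ = ∫⁻ u, ENNReal.ofReal ((u.1 - τ j u.1) ^ 2) ∂(uc (i, j)) := by
            apply lintegral_congr_ae
            filter_upwards [ae_uc (i, j)] with u hu
            rw [floor_of_Iu hu.2]
        _ = ∫⁻ x in Iu i, ENNReal.ofReal ((x - τ j x) ^ 2) := by
            unfold uc
            rw [lintegral_prod _ hf.aemeasurable]
            simp
        _ ≤ _ := piece_cost i (τ j) (hτm j) _ _ _ (hℓ i hi j hj)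
            ((hτ j hj).2 i hi _ (hℓ i hi j hj) (fun k hk hk' => hl i hi j hj k hk hk'))
    · intro p hp
      obtain ⟨i, j⟩ := p
      obtain ⟨hi, hj⟩ := mem_sqI.1 hp
      exact mul_nonneg (hc.le.trans (ha i hi j hj)) (by positivity)

lemma alphaM_swap (G : ℕ) (a : ℕ × ℕ → ℝ) :
    (alphaM G a).map Prod.swap = alphaM G (fun p => a p.swap) := by
  unfold alphaM
  rw [map_fsum _ _ _ measurable_swap]
  unfold sqI
  rw [Finset.sum_product, Finset.sum_product_right]
  refine Finset.sum_congr rfl fun i _ => Finset.sum_congr rfl fun j _ => ?_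
  rw [Measure.map_smul]
  unfold uc
  rw [Measure.prod_swap]; rfl

lemma sqI_swap_sum (G : ℕ) (f : ℕ × ℕ → ℝ) : ∑ p ∈ sqI G, f p.swap = ∑ p ∈ sqI G, f p := by
  unfold sqI
  rw [Finset.sum_product, Finset.sum_product_right]
  rfl

lemma twoD (G : ℕ) (a σ b J1 J2 : ℕ × ℕ → ℝ) (c : ℝ) (hc : 0 < c)
    (ha : ∀ i < G, ∀ j < G, c ≤ a (i, j))
    (hσ : ∀ i < G, ∀ j < G, c ≤ σ (i, j)) (hb : ∀ i < G, ∀ j < G, c ≤ b (i, j))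
    (hJ0 : ∀ q < G, J1 (0, q) = 0) (hJG : ∀ q < G, J1 (G, q) = 0)
    (hJ0' : ∀ q < G, J2 (q, 0) = 0) (hJG' : ∀ q < G, J2 (q, G) = 0)
    (hdiv : ∀ i < G, ∀ j < G, J1 (i + 1, j) - J1 (i, j) = a (i, j) - σ (i, j))
    (hdiv' : ∀ i < G, ∀ j < G, J2 (i, j + 1) - J2 (i, j) = σ (i, j) - b (i, j))
    (η : ℝ)
    (hη : ∀ p ≤ G, ∀ q < G, |J1 (p, q)| ≤ c * η)
    (hη' : ∀ p ≤ G, ∀ q < G, |J2 (q, p)| ≤ c * η) (ℓ : ℕ × ℕ → ℝ)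
    (hℓ : ∀ i < G, ∀ j < G, 0 < ℓ (i, j))
    (hl : ∀ i < G, ∀ j < G, ∀ i' < G, |(i' : ℝ) - i| ≤ η + 1 → ℓ (i, j) ≤ σ (i', j))
    (hl' : ∀ i < G, ∀ j < G, ∀ j' < G, |(j' : ℝ) - j| ≤ η + 1 → ℓ (i, j) ≤ b (i, j')) :
    ∃ T : ℝ × ℝ → ℝ × ℝ, Measurable T ∧ (alphaM G a).map T = alphaM G b ∧
      ∫⁻ u, ENNReal.ofReal (d2 u (T u)) ∂(alphaM G a) ≤
        ENNReal.ofReal (∑ p ∈ sqI G, a p * ((J1 p ^ 2 + J1 (p.1 + 1, p.2) ^ 2) / (2 * ℓ p ^ 2)) +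
          ∑ p ∈ sqI G, σ p * ((J2 p ^ 2 + J2 (p.1, p.2 + 1) ^ 2) / (2 * ℓ p ^ 2))) := by
  obtain ⟨t, htm, ht, htc⟩ := horiz G a σ J1 c hc ha hσ hJ0 hJG hdiv η hη ℓ hℓ hl
  obtain ⟨s, hsm, hs, hsc⟩ := horiz G (fun p => σ p.swap) (fun p => b p.swap) (fun p => J2 p.swap) c hc
    (fun i hi j hj => hσ j hj i hi) (fun i hi j hj => hb j hj i hi) hJ0' hJG'
    (fun i hi j hj => hdiv' j hj i hi) η hη' (fun p => ℓ p.swap)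
    (fun i hi j hj => hℓ j hj i hi) (fun i hi j hj k hk h => hl' j hj i hi k hk h)
  set T1 : ℝ × ℝ → ℝ × ℝ := fun u => (t u, u.2) with hT1
  set T2 : ℝ × ℝ → ℝ × ℝ := fun u => (u.1, s u.swap) with hT2
  have hT1m : Measurable T1 := htm.prodMk measurable_snd
  have hT2m : Measurable T2 := measurable_fst.prodMk (hsm.comp measurable_swap)
  have hs2 : (alphaM G σ).map T2 = alphaM G b := by
    have e : T2 = Prod.swap ∘ (fun u => (s u, u.2)) ∘ Prod.swap := by
      funext u; rfl
    rw [e, ← Measure.map_map measurable_swap ((hsm.prodMk measurable_snd).comp measurable_swap),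
      ← Measure.map_map (hsm.prodMk measurable_snd) measurable_swap, alphaM_swap, hs, alphaM_swap]
    rfl
  refine ⟨T2 ∘ T1, hT2m.comp hT1m, ?_, ?_⟩
  · rw [← Measure.map_map hT2m hT1m, ht, hs2]
  · have hd : ∀ u, d2 u ((T2 ∘ T1) u) = (u.1 - t u) ^ 2 + ((T1 u).2 - s (T1 u).swap) ^ 2 := by
      intro u; rfl
    have hm1 : Measurable fun u : ℝ × ℝ => ENNReal.ofReal ((u.1 - t u) ^ 2) := by fun_prop
    have hm2 : Measurable fun u : ℝ × ℝ => ENNReal.ofReal ((u.2 - s u.swap) ^ 2) := by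
      have : Measurable fun u : ℝ × ℝ => s u.swap := hsm.comp measurable_swap
      fun_prop
    have hm3 : Measurable fun u : ℝ × ℝ => ENNReal.ofReal ((u.1 - s u) ^ 2) := by
      fun_prop
    calc ∫⁻ u, ENNReal.ofReal (d2 u ((T2 ∘ T1) u)) ∂(alphaM G a)
        = ∫⁻ u, ENNReal.ofReal ((u.1 - t u) ^ 2) + ENNReal.ofReal (((T1 u).2 - s (T1 u).swap) ^ 2) ∂(alphaM G a) := by
          refine lintegral_congr fun u => ?_
          rw [hd, ENNReal.ofReal_add (sq_nonneg _) (sq_nonneg _)]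
      _ = ∫⁻ u, ENNReal.ofReal ((u.1 - t u) ^ 2) ∂(alphaM G a) +
          ∫⁻ u, ENNReal.ofReal ((u.2 - s u.swap) ^ 2) ∂(alphaM G σ) := by
          rw [lintegral_add_left hm1, ← ht, lintegral_map hm2 hT1m]
      _ ≤ _ := by
          rw [ENNReal.ofReal_add]
          · refine add_le_add htc ?_
            have e3 : ∫⁻ u, ENNReal.ofReal ((u.2 - s u.swap) ^ 2) ∂(alphaM G σ) =
                ∫⁻ u, ENNReal.ofReal ((u.1 - s u) ^ 2) ∂(alphaM G (fun p => σ p.swap)) := by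
              rw [← alphaM_swap, lintegral_map hm3 measurable_swap]; rfl
            rw [e3]
            refine hsc.trans (le_of_eq ?_)
            congr 1
            exact sqI_swap_sum G (fun p => σ p * ((J2 p ^ 2 + J2 (p.1, p.2 + 1) ^ 2) / (2 * ℓ p ^ 2)))
          · refine Finset.sum_nonneg fun p hp => ?_
            obtain ⟨hi, hj⟩ := mem_sqI.1 hp
            exact mul_nonneg (hc.le.trans (ha p.1 hi p.2 hj)) (by positivity)
          · refine Finset.sum_nonneg fun p hp => ?_
            obtain ⟨hi, hj⟩ := mem_sqI.1 hp
            exact mul_nonneg (hc.le.trans (hσ p.1 hi p.2 hj)) (by positivity)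

end Part6

section Part7
/-! ### Within-cell transport -/

lemma coupling {ι : Type*} [DecidableEq ι] (S : Finset ι) (α β : ι → ℝ) (hα : ∀ r ∈ S, 0 ≤ α r)
    (hβ : ∀ r ∈ S, 0 ≤ β r) (hs : ∑ r ∈ S, α r = ∑ r ∈ S, β r) :
    ∃ P : ι → ι → ℝ, (∀ r ∈ S, ∀ r' ∈ S, 0 ≤ P r r') ∧ (∀ r ∈ S, ∑ r' ∈ S, P r r' = α r) ∧
      (∀ r' ∈ S, ∑ r ∈ S, P r r' = β r') ∧
      ∀ A B : ℝ, 0 ≤ A → 0 ≤ B →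
        ∑ r' ∈ S, ∑ r ∈ S, P r r' * (if r = r' then A else B) ≤
          A * ∑ r ∈ S, β r + B * ∑ r ∈ S, |α r - β r| := by
  set p : ι → ℝ := fun r => max (α r - β r) 0 with hp
  set q : ι → ℝ := fun r => max (β r - α r) 0 with hq
  have hpn : ∀ r, 0 ≤ p r := fun r => le_max_right _ _
  have hqn : ∀ r, 0 ≤ q r := fun r => le_max_right _ _
  have hpq : ∀ r, p r - q r = α r - β r := by
    intro r
    simp only [hp, hq]
    rcases le_total (α r) (β r) with h | h
    · rw [max_eq_right (by linarith), max_eq_left (by linarith)]; ring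
    · rw [max_eq_left (by linarith), max_eq_right (by linarith)]; ring
  have hmin1 : ∀ r, min (α r) (β r) + p r = α r := by
    intro r
    simp only [hp]
    rcases le_total (α r) (β r) with h | h
    · rw [max_eq_right (by linarith), min_eq_left h]; ring
    · rw [max_eq_left (by linarith), min_eq_right h]; ring
  have hmin2 : ∀ r, min (α r) (β r) + q r = β r := fun r => by linarith [hmin1 r, hpq r]
  have hple : ∀ r, p r ≤ |α r - β r| := fun r => max_le (le_abs_self _) (abs_nonneg _)
  set D := ∑ r ∈ S, p r with hD
  have hDq : ∑ r ∈ S, q r = D := by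
    have : ∑ r ∈ S, (p r - q r) = 0 := by
      simp only [hpq]; rw [Finset.sum_sub_distrib, hs, sub_self]
    rw [Finset.sum_sub_distrib] at this; linarith
  have hDn : 0 ≤ D := Finset.sum_nonneg fun r _ => hpn r
  have hpD : ∀ r ∈ S, p r * (D / D) = p r := by
    intro r hr
    by_cases h : D = 0
    · rw [(Finset.sum_eq_zero_iff_of_nonneg fun r _ => hpn r).1 h r hr]; simp
    · rw [div_self h, mul_one]
  have hqD : ∀ r ∈ S, q r * (D / D) = q r := by
    intro r hr
    by_cases h : D = 0
    · rw [h] at hDq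
      rw [(Finset.sum_eq_zero_iff_of_nonneg fun r _ => hqn r).1 hDq r hr]; simp
    · rw [div_self h, mul_one]
  have hmn : ∀ r ∈ S, 0 ≤ min (α r) (β r) := fun r hr => le_min (hα r hr) (hβ r hr)
  have hcol : ∀ r' ∈ S, ∑ r ∈ S, p r * q r' / D = q r' := by
    intro r' hr
    rw [← Finset.sum_div, ← Finset.sum_mul, ← hD, mul_comm, mul_div_assoc, hqD r' hr]
  have hrow : ∀ r ∈ S, ∑ r' ∈ S, p r * q r' / D = p r := by
    intro r hr
    rw [← Finset.sum_div, ← Finset.mul_sum, hDq, mul_div_assoc, hpD r hr]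
  refine ⟨fun r r' => (if r = r' then min (α r) (β r) else 0) + p r * q r' / D, ?_, ?_, ?_, ?_⟩
  · intro r hr r' hr'
    have := hpn r; have := hqn r'; have := hmn r hr
    dsimp only
    split_ifs <;> positivity
  · intro r hr
    rw [Finset.sum_add_distrib, Finset.sum_ite_eq, if_pos hr, hrow r hr, hmin1]
  · intro r' hr
    rw [Finset.sum_add_distrib, Finset.sum_ite_eq', if_pos hr, hcol r' hr, hmin2]
  · intro A B hA hB
    have key : ∀ r' ∈ S, ∀ r ∈ S, ((if r = r' then min (α r) (β r) else 0) + p r * q r' / D) *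
        (if r = r' then A else B) ≤ (if r = r' then A * β r' else 0) + B * (p r * q r' / D) := by
      intro r' hr' r hr
      have h1 : 0 ≤ p r * q r' / D := div_nonneg (mul_nonneg (hpn _) (hqn _)) hDn
      split_ifs with h
      · subst h
        have h2 : p r * q r / D = 0 := by
          have : p r * q r = 0 := by
            simp only [hp, hq]
            rcases le_total (α r) (β r) with h | h
            · rw [max_eq_right (show α r - β r ≤ 0 by linarith)]; ring
            · rw [max_eq_right (show β r - α r ≤ 0 by linarith)]; ring
          rw [this, zero_div]
        rw [h2]
        nlinarith [min_le_right (α r) (β r)]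
      · rw [zero_add, zero_add, mul_comm]
    calc _ ≤ ∑ r' ∈ S, ∑ r ∈ S, ((if r = r' then A * β r' else 0) + B * (p r * q r' / D)) :=
          Finset.sum_le_sum fun r' hr' => Finset.sum_le_sum fun r hr => key r' hr' r hr
      _ = ∑ r' ∈ S, (A * β r' + B * q r') := by
          refine Finset.sum_congr rfl fun r' hr' => ?_
          rw [Finset.sum_add_distrib, Finset.sum_ite_eq', if_pos hr', ← Finset.mul_sum, hcol r' hr']
      _ = A * ∑ r ∈ S, β r + B * D := by
          rw [Finset.sum_add_distrib, ← Finset.mul_sum, ← Finset.mul_sum, hDq]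
      _ ≤ _ := by
          exact add_le_add le_rfl (mul_le_mul_of_nonneg_left (Finset.sum_le_sum fun r _ => hple r) hB)

abbrev Is (M i r : ℕ) : Set ℝ := Set.Ico ((i : ℝ) + r / M) (i + (r + 1) / M)

def vc (M : ℕ) (c r : ℕ × ℕ) : Measure (ℝ × ℝ) :=
  ENNReal.ofReal ((M : ℝ) ^ 2) • ((volume.restrict (Is M c.1 r.1)).prod (volume.restrict (Is M c.2 r.2)))

lemma vc_univ (M : ℕ) (hM : 0 < M) (c r : ℕ × ℕ) : vc M c r Set.univ = 1 := by
  unfold vc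
  have hM' : (0 : ℝ) < M := by exact_mod_cast hM
  rw [Measure.smul_apply, ← Set.univ_prod_univ, Measure.prod_prod, Measure.restrict_apply_univ,
    Measure.restrict_apply_univ, Real.volume_Ico, Real.volume_Ico, smul_eq_mul,
    ← ENNReal.ofReal_mul (by ring_nf; positivity), ← ENNReal.ofReal_mul (by positivity), ← ENNReal.ofReal_one]
  congr 1
  field_simp
  ring

lemma restrict_tele (x : ℕ → ℝ) (hx : Monotone x) (n : ℕ) :
    ∑ r ∈ Finset.range n, (volume : Measure ℝ).restrict (Set.Ico (x r) (x (r + 1))) =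
      volume.restrict (Set.Ico (x 0) (x n)) := by
  induction n with
  | zero => simp
  | succ n ih =>
    rw [Finset.sum_range_succ, ih, ← Measure.restrict_union, Set.Ico_union_Ico_eq_Ico (hx (Nat.zero_le _)) (hx (Nat.le_succ _))]
    · rw [Set.disjoint_left]
      intro y hy hy'
      exact absurd hy.2 (not_lt.2 hy'.1)
    · exact measurableSet_Ico

lemma Iu_eq_sum (M : ℕ) (hM : 0 < M) (i : ℕ) :
    (volume : Measure ℝ).restrict (Iu i) = ∑ r ∈ Finset.range M, volume.restrict (Is M i r) := by
  have hM' : (0 : ℝ) < M := by exact_mod_cast hM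
  have h := restrict_tele (fun r => (i : ℝ) + r / M) (by
    intro a b h
    have : (a : ℝ) ≤ b := by exact_mod_cast h
    dsimp only; gcongr) M
  have e : ∀ r : ℕ, Is M i r = Set.Ico ((i : ℝ) + r / M) (i + ((r + 1 : ℕ) : ℝ) / M) := by
    intro r; push_cast; rfl
  simp only [e]
  rw [h]
  simp [div_self hM'.ne']

lemma prod_fsum {ι : Type*} (s t : Finset ι) (μ ν : ι → Measure ℝ) [∀ i, IsFiniteMeasure (μ i)]
    [∀ i, IsFiniteMeasure (ν i)] :
    (∑ i ∈ s, μ i).prod (∑ j ∈ t, ν j) = ∑ p ∈ s ×ˢ t, (μ p.1).prod (ν p.2) := by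
  classical
  have hf : ∀ (u : Finset ι) (κ : ι → Measure ℝ), (∀ i, IsFiniteMeasure (κ i)) → IsFiniteMeasure (∑ i ∈ u, κ i) := by
    intro u κ h
    constructor
    rw [Measure.finsetSum_apply]
    exact ENNReal.sum_lt_top.2 fun c _ => measure_lt_top _ _
  rw [Finset.sum_product]
  have h1 : ∀ i, (μ i).prod (∑ j ∈ t, ν j) = ∑ j ∈ t, (μ i).prod (ν j) := by
    intro i
    induction t using Finset.induction_on with
    | empty => simp
    | insert j t hj ih =>
      have := hf t ν inferInstance
      rw [Finset.sum_insert hj, Finset.sum_insert hj, Measure.prod_add, ih]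
  have := hf t ν inferInstance
  induction s using Finset.induction_on with
  | empty => simp
  | insert j s hj ih =>
    have := hf s μ inferInstance
    rw [Finset.sum_insert hj, Finset.sum_insert hj, Measure.add_prod, ih, h1]

lemma uc_eq_sum (M : ℕ) (hM : 0 < M) (c : ℕ × ℕ) :
    uc c = ∑ r ∈ sqI M, ENNReal.ofReal (1 / (M : ℝ) ^ 2) • vc M c r := by
  have hM' : (0 : ℝ) < M := by exact_mod_cast hM
  unfold uc
  rw [Iu_eq_sum M hM, Iu_eq_sum M hM, prod_fsum]
  refine Finset.sum_congr rfl fun r _ => ?_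
  unfold vc
  rw [smul_smul, ← ENNReal.ofReal_mul (by positivity), one_div, inv_mul_cancel₀ (by positivity),
    ENNReal.ofReal_one, one_smul]

lemma vc_cost (M : ℕ) (hM : 0 < M) (c r r' : ℕ × ℕ) (hr : r ∈ sqI M) (hr' : r' ∈ sqI M) (X : ℝ × ℝ)
    (h1 : X.1 ∈ Is M c.1 r'.1) (h2 : X.2 ∈ Is M c.2 r'.2) :
    ∫⁻ u, ENNReal.ofReal (d2 X u) ∂(vc M c r) ≤
      ENNReal.ofReal (if r = r' then 2 / (M : ℝ) ^ 2 else 2) := by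
  have hM' : (0 : ℝ) < M := by exact_mod_cast hM
  have hae : ∀ᵐ u ∂(vc M c r), ENNReal.ofReal (d2 X u) ≤
      ENNReal.ofReal (if r = r' then 2 / (M : ℝ) ^ 2 else 2) := by
    unfold vc
    refine Measure.ae_smul_measure ?_ _
    rw [Measure.prod_restrict]
    filter_upwards [ae_restrict_mem (measurableSet_Ico.prod measurableSet_Ico)] with u hu
    apply ENNReal.ofReal_le_ofReal
    have hu1 := hu.1
    have hu2 := hu.2
    unfold d2
    split_ifs with h
    · subst h
      have key : ∀ (i s : ℕ) (x y : ℝ), x ∈ Is M i s → y ∈ Is M i s → (x - y) ^ 2 ≤ 1 / (M : ℝ) ^ 2 := by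
        intro i s x y hx hy
        have e : ((s : ℝ) + 1) / M = s / M + 1 / M := by ring
        have a1 := hx.1; have a2 := hx.2; have a3 := hy.1; have a4 := hy.2
        rw [e] at a2 a4
        rw [← one_div_pow, ← abs_of_pos (show (0:ℝ) < 1 / M by positivity), sq_le_sq, abs_abs,
          abs_of_pos (show (0:ℝ) < 1 / M by positivity)]
        rw [abs_le]; constructor <;> linarith
      have := key _ _ _ _ h1 hu1
      have := key _ _ _ _ h2 hu2
      calc _ ≤ 1 / (M : ℝ) ^ 2 + 1 / (M : ℝ) ^ 2 := by linarith
        _ = _ := by ring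
    · have key : ∀ (i s t : ℕ) (x y : ℝ), s < M → t < M → x ∈ Is M i s → y ∈ Is M i t → (x - y) ^ 2 ≤ 1 := by
        intro i s t x y hs ht hx hy
        have hI : ∀ (s : ℕ) (x : ℝ), s < M → x ∈ Is M i s → (i : ℝ) ≤ x ∧ x ≤ i + 1 := by
          intro s x hs hx
          have h3 : ((s : ℝ) + 1) / M ≤ 1 := by
            rw [div_le_one hM']; exact_mod_cast hs
          have h4 : 0 ≤ (s : ℝ) / M := by positivity
          exact ⟨by linarith [hx.1], by linarith [hx.2]⟩
        have b1 := hI s x hs hx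
        have b2 := hI t y ht hy
        rw [sq_le_one_iff_abs_le_one, abs_le]
        constructor <;> linarith
      have hm := mem_sqI.1 hr
      have hm' := mem_sqI.1 hr'
      have := key _ _ _ _ _ hm'.1 hm.1 h1 hu1
      have := key _ _ _ _ _ hm'.2 hm.2 h2 hu2
      linarith
  calc _ ≤ ∫⁻ _, ENNReal.ofReal (if r = r' then 2 / (M : ℝ) ^ 2 else 2) ∂(vc M c r) := lintegral_mono_ae hae
    _ = _ := by rw [lintegral_const, vc_univ M hM, mul_one]

lemma within (N G M : ℕ) (hM : 0 < M) (X : Fin N → ℝ × ℝ) (cell sub : Fin N → ℕ × ℕ)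
    (hcell : ∀ i, cell i ∈ sqI G) (hsub : ∀ i, sub i ∈ sqI M)
    (hX : ∀ i, (X i).1 ∈ Is M (cell i).1 (sub i).1 ∧ (X i).2 ∈ Is M (cell i).2 (sub i).2)
    (a : ℕ × ℕ → ℝ) (ha : ∀ c, a c = ∑ i, if cell i = c then (1 : ℝ) else 0)
    (k : ℕ × ℕ → ℕ × ℕ → ℝ) (hk : ∀ c r, k c r = ∑ i, if cell i = c ∧ sub i = r then (1 : ℝ) else 0) :
    ∃ κ : Fin N → Measure (ℝ × ℝ), (∀ i, κ i Set.univ = 1) ∧ ∑ i, κ i = alphaM G a ∧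
      ∑ i, ∫⁻ u, ENNReal.ofReal (d2 (X i) u) ∂(κ i) ≤
        ENNReal.ofReal (2 * N / M ^ 2 + 2 * ∑ c ∈ sqI G, ∑ r ∈ sqI M, |k c r - a c / M ^ 2|) := by
  have hM' : (0 : ℝ) < M := by exact_mod_cast hM
  have hkn : ∀ c r, 0 ≤ k c r := by
    intro c r; rw [hk]; exact Finset.sum_nonneg fun i _ => by split_ifs <;> norm_num
  have han : ∀ c, 0 ≤ a c := by
    intro c; rw [ha]; exact Finset.sum_nonneg fun i _ => by split_ifs <;> norm_num
  have hks : ∀ c, ∑ r ∈ sqI M, k c r = a c := by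
    intro c
    simp only [hk, ha]
    rw [Finset.sum_comm]
    refine Finset.sum_congr rfl fun i _ => ?_
    by_cases h : cell i = c
    · simp [h, hsub i]
    · simp [h]
  have has : ∑ c ∈ sqI G, a c = N := by
    simp only [ha]
    rw [Finset.sum_comm]
    have : ∀ i ∈ (Finset.univ : Finset (Fin N)), ∑ c ∈ sqI G, (if cell i = c then (1 : ℝ) else 0) = 1 := by
      intro i _; simp [hcell i]
    rw [Finset.sum_congr rfl this]; simp
  have hP : ∀ c, _ := fun c => coupling (sqI M) (fun _ => a c / M ^ 2) (fun r => k c r)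
    (fun _ _ => div_nonneg (han c) (by positivity)) (fun r _ => hkn c r) (by
      rw [hks, Finset.sum_const, nsmul_eq_mul]
      have : ((sqI M).card : ℝ) = M ^ 2 := by unfold sqI; rw [Finset.card_product]; simp; ring
      rw [this]; field_simp)
  choose P hPn hProw hPcol hPcost using hP
  have hkpos : ∀ i, 0 < k (cell i) (sub i) := by
    intro i
    rw [hk]
    refine Finset.sum_pos' (fun j _ => by split_ifs <;> norm_num) ⟨i, Finset.mem_univ _, by simp⟩
  -- fibre sum
  have fib : ∀ {A : Type} [AddCommMonoid A] [Module ℝ≥0∞ A] (g : ℕ × ℕ → ℕ × ℕ → A),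
      ∑ i, g (cell i) (sub i) = ∑ c ∈ sqI G, ∑ r ∈ sqI M, ENNReal.ofReal (k c r) • g c r := by
    intro A _ _ g
    have : ∀ i ∈ (Finset.univ : Finset (Fin N)), g (cell i) (sub i) = ∑ c ∈ sqI G, ∑ r ∈ sqI M,
        (if cell i = c ∧ sub i = r then (1 : ℝ≥0∞) else 0) • g c r := by
      intro i _
      rw [Finset.sum_eq_single (cell i), Finset.sum_eq_single (sub i)]
      · simp
      · intro r _ hr; simp [hr.symm]
      · intro h; exact absurd (hsub i) h
      · intro c _ hc; simp [hc.symm]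
      · intro h; exact absurd (hcell i) h
    rw [Finset.sum_congr rfl this, Finset.sum_comm]
    refine Finset.sum_congr rfl fun c _ => ?_
    rw [Finset.sum_comm]
    refine Finset.sum_congr rfl fun r _ => ?_
    rw [← Finset.sum_smul, hk, ENNReal.ofReal_sum_of_nonneg (fun i _ => by split_ifs <;> norm_num)]
    congr 1
    refine Finset.sum_congr rfl fun i _ => ?_
    split_ifs <;> simp
  have hP0 : ∀ c, ∀ r ∈ sqI M, ∀ r' ∈ sqI M,
      ENNReal.ofReal (k c r') * ENNReal.ofReal (P c r r' / k c r') = ENNReal.ofReal (P c r r') := by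
    intro c r hr r' hr'
    rw [← ENNReal.ofReal_mul (hkn c r')]
    by_cases h : k c r' = 0
    · have h2 := hPcol c r' hr'
      rw [h, Finset.sum_eq_zero_iff_of_nonneg (fun s hs => hPn c s hs r' hr')] at h2
      rw [h2 r hr, h]; simp
    · rw [mul_div_cancel₀ _ h]
  refine ⟨fun i => ∑ r ∈ sqI M, ENNReal.ofReal (P (cell i) r (sub i) / k (cell i) (sub i)) • vc M (cell i) r,
    ?_, ?_, ?_⟩
  · intro i
    rw [Measure.finsetSum_apply]
    simp only [Measure.smul_apply, vc_univ M hM, smul_eq_mul, mul_one]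
    rw [← ENNReal.ofReal_sum_of_nonneg
      (fun r hr => div_nonneg (hPn _ r hr _ (hsub i)) (hkn _ _)), ← Finset.sum_div, hPcol _ _ (hsub i),
      div_self (hkpos i).ne', ENNReal.ofReal_one]
  · rw [fib (fun c r' => ∑ r ∈ sqI M, ENNReal.ofReal (P c r r' / k c r') • vc M c r)]
    unfold alphaM
    refine Finset.sum_congr rfl fun c _ => ?_
    rw [uc_eq_sum M hM, Finset.smul_sum]
    simp only [Finset.smul_sum]
    rw [Finset.sum_comm]
    refine Finset.sum_congr rfl fun r hr => ?_
    rw [smul_smul, ← ENNReal.ofReal_mul (han c), mul_one_div, ← hProw c r hr,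
      ENNReal.ofReal_sum_of_nonneg (fun r' hr' => hPn c r hr r' hr'), Finset.sum_smul]
    refine Finset.sum_congr rfl fun r' hr' => ?_
    rw [smul_smul, hP0 c r hr r' hr']
  · calc _ ≤ ∑ i, ∑ r ∈ sqI M, ENNReal.ofReal (P (cell i) r (sub i) / k (cell i) (sub i)) *
        ENNReal.ofReal (if r = sub i then 2 / (M : ℝ) ^ 2 else 2) := by
          refine Finset.sum_le_sum fun i _ => ?_
          rw [lintegral_finsetSum_measure]
          refine Finset.sum_le_sum fun r hr => ?_
          rw [lintegral_smul_measure, smul_eq_mul]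
          gcongr
          exact vc_cost M hM _ _ _ hr (hsub i) _ (hX i).1 (hX i).2
      _ = ∑ c ∈ sqI G, ∑ r' ∈ sqI M, ∑ r ∈ sqI M, ENNReal.ofReal (P c r r' * (if r = r' then 2 / (M : ℝ) ^ 2 else 2)) := by
          rw [fib (fun c r' => ∑ r ∈ sqI M, ENNReal.ofReal (P c r r' / k c r') *
            ENNReal.ofReal (if r = r' then 2 / (M : ℝ) ^ 2 else 2))]
          refine Finset.sum_congr rfl fun c _ => Finset.sum_congr rfl fun r' hr' => ?_
          rw [Finset.smul_sum]
          refine Finset.sum_congr rfl fun r hr => ?_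
          rw [smul_eq_mul, ← mul_assoc, hP0 c r hr r' hr', ENNReal.ofReal_mul (hPn c r hr r' hr')]
      _ = ENNReal.ofReal (∑ c ∈ sqI G, ∑ r' ∈ sqI M, ∑ r ∈ sqI M, (P c r r' * (if r = r' then 2 / (M : ℝ) ^ 2 else 2))) := by
          have hnn : ∀ c, ∀ r' ∈ sqI M, ∀ r ∈ sqI M, 0 ≤ P c r r' * (if r = r' then 2 / (M : ℝ) ^ 2 else 2) := by
            intro c r' hr' r hr
            exact mul_nonneg (hPn c r hr r' hr') (by split_ifs <;> positivity)
          rw [ENNReal.ofReal_sum_of_nonneg (fun c _ => Finset.sum_nonneg fun r' hr' =>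
            Finset.sum_nonneg fun r hr => hnn c r' hr' r hr)]
          refine Finset.sum_congr rfl fun c _ => ?_
          rw [ENNReal.ofReal_sum_of_nonneg (fun r' hr' =>
            Finset.sum_nonneg fun r hr => hnn c r' hr' r hr)]
          refine Finset.sum_congr rfl fun r' hr' => ?_
          rw [ENNReal.ofReal_sum_of_nonneg (fun r hr => hnn c r' hr' r hr)]
      _ ≤ _ := by
          apply ENNReal.ofReal_le_ofReal
          calc _ ≤ ∑ c ∈ sqI G, (2 / (M : ℝ) ^ 2 * ∑ r ∈ sqI M, k c r + 2 * ∑ r ∈ sqI M, |a c / M ^ 2 - k c r|) :=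
                Finset.sum_le_sum fun c _ => hPcost c _ _ (by positivity) (by norm_num)
            _ = _ := by
                simp only [hks]
                rw [Finset.sum_add_distrib, ← Finset.mul_sum, ← Finset.mul_sum, has]
                simp only [abs_sub_comm]
                ring

end Part7

section Part8
/-! ### The global flux -/

def zS (m : ℕ) (z : ℕ × ℕ → ℝ) (b c : ℕ × ℕ) : ℝ := z (b.1 * m + c.1, b.2 * m + c.2)
def ZS (m : ℕ) (z : ℕ × ℕ → ℝ) (b : ℕ × ℕ) : ℝ := ∑ c ∈ sqI m, zS m z b c
def blk (m : ℕ) (p : ℕ × ℕ) : ℕ × ℕ := (p.1 / m, p.2 / m)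
def loc (m : ℕ) (p : ℕ × ℕ) : ℕ × ℕ := (p.1 % m, p.2 % m)
def JL1 (m : ℕ) (z : ℕ × ℕ → ℝ) (p : ℕ × ℕ) : ℝ := J1F m (zS m z (blk m p)) (loc m p)
def JL2 (m : ℕ) (z : ℕ × ℕ → ℝ) (p : ℕ × ℕ) : ℝ := J2F m (zS m z (blk m p)) (loc m p)
def vF (m : ℕ) (z : ℕ × ℕ → ℝ) (p : ℕ × ℕ) : ℝ := ZS m z (blk m p) / (m : ℝ) ^ 2
def rF (B m : ℕ) (z : ℕ × ℕ → ℝ) (j : ℕ) : ℝ :=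
  (∑ i ∈ Finset.range (B * m), vF m z (i, j)) / ((B * m : ℕ) : ℝ)
def Jc1 (B m : ℕ) (z : ℕ × ℕ → ℝ) (p : ℕ × ℕ) : ℝ :=
  ∑ i ∈ Finset.range p.1, (vF m z (i, p.2) - rF B m z p.2)
def Jc2 (B m : ℕ) (z : ℕ × ℕ → ℝ) (p : ℕ × ℕ) : ℝ := ∑ j ∈ Finset.range p.2, rF B m z j
def JG1 (B m : ℕ) (z : ℕ × ℕ → ℝ) (p : ℕ × ℕ) : ℝ := JL1 m z p + Jc1 B m z p
def JG2 (B m : ℕ) (z : ℕ × ℕ → ℝ) (p : ℕ × ℕ) : ℝ := JL2 m z p + Jc2 B m z p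

lemma succ_divmod (m i : ℕ) (hm : 0 < m) : ((i + 1) / m = i / m ∧ (i + 1) % m = i % m + 1) ∨
    ((i + 1) % m = 0 ∧ i % m + 1 = m) := by
  by_cases h : i % m + 1 = m
  · right
    refine ⟨?_, h⟩
    rw [Nat.add_mod_eq_add_mod_right 1 (Nat.mod_mod i m).symm, h, Nat.mod_self]
  · left
    have h1 : i % m < m := Nat.mod_lt _ hm
    have h2 : i = m * (i / m) + i % m := (Nat.div_add_mod i m).symm
    have h3 : i + 1 = (i % m + 1) + m * (i / m) := by omega
    constructor
    · rw [h3, Nat.add_mul_div_left _ _ hm, Nat.div_eq_of_lt (by omega)]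
      omega
    · rw [h3, Nat.add_mul_mod_self_left, Nat.mod_eq_of_lt (by omega)]

lemma JL1_succ (m : ℕ) (hm : 0 < m) (z : ℕ × ℕ → ℝ) (i j : ℕ) :
    JL1 m z (i + 1, j) = J1F m (zS m z (blk m (i, j))) (i % m + 1, j % m) := by
  unfold JL1 blk loc
  rcases succ_divmod m i hm with ⟨h1, h2⟩ | ⟨h1, h2⟩
  · simp only [h1, h2]
  · simp only [h1, h2]
    rw [J1F_bdry0, J1F_bdry1 m hm]

lemma JL2_succ (m : ℕ) (hm : 0 < m) (z : ℕ × ℕ → ℝ) (i j : ℕ) :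
    JL2 m z (i, j + 1) = J2F m (zS m z (blk m (i, j))) (i % m, j % m + 1) := by
  unfold JL2 blk loc
  rcases succ_divmod m j hm with ⟨h1, h2⟩ | ⟨h1, h2⟩
  · simp only [h1, h2]
  · simp only [h1, h2]
    rw [J2F_bdry0, J2F_bdry1 m hm]

lemma zS_blk_loc (m : ℕ) (z : ℕ × ℕ → ℝ) (p : ℕ × ℕ) : zS m z (blk m p) (loc m p) = z p := by
  unfold zS blk loc
  simp only [Nat.div_add_mod']

lemma JG_div (B m : ℕ) (hm : 0 < m) (z : ℕ × ℕ → ℝ) (i j : ℕ) :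
    (JG1 B m z (i + 1, j) - JG1 B m z (i, j)) + (JG2 B m z (i, j + 1) - JG2 B m z (i, j)) = z (i, j) := by
  have h := JF_div m (zS m z (blk m (i, j))) (i % m) (j % m) (Nat.mod_lt _ hm) (Nat.mod_lt _ hm)
  have h2 := zS_blk_loc m z (i, j)
  unfold loc at h2
  simp only at h2
  rw [h2] at h
  have h3 : Jc1 B m z (i + 1, j) - Jc1 B m z (i, j) = vF m z (i, j) - rF B m z j := by
    unfold Jc1; simp only; rw [Finset.sum_range_succ]; ring
  have h4 : Jc2 B m z (i, j + 1) - Jc2 B m z (i, j) = rF B m z j := by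
    unfold Jc2; simp only; rw [Finset.sum_range_succ]; ring
  unfold JG1 JG2
  rw [JL1_succ m hm, JL2_succ m hm]
  have e1 : JL1 m z (i, j) = J1F m (zS m z (blk m (i, j))) (i % m, j % m) := rfl
  have e2 : JL2 m z (i, j) = J2F m (zS m z (blk m (i, j))) (i % m, j % m) := rfl
  rw [e1, e2]
  have e3 : vF m z (i, j) = (∑ c ∈ sqI m, zS m z (blk m (i, j)) c) / (m : ℝ) ^ 2 := rfl
  rw [e3] at h3
  linarith

lemma sum_range_blocks {A : Type*} [AddCommMonoid A] (B m : ℕ) (f : ℕ → A) :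
    ∑ i ∈ Finset.range (B * m), f i = ∑ b ∈ Finset.range B, ∑ c ∈ Finset.range m, f (b * m + c) := by
  induction B with
  | zero => simp
  | succ n ih => rw [Nat.succ_mul, Finset.sum_range_add, ih, Finset.sum_range_succ]

lemma sum_sqI_blocks {A : Type*} [AddCommMonoid A] (B m : ℕ) (f : ℕ × ℕ → A) :
    ∑ p ∈ sqI (B * m), f p =
      ∑ b ∈ sqI B, ∑ c ∈ sqI m, f (b.1 * m + c.1, b.2 * m + c.2) := by
  unfold sqI
  rw [Finset.sum_product, sum_range_blocks, Finset.sum_product]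
  refine Finset.sum_congr rfl fun b _ => ?_
  simp only [sum_range_blocks]
  simp only [Finset.sum_product]
  rw [Finset.sum_comm]

lemma blk_mk (m : ℕ) (b c : ℕ × ℕ) (hc : c ∈ sqI m) : blk m (b.1 * m + c.1, b.2 * m + c.2) = b := by
  obtain ⟨h1, h2⟩ := mem_sqI.1 hc
  unfold blk
  simp only
  rw [add_comm, Nat.add_mul_div_right _ _ (by omega), Nat.div_eq_of_lt h1, add_comm (b.2 * m),
    Nat.add_mul_div_right _ _ (by omega), Nat.div_eq_of_lt h2]
  simp

lemma loc_mk (m : ℕ) (b c : ℕ × ℕ) (hc : c ∈ sqI m) : loc m (b.1 * m + c.1, b.2 * m + c.2) = c := by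
  obtain ⟨h1, h2⟩ := mem_sqI.1 hc
  unfold loc
  simp only
  rw [add_comm, Nat.add_mul_mod_self_right, Nat.mod_eq_of_lt h1, add_comm (b.2 * m),
    Nat.add_mul_mod_self_right, Nat.mod_eq_of_lt h2]

lemma blk_mem (B m : ℕ) (p : ℕ × ℕ) (hp : p ∈ sqI (B * m)) : blk m p ∈ sqI B := by
  obtain ⟨h1, h2⟩ := mem_sqI.1 hp
  rw [mem_sqI]
  have hm : 0 < m := Nat.pos_of_ne_zero (by rintro rfl; simp at h1)
  exact ⟨(Nat.div_lt_iff_lt_mul hm).2 h1, (Nat.div_lt_iff_lt_mul hm).2 h2⟩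

lemma loc_mem (m : ℕ) (hm : 0 < m) (p : ℕ × ℕ) : loc m p ∈ sqI m :=
  mem_sqI.2 ⟨Nat.mod_lt _ hm, Nat.mod_lt _ hm⟩

lemma JG1_zero (B m : ℕ) (z : ℕ × ℕ → ℝ) (q : ℕ) : JG1 B m z (0, q) = 0 := by
  unfold JG1 JL1 Jc1 loc
  simp [J1F_bdry0]

lemma JG2_zero (B m : ℕ) (z : ℕ × ℕ → ℝ) (q : ℕ) : JG2 B m z (q, 0) = 0 := by
  unfold JG2 JL2 Jc2 loc
  simp [J2F_bdry0]

lemma JG1_last (B m : ℕ) (hB : 0 < B) (hm : 0 < m) (z : ℕ × ℕ → ℝ) (q : ℕ) :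
    JG1 B m z (B * m, q) = 0 := by
  have hG : ((B * m : ℕ) : ℝ) ≠ 0 := by exact_mod_cast (Nat.mul_pos hB hm).ne'
  unfold JG1 JL1 Jc1 loc
  simp only [Nat.mul_mod_left, J1F_bdry0, zero_add]
  rw [Finset.sum_sub_distrib, Finset.sum_const, Finset.card_range, nsmul_eq_mul, rF,
    mul_div_cancel₀ _ hG, sub_self]

lemma sum_vF (B m : ℕ) (hm : 0 < m) (z : ℕ × ℕ → ℝ) :
    ∑ p ∈ sqI (B * m), vF m z p = ∑ p ∈ sqI (B * m), z p := by
  have hm' : (m : ℝ) ≠ 0 := by exact_mod_cast hm.ne'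
  rw [sum_sqI_blocks, sum_sqI_blocks]
  refine Finset.sum_congr rfl fun b _ => ?_
  have : ∀ c ∈ sqI m, vF m z (b.1 * m + c.1, b.2 * m + c.2) = ZS m z b / (m : ℝ) ^ 2 := by
    intro c hc
    unfold vF
    rw [blk_mk m b c hc]
  rw [Finset.sum_congr rfl this, Finset.sum_const, nsmul_eq_mul]
  have hcard : ((sqI m).card : ℝ) = m ^ 2 := by unfold sqI; rw [Finset.card_product]; simp; ring
  rw [hcard, mul_div_cancel₀ _ (pow_ne_zero 2 hm')]
  rfl

lemma JG2_last (B m : ℕ) (hm : 0 < m) (z : ℕ × ℕ → ℝ)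
    (hz : ∑ p ∈ sqI (B * m), z p = 0) (q : ℕ) :
    JG2 B m z (q, B * m) = 0 := by
  unfold JG2 JL2 Jc2 loc
  simp only [Nat.mul_mod_left, J2F_bdry0, zero_add]
  unfold rF
  rw [← Finset.sum_div]
  have h := sum_vF B m hm z
  rw [hz] at h
  unfold sqI at h
  rw [Finset.sum_product_right] at h
  rw [h, zero_div]

/-- local energy -/
lemma local_energy (B m : ℕ) (hm : 0 < m) (z w : ℕ × ℕ → ℝ) (wm : ℕ × ℕ → ℝ)
    (hwm : ∀ b ∈ sqI B, 0 < wm b) (hw : ∀ p ∈ sqI (B * m), wm (blk m p) ≤ w p) :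
    ∑ p ∈ sqI (B * m), (JL1 m z p ^ 2 + JL1 m z (p.1 + 1, p.2) ^ 2) / (2 * w p) +
    ∑ p ∈ sqI (B * m), (JL2 m z p ^ 2 + JL2 m z (p.1, p.2 + 1) ^ 2) / (2 * w p) ≤
      ∑ b ∈ sqI B, (1 / wm b) * ∑ k ∈ sqI m, hatF m (zS m z b) k ^ 2 / LamF m k := by
  rw [sum_sqI_blocks, sum_sqI_blocks, ← Finset.sum_add_distrib]
  refine Finset.sum_le_sum fun b hb => ?_
  have hmem : ∀ c ∈ sqI m, (b.1 * m + c.1, b.2 * m + c.2) ∈ sqI (B * m) := by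
    intro c hc
    obtain ⟨h1, h2⟩ := mem_sqI.1 hc
    obtain ⟨h3, h4⟩ := mem_sqI.1 hb
    rw [mem_sqI]
    constructor <;> simp only
    · nlinarith
    · nlinarith
  have hwb := hwm b hb
  have hw' : ∀ c ∈ sqI m, ∀ x : ℝ, 0 ≤ x → x / (2 * w (b.1 * m + c.1, b.2 * m + c.2)) ≤ 1 / wm b * (x / 2) := by
    intro c hc x hx
    have h := hw _ (hmem c hc)
    rw [blk_mk m b c hc] at h
    have : x / (2 * w (b.1 * m + c.1, b.2 * m + c.2)) ≤ x / (2 * wm b) := by gcongr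
    refine this.trans (le_of_eq ?_)
    field_simp
  have e1 : ∀ c ∈ sqI m, JL1 m z (b.1 * m + c.1, b.2 * m + c.2) = J1F m (zS m z b) c := by
    intro c hc; unfold JL1; rw [blk_mk m b c hc, loc_mk m b c hc]
  have e2 : ∀ c ∈ sqI m, JL2 m z (b.1 * m + c.1, b.2 * m + c.2) = J2F m (zS m z b) c := by
    intro c hc; unfold JL2; rw [blk_mk m b c hc, loc_mk m b c hc]
  have e3 : ∀ c ∈ sqI m, JL1 m z (b.1 * m + c.1 + 1, b.2 * m + c.2) = J1F m (zS m z b) (c.1 + 1, c.2) := by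
    intro c hc
    have h := loc_mk m b c hc
    unfold loc at h
    rw [Prod.ext_iff] at h
    simp only at h
    rw [JL1_succ m hm, blk_mk m b c hc, h.1, h.2]
  have e4 : ∀ c ∈ sqI m, JL2 m z (b.1 * m + c.1, b.2 * m + c.2 + 1) = J2F m (zS m z b) (c.1, c.2 + 1) := by
    intro c hc
    have h := loc_mk m b c hc
    unfold loc at h
    rw [Prod.ext_iff] at h
    simp only at h
    rw [JL2_succ m hm, blk_mk m b c hc, h.1, h.2]
  have tele : ∀ f : ℕ → ℝ, f 0 = 0 → f m = 0 → ∑ i ∈ Finset.range m, f (i + 1) = ∑ i ∈ Finset.range m, f i := by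
    intro f h0 hm
    have h1 := Finset.sum_range_succ f m
    have h2 := Finset.sum_range_succ' f m
    rw [h0] at h2; rw [hm] at h1; linarith
  have t1 : ∑ c ∈ sqI m, J1F m (zS m z b) (c.1 + 1, c.2) ^ 2 = ∑ c ∈ sqI m, J1F m (zS m z b) c ^ 2 := by
    unfold sqI
    rw [Finset.sum_product_right, Finset.sum_product_right]
    refine Finset.sum_congr rfl fun j _ => ?_
    exact tele (fun i => J1F m (zS m z b) (i, j) ^ 2) (by simp [J1F_bdry0]) (by simp [J1F_bdry1 m hm])
  have t2 : ∑ c ∈ sqI m, J2F m (zS m z b) (c.1, c.2 + 1) ^ 2 = ∑ c ∈ sqI m, J2F m (zS m z b) c ^ 2 := by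
    unfold sqI
    rw [Finset.sum_product, Finset.sum_product]
    refine Finset.sum_congr rfl fun j _ => ?_
    exact tele (fun i => J2F m (zS m z b) (j, i) ^ 2) (by simp [J2F_bdry0]) (by simp [J2F_bdry1 m hm])
  calc _ ≤ ∑ c ∈ sqI m, 1 / wm b * ((J1F m (zS m z b) c ^ 2 + J1F m (zS m z b) (c.1 + 1, c.2) ^ 2) / 2) +
        ∑ c ∈ sqI m, 1 / wm b * ((J2F m (zS m z b) c ^ 2 + J2F m (zS m z b) (c.1, c.2 + 1) ^ 2) / 2) := by
        refine add_le_add (Finset.sum_le_sum fun c hc => ?_) (Finset.sum_le_sum fun c hc => ?_)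
        · rw [e1 c hc, e3 c hc]
          exact hw' c hc _ (by positivity)
        · rw [e2 c hc, e4 c hc]
          exact hw' c hc _ (by positivity)
    _ = 1 / wm b * (∑ c ∈ sqI m, J1F m (zS m z b) c ^ 2 + ∑ c ∈ sqI m, J2F m (zS m z b) c ^ 2) := by
        rw [← Finset.mul_sum, ← Finset.mul_sum, ← Finset.sum_div, ← Finset.sum_div,
          Finset.sum_add_distrib, Finset.sum_add_distrib, t1, t2]
        ring
    _ ≤ _ := by rw [JF_energy]

lemma vF_abs (m : ℕ) (z : ℕ × ℕ → ℝ) (B : ℕ) (Y : ℝ) (hY0 : 0 ≤ Y)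
    (hY : ∑ b ∈ sqI B, ZS m z b ^ 2 ≤ Y ^ 2) (p : ℕ × ℕ)
    (hp : p ∈ sqI (B * m)) : |vF m z p| ≤ Y / (m : ℝ) ^ 2 := by
  unfold vF
  rw [abs_div, abs_of_nonneg (by positivity : (0 : ℝ) ≤ (m : ℝ) ^ 2)]
  gcongr
  have h2 : ZS m z (blk m p) ^ 2 ≤ ∑ b ∈ sqI B, ZS m z b ^ 2 :=
    Finset.single_le_sum (f := fun b => ZS m z b ^ 2) (fun _ _ => sq_nonneg _) (blk_mem B m p hp)
  exact abs_le_of_sq_le_sq (h2.trans hY) hY0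

lemma rF_abs (B m : ℕ) (hB : 0 < B) (hm : 0 < m) (z : ℕ × ℕ → ℝ) (V : ℝ)
    (hV : ∀ p ∈ sqI (B * m), |vF m z p| ≤ V) (j : ℕ) (hj : j < B * m) : |rF B m z j| ≤ V := by
  have hG : (0 : ℝ) < ((B * m : ℕ) : ℝ) := by exact_mod_cast (Nat.mul_pos hB hm)
  unfold rF
  rw [abs_div, abs_of_pos hG, div_le_iff₀ hG]
  calc _ ≤ ∑ i ∈ Finset.range (B * m), |vF m z (i, j)| := Finset.abs_sum_le_sum_abs _ _
    _ ≤ ∑ i ∈ Finset.range (B * m), V := Finset.sum_le_sum fun i hi =>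
        hV _ (mem_sqI.2 ⟨Finset.mem_range.1 hi, hj⟩)
    _ = _ := by rw [Finset.sum_const, nsmul_eq_mul, Finset.card_range, mul_comm]

lemma Jc1_abs (B m : ℕ) (hB : 0 < B) (hm : 0 < m) (z : ℕ × ℕ → ℝ) (V : ℝ)
    (hV : ∀ p ∈ sqI (B * m), |vF m z p| ≤ V) (p q : ℕ) (hp : p ≤ B * m) (hq : q < B * m) :
    |Jc1 B m z (p, q)| ≤ 2 * (B * m : ℕ) * V := by
  have hV0 : 0 ≤ V := le_trans (abs_nonneg _) (rF_abs B m hB hm z V hV q hq)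
  unfold Jc1
  simp only
  calc _ ≤ ∑ i ∈ Finset.range p, |vF m z (i, q) - rF B m z q| := Finset.abs_sum_le_sum_abs _ _
    _ ≤ ∑ i ∈ Finset.range p, (V + V) := Finset.sum_le_sum fun i hi => by
        have h1 := hV (i, q) (mem_sqI.2 ⟨lt_of_lt_of_le (Finset.mem_range.1 hi) hp, hq⟩)
        have h2 := rF_abs B m hB hm z V hV q hq
        exact (abs_sub _ _).trans (add_le_add h1 h2)
    _ = p * (V + V) := by rw [Finset.sum_const, nsmul_eq_mul, Finset.card_range]
    _ ≤ (B * m : ℕ) * (V + V) := by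
        have : (p : ℝ) ≤ (B * m : ℕ) := by exact_mod_cast hp
        gcongr
    _ = _ := by ring

lemma Jc2_abs (B m : ℕ) (hB : 0 < B) (hm : 0 < m) (z : ℕ × ℕ → ℝ) (V : ℝ)
    (hV : ∀ p ∈ sqI (B * m), |vF m z p| ≤ V) (p q : ℕ) (hp : p ≤ B * m) :
    |Jc2 B m z (q, p)| ≤ 2 * (B * m : ℕ) * V := by
  have hV0 : 0 ≤ V := le_trans (abs_nonneg _) (rF_abs B m hB hm z V hV 0 (Nat.mul_pos hB hm))
  unfold Jc2
  simp only
  calc _ ≤ ∑ i ∈ Finset.range p, |rF B m z i| := Finset.abs_sum_le_sum_abs _ _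
    _ ≤ ∑ i ∈ Finset.range p, V := Finset.sum_le_sum fun i hi =>
        rF_abs B m hB hm z V hV i (lt_of_lt_of_le (Finset.mem_range.1 hi) hp)
    _ = p * V := by rw [Finset.sum_const, nsmul_eq_mul, Finset.card_range]
    _ ≤ (B * m : ℕ) * V := by
        have : (p : ℝ) ≤ (B * m : ℕ) := by exact_mod_cast hp
        gcongr
    _ ≤ _ := by nlinarith [mul_nonneg (Nat.cast_nonneg (α := ℝ) (B * m)) hV0]

end Part8

section Part9
/-! ### Macroscopic transport -/

def sigF (B m : ℕ) (a b : ℕ × ℕ → ℝ) (p : ℕ × ℕ) : ℝ :=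
  a p - (JG1 B m (fun q => a q - b q) (p.1 + 1, p.2) - JG1 B m (fun q => a q - b q) p)

def EnB (B m : ℕ) (wm z : ℕ × ℕ → ℝ) : ℝ :=
  ∑ b ∈ sqI B, (1 / wm b) * ∑ k ∈ sqI m, hatF m (zS m z b) k ^ 2 / LamF m k

def YB (B m : ℕ) (z : ℕ × ℕ → ℝ) : ℝ := ∑ b ∈ sqI B, ZS m z b ^ 2

lemma sq_split (ε : ℝ) (hε : 0 < ε) (x y : ℝ) :
    (x + y) ^ 2 ≤ (1 + ε) * x ^ 2 + (1 + 1 / ε) * y ^ 2 := by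
  have h : 0 ≤ (ε * x - y) ^ 2 / ε := by positivity
  have e : (ε * x - y) ^ 2 / ε = ε * x ^ 2 - 2 * x * y + 1 / ε * y ^ 2 := by
    field_simp; ring
  rw [e] at h
  nlinarith

lemma flux_sum (B m : ℕ) (w c f g : ℕ × ℕ → ℝ) (e : ℕ × ℕ → ℕ × ℕ) (ε w0 U : ℝ) (hε : 0 < ε)
    (hε4 : ε ≤ 1 / 4) (hw0 : 0 < w0)
    (hw : ∀ p ∈ sqI (B * m), w0 ≤ w p) (hc : ∀ p ∈ sqI (B * m), c p ≤ (1 + ε) * w p)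
    (hg : ∀ p ∈ sqI (B * m), g p ^ 2 ≤ U) (hg' : ∀ p ∈ sqI (B * m), g (e p) ^ 2 ≤ U) :
    ∑ p ∈ sqI (B * m), c p * (((f p + g p) ^ 2 + (f (e p) + g (e p)) ^ 2) / (2 * ((1 - 2 * ε) * w p) ^ 2)) ≤
      (1 + ε) / (1 - 2 * ε) ^ 2 * ((1 + ε) * ∑ p ∈ sqI (B * m), (f p ^ 2 + f (e p) ^ 2) / (2 * w p) +
        (1 + 1 / ε) * (((B * m : ℕ) : ℝ) ^ 2 * U / w0)) := by
  have hcard : ((sqI (B * m)).card : ℝ) = ((B * m : ℕ) : ℝ) ^ 2 := by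
    unfold sqI; rw [Finset.card_product]; simp; ring
  have h1 : 0 < 1 - 2 * ε := by linarith
  have key : ∀ p ∈ sqI (B * m), c p * (((f p + g p) ^ 2 + (f (e p) + g (e p)) ^ 2) / (2 * ((1 - 2 * ε) * w p) ^ 2)) ≤
      (1 + ε) / (1 - 2 * ε) ^ 2 * ((1 + ε) * ((f p ^ 2 + f (e p) ^ 2) / (2 * w p)) + (1 + 1 / ε) * (U / w0)) := by
    intro p hp
    have hwp := hw p hp
    have hwp0 : 0 < w p := hw0.trans_le hwp
    have hU : 0 ≤ U := (sq_nonneg _).trans (hg p hp)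
    have s1 := sq_split ε hε (f p) (g p)
    have s2 := sq_split ε hε (f (e p)) (g (e p))
    have s3 := hg p hp
    have s4 := hg' p hp
    have hinv : 0 < 1 + 1 / ε := by positivity
    calc _ ≤ (1 + ε) * w p * (((f p + g p) ^ 2 + (f (e p) + g (e p)) ^ 2) / (2 * ((1 - 2 * ε) * w p) ^ 2)) := by
          gcongr; exact hc p hp
      _ = (1 + ε) / (1 - 2 * ε) ^ 2 * (((f p + g p) ^ 2 + (f (e p) + g (e p)) ^ 2) / (2 * w p)) := by
          field_simp
      _ ≤ (1 + ε) / (1 - 2 * ε) ^ 2 * (((1 + ε) * (f p ^ 2 + f (e p) ^ 2) + (1 + 1 / ε) * (2 * U)) / (2 * w p)) := by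
          have q3 := mul_le_mul_of_nonneg_left s3 hinv.le
          have q4 := mul_le_mul_of_nonneg_left s4 hinv.le
          refine mul_le_mul_of_nonneg_left (div_le_div_of_nonneg_right ?_ (by positivity)) (by positivity)
          linarith
      _ = (1 + ε) / (1 - 2 * ε) ^ 2 * ((1 + ε) * ((f p ^ 2 + f (e p) ^ 2) / (2 * w p)) + (1 + 1 / ε) * (U / w p)) := by
          congr 1; field_simp
      _ ≤ _ := by gcongr
  refine (Finset.sum_le_sum key).trans (le_of_eq ?_)
  rw [← Finset.mul_sum, Finset.sum_add_distrib, ← Finset.mul_sum, Finset.sum_const, nsmul_eq_mul, hcard]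
  ring

lemma macro_bound (B m : ℕ) (hB : 0 < B) (hm : 0 < m) (a b w wm : ℕ × ℕ → ℝ) (ε δ w0 κ : ℝ)
    (hε : 0 < ε) (hε4 : ε ≤ 1 / 4) (hδ : 0 ≤ δ) (hδε : δ ≤ ε) (hw0 : 0 < w0) (hκ : 0 ≤ κ)
    (hsum : ∑ p ∈ sqI (B * m), (a p - b p) = 0)
    (hw : ∀ p ∈ sqI (B * m), w0 ≤ w p)
    (hwm : ∀ b ∈ sqI B, 0 < wm b) (hwmw : ∀ p ∈ sqI (B * m), wm (blk m p) ≤ w p)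
    (ha : ∀ p ∈ sqI (B * m), |a p - w p| ≤ δ * w0)
    (hb : ∀ p ∈ sqI (B * m), |b p - w p| ≤ δ * w0)
    (hσ : ∀ p ∈ sqI (B * m), |sigF B m a b p - w p| ≤ δ * w0)
    (hL1 : ∀ i < B * m, ∀ j < B * m, ∀ i' < B * m, |w (i', j) - w (i, j)| ≤ κ * |(i' : ℝ) - i|)
    (hL2 : ∀ i < B * m, ∀ j < B * m, ∀ j' < B * m, |w (i, j') - w (i, j)| ≤ κ * |(j' : ℝ) - j|)
    (hκw : κ * (4 * δ * (B * m : ℕ) + 1) ≤ ε * w0) :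
    ∃ T : ℝ × ℝ → ℝ × ℝ, Measurable T ∧ (alphaM (B * m) a).map T = alphaM (B * m) b ∧
      ∫⁻ u, ENNReal.ofReal (d2 u (T u)) ∂(alphaM (B * m) a) ≤
        ENNReal.ofReal ((1 + ε) / (1 - 2 * ε) ^ 2 * ((1 + ε) * EnB B m wm (fun q => a q - b q) +
          (1 + 1 / ε) * (8 * (B : ℝ) ^ 4 * YB B m (fun q => a q - b q) / w0))) := by
  set z : ℕ × ℕ → ℝ := fun q => a q - b q with hz
  set G := B * m with hG
  have hGpos : 0 < G := Nat.mul_pos hB hm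
  set σ := sigF B m a b with hσd
  have hm' : (0 : ℝ) < m := by exact_mod_cast hm
  have mem : ∀ i < G, ∀ j < G, (i, j) ∈ sqI G := fun i hi j hj => mem_sqI.2 ⟨hi, hj⟩
  have hδw : δ * w0 ≤ w0 / 2 := by nlinarith
  have hdiv : ∀ i < G, ∀ j < G, JG1 B m z (i + 1, j) - JG1 B m z (i, j) = a (i, j) - σ (i, j) := by
    intro i _ j _
    simp only [hσd, sigF]; ring
  have hdiv' : ∀ i < G, ∀ j < G, JG2 B m z (i, j + 1) - JG2 B m z (i, j) = σ (i, j) - b (i, j) := by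
    intro i hi j hj
    have h := JG_div B m hm z i j
    have h2 := hdiv i hi j hj
    have : z (i, j) = a (i, j) - b (i, j) := rfl
    linarith
  have hlow : ∀ f : ℕ × ℕ → ℝ, (∀ p ∈ sqI G, |f p - w p| ≤ δ * w0) → ∀ i < G, ∀ j < G, w0 / 2 ≤ f (i, j) := by
    intro f hf i hi j hj
    have h1 := abs_le.1 (hf _ (mem i hi j hj))
    have h2 := hw _ (mem i hi j hj)
    linarith
  have bd1 : ∀ q < G, ∀ p ≤ G, |JG1 B m z (p, q)| ≤ p * (2 * δ * w0) := by
    intro q hq p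
    induction p with
    | zero => intro _; simp [JG1_zero]
    | succ p ih =>
      intro hp
      have h1 := ih (by omega)
      have h2 := hdiv p (by omega) q hq
      have h3 := abs_le.1 (ha _ (mem p (by omega) q hq))
      have h4 := abs_le.1 (hσ _ (mem p (by omega) q hq))
      rw [abs_le] at h1 ⊢
      push_cast
      constructor <;> linarith
  have bd2 : ∀ q < G, ∀ p ≤ G, |JG2 B m z (q, p)| ≤ p * (2 * δ * w0) := by
    intro q hq p
    induction p with
    | zero => intro _; simp [JG2_zero]
    | succ p ih =>
      intro hp
      have h1 := ih (by omega)
      have h2 := hdiv' q hq p (by omega)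
      have h3 := abs_le.1 (hb _ (mem q hq p (by omega)))
      have h4 := abs_le.1 (hσ _ (mem q hq p (by omega)))
      rw [abs_le] at h1 ⊢
      push_cast
      constructor <;> linarith
  have hη : ∀ p ≤ G, (p : ℝ) * (2 * δ * w0) ≤ w0 / 2 * (4 * δ * (G : ℕ)) := by
    intro p hp
    have : (p : ℝ) ≤ G := by exact_mod_cast hp
    calc (p : ℝ) * (2 * δ * w0) ≤ G * (2 * δ * w0) := by gcongr
      _ = _ := by ring
  have hwpos : ∀ i < G, ∀ j < G, 0 < (1 - 2 * ε) * w (i, j) := fun i hi j hj =>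
    mul_pos (by linarith) (hw0.trans_le (hw _ (mem i hi j hj)))
  have hll : ∀ (f : ℕ × ℕ → ℝ), (∀ p ∈ sqI G, |f p - w p| ≤ δ * w0) → ∀ p ∈ sqI G, ∀ p' ∈ sqI G, ∀ t : ℝ,
      |w p' - w p| ≤ κ * t → t ≤ 4 * δ * G + 1 → (1 - 2 * ε) * w p ≤ f p' := by
    intro f hf p hp p' hp' t h1 h2
    have h3 := abs_le.1 (hf p' hp')
    have h4 : κ * t ≤ ε * w0 := le_trans (by gcongr) hκw
    have h5 := abs_le.1 (h1.trans h4)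
    have h6 := hw p hp
    nlinarith
  obtain ⟨T, hT, hmap, hcost⟩ := twoD G a σ b (JG1 B m z) (JG2 B m z) (w0 / 2) (by positivity)
    (hlow a ha) (hlow σ hσ) (hlow b hb) (fun q _ => JG1_zero B m z q) (fun q _ => JG1_last B m hB hm z q)
    (fun q _ => JG2_zero B m z q) (fun q _ => JG2_last B m hm z hsum q) hdiv hdiv' (4 * δ * (G : ℕ))
    (fun p hp q hq => (bd1 q hq p hp).trans (hη p hp)) (fun p hp q hq => (bd2 q hq p hp).trans (hη p hp))
    (fun p => (1 - 2 * ε) * w p) hwpos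
    (fun i hi j hj i' hi' h => hll σ hσ _ (mem i hi j hj) _ (mem i' hi' j hj) _ (hL1 i hi j hj i' hi') h)
    (fun i hi j hj j' hj' h => hll b hb _ (mem i hi j hj) _ (mem i hi j' hj') _ (hL2 i hi j hj j' hj') h)
  refine ⟨T, hT, hmap, hcost.trans (ENNReal.ofReal_le_ofReal ?_)⟩
  have hYn : 0 ≤ YB B m z := Finset.sum_nonneg fun _ _ => sq_nonneg _
  set V := Real.sqrt (YB B m z) / (m : ℝ) ^ 2 with hV
  have hVb : ∀ p ∈ sqI G, |vF m z p| ≤ V := fun p hp => vF_abs m z B _ (Real.sqrt_nonneg _)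
    (by rw [Real.sq_sqrt hYn]; exact le_rfl) p hp
  set U := (2 * (G : ℕ) * V) ^ 2 with hU
  have sqle : ∀ x : ℝ, |x| ≤ 2 * (G : ℕ) * V → x ^ 2 ≤ U := by
    intro x hx
    rw [hU, ← sq_abs x]
    exact pow_le_pow_left₀ (abs_nonneg _) hx 2
  have up : ∀ f : ℕ × ℕ → ℝ, (∀ p ∈ sqI G, |f p - w p| ≤ δ * w0) → ∀ p ∈ sqI G, f p ≤ (1 + ε) * w p := by
    intro f hf p hp
    have h3 := abs_le.1 (hf p hp)
    have h6 := hw p hp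
    nlinarith
  have f1 := flux_sum B m w a (JL1 m z) (Jc1 B m z) (fun p => (p.1 + 1, p.2)) ε w0 U hε hε4 hw0 hw (up a ha)
    (fun p hp => sqle _ (Jc1_abs B m hB hm z V hVb p.1 p.2 (mem_sqI.1 hp).1.le (mem_sqI.1 hp).2))
    (fun p hp => sqle _ (Jc1_abs B m hB hm z V hVb (p.1 + 1) p.2 (mem_sqI.1 hp).1 (mem_sqI.1 hp).2))
  have f2 := flux_sum B m w σ (JL2 m z) (Jc2 B m z) (fun p => (p.1, p.2 + 1)) ε w0 U hε hε4 hw0 hw (up σ hσ)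
    (fun p hp => sqle _ (Jc2_abs B m hB hm z V hVb p.2 p.1 (mem_sqI.1 hp).2.le))
    (fun p hp => sqle _ (Jc2_abs B m hB hm z V hVb (p.2 + 1) p.1 (mem_sqI.1 hp).2))
  have le := local_energy B m hm z w wm hwm hwmw
  have h12 : 0 < 1 - 2 * ε := by linarith
  refine (add_le_add f1 f2).trans ?_
  rw [← mul_add]
  refine mul_le_mul_of_nonneg_left ?_ (by positivity)
  have hUe : ((G : ℕ) : ℝ) ^ 2 * U = 4 * (B : ℝ) ^ 4 * YB B m z := by
    rw [hU, hV, mul_pow, mul_pow, div_pow, Real.sq_sqrt hYn, hG]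
    push_cast
    field_simp
    ring
  rw [hUe]
  have le' := mul_le_mul_of_nonneg_left le (by positivity : (0:ℝ) ≤ 1 + ε)
  have e8 : 8 * (B : ℝ) ^ 4 * YB B m z / w0 = 4 * (B : ℝ) ^ 4 * YB B m z / w0 + 4 * (B : ℝ) ^ 4 * YB B m z / w0 := by ring
  rw [e8]
  unfold EnB
  linarith

end Part9

section Part10
/-! ### Deterministic bound on the good event -/

/-- The family of test functions defining the good event. -/
def tst (m : ℕ) (j : Fin 3) (c d : ℕ × ℕ) : ℝ :=
  if j = 0 then (if d = c then 1 else 0)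
  else if j = 1 then (if blk m d = blk m c then HF m (loc m c) (loc m d) else 0)
  else (if blk m d = blk m c then 1 / (m : ℝ) ^ 2 else 0)

lemma sum_blk (B m : ℕ) (b : ℕ × ℕ) (hb : b ∈ sqI B) (f : ℕ × ℕ → ℝ) :
    ∑ d ∈ sqI (B * m), (if blk m d = b then f d else 0) =
      ∑ c ∈ sqI m, f (b.1 * m + c.1, b.2 * m + c.2) := by
  rw [sum_sqI_blocks, Finset.sum_eq_single b]
  · refine Finset.sum_congr rfl fun c hc => ?_
    rw [blk_mk m b c hc, if_pos rfl]
  · intro b' _ hne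
    refine Finset.sum_eq_zero fun c hc => ?_
    rw [blk_mk m b' c hc, if_neg hne]
  · intro h; exact absurd hb h

lemma tst0_sum (B m : ℕ) (c : ℕ × ℕ) (hc : c ∈ sqI (B * m)) (u : ℕ × ℕ → ℝ) :
    ∑ d ∈ sqI (B * m), tst m 0 c d * u d = u c := by
  simp [tst, hc]

lemma tst1_sum (B m : ℕ) (c : ℕ × ℕ) (hc : c ∈ sqI (B * m)) (u : ℕ × ℕ → ℝ) :
    ∑ d ∈ sqI (B * m), tst m 1 c d * u d = ∑ d ∈ sqI m, HF m (loc m c) d * zS m u (blk m c) d := by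
  have := sum_blk B m (blk m c) (blk_mem B m c hc) (fun d => HF m (loc m c) (loc m d) * u d)
  simp only [tst, ite_mul, zero_mul]
  simp only [Fin.one_eq_zero_iff, OfNat.ofNat_ne_one, if_false, if_true]
  refine this.trans (Finset.sum_congr rfl fun d hd => ?_)
  rw [loc_mk m _ d hd]; rfl

lemma tst2_sum (B m : ℕ) (c : ℕ × ℕ) (hc : c ∈ sqI (B * m)) (u : ℕ × ℕ → ℝ) :
    ∑ d ∈ sqI (B * m), tst m 2 c d * u d = vF m u c := by
  have := sum_blk B m (blk m c) (blk_mem B m c hc) (fun d => 1 / (m : ℝ) ^ 2 * u d)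
  have h1 : ((2 : Fin 3) = 0) = False := by simp
  have h2 : ((2 : Fin 3) = 1) = False := by simp
  simp only [tst, ite_mul, zero_mul, h1, h2, if_false]
  refine this.trans ?_
  unfold vF ZS zS
  rw [← Finset.mul_sum]; ring

lemma tests_good (B m : ℕ) (hB : 0 < B) (hm : 0 < m) (a b w : ℕ × ℕ → ℝ) (t : ℝ)
    (hta : ∀ j : Fin 3, ∀ c ∈ sqI (B * m), |∑ d ∈ sqI (B * m), tst m j c d * (a d - w d)| ≤ t)
    (htb : ∀ j : Fin 3, ∀ c ∈ sqI (B * m), |∑ d ∈ sqI (B * m), tst m j c d * (b d - w d)| ≤ t) :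
    ∀ p ∈ sqI (B * m), |a p - w p| ≤ t ∧ |b p - w p| ≤ t ∧ |sigF B m a b p - w p| ≤ 7 * t := by
  have hz : ∀ j : Fin 3, ∀ c ∈ sqI (B * m), |∑ d ∈ sqI (B * m), tst m j c d * (a d - b d)| ≤ 2 * t := by
    intro j c hc
    have h1 := hta j c hc
    have h2 := htb j c hc
    have : ∑ d ∈ sqI (B * m), tst m j c d * (a d - b d) =
        ∑ d ∈ sqI (B * m), tst m j c d * (a d - w d) - ∑ d ∈ sqI (B * m), tst m j c d * (b d - w d) := by
      rw [← Finset.sum_sub_distrib]; exact Finset.sum_congr rfl fun d _ => by ring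
    rw [this]
    exact (abs_sub _ _).trans (by linarith)
  have hv : ∀ p ∈ sqI (B * m), |vF m (fun q => a q - b q) p| ≤ 2 * t := by
    intro p hp
    have := hz 2 p hp
    rwa [tst2_sum B m p hp (fun q => a q - b q)] at this
  intro p hp
  have h1 := hta 0 p hp
  have h2 := htb 0 p hp
  rw [tst0_sum B m p hp (fun q => a q - w q)] at h1
  rw [tst0_sum B m p hp (fun q => b q - w q)] at h2
  refine ⟨h1, h2, ?_⟩
  have h3 := hz 1 p hp
  rw [tst1_sum B m p hp (fun q => a q - b q)] at h3
  have h4 := hv p hp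
  have h5 := rF_abs B m hB hm (fun q => a q - b q) (2 * t) hv p.2 (mem_sqI.1 hp).2
  set z : ℕ × ℕ → ℝ := fun q => a q - b q
  have h6 : JG1 B m z (p.1 + 1, p.2) - JG1 B m z p =
      (∑ d ∈ sqI m, HF m (loc m p) d * zS m z (blk m p) d) + (vF m z p - rF B m z p.2) := by
    obtain ⟨i, j⟩ := p
    have h3 : Jc1 B m z (i + 1, j) - Jc1 B m z (i, j) = vF m z (i, j) - rF B m z j := by
      unfold Jc1; simp only; rw [Finset.sum_range_succ]; ring
    have e1 : JL1 m z (i, j) = J1F m (zS m z (blk m (i, j))) (i % m, j % m) := rfl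
    unfold JG1
    rw [JL1_succ m hm, e1]
    have := J1F_sub_eq_HF m (zS m z (blk m (i, j))) (i % m) (j % m)
    simp only at *
    unfold loc
    linarith
  have h7 : sigF B m a b p - w p = (a p - w p) -
      ((∑ d ∈ sqI m, HF m (loc m p) d * zS m z (blk m p) d) + (vF m z p - rF B m z p.2)) := by
    rw [← h6]; unfold sigF; ring
  rw [h7]
  rw [abs_le] at *
  constructor <;> linarith

def cnt {N : ℕ} (f : Fin N → ℕ × ℕ) (c : ℕ × ℕ) : ℝ := ∑ i, if f i = c then (1 : ℝ) else 0

/-- Subcell discrepancy. -/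
def RF {N : ℕ} (G M : ℕ) (f : Fin N → ℕ × ℕ) : ℝ :=
  ∑ c ∈ sqI G, ∑ r ∈ sqI M,
    |cnt f (c.1 * M + r.1, c.2 * M + r.2) - cnt (fun i => blk M (f i)) c / (M : ℝ) ^ 2|

lemma RF_nonneg {N : ℕ} (G M : ℕ) (f : Fin N → ℕ × ℕ) : 0 ≤ RF G M f :=
  Finset.sum_nonneg fun _ _ => Finset.sum_nonneg fun _ _ => abs_nonneg _

lemma sum_cnt {N : ℕ} (G : ℕ) (f : Fin N → ℕ × ℕ) (hf : ∀ i, f i ∈ sqI G) (g : ℕ × ℕ → ℝ) :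
    ∑ c ∈ sqI G, g c * cnt f c = ∑ i, g (f i) := by
  unfold cnt
  simp_rw [Finset.mul_sum]
  rw [Finset.sum_comm]
  refine Finset.sum_congr rfl fun i _ => ?_
  simp [hf i]

lemma within' (N G M : ℕ) (hM : 0 < M) (X : Fin N → ℝ × ℝ) (f : Fin N → ℕ × ℕ)
    (hf : ∀ i, f i ∈ sqI (G * M))
    (hX : ∀ i, (X i).1 ∈ Set.Ico (((f i).1 : ℝ) / M) (((f i).1 + 1) / M) ∧
      (X i).2 ∈ Set.Ico (((f i).2 : ℝ) / M) (((f i).2 + 1) / M)) :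
    ∃ κ : Fin N → Measure (ℝ × ℝ), (∀ i, κ i Set.univ = 1) ∧
      ∑ i, κ i = alphaM G (cnt fun i => blk M (f i)) ∧
      ∑ i, ∫⁻ u, ENNReal.ofReal (d2 (X i) u) ∂(κ i) ≤
        ENNReal.ofReal (2 * N / M ^ 2 + 2 * RF G M f) := by
  have hM' : (0 : ℝ) < M := by exact_mod_cast hM
  have key : ∀ k : ℕ, Set.Ico ((k : ℝ) / M) ((k + 1) / M) = Is M (k / M) (k % M) := by
    intro k
    have h : ((k / M : ℕ) : ℝ) * M + ((k % M : ℕ) : ℝ) = k := by exact_mod_cast Nat.div_add_mod' k M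
    unfold Is
    congr 1
    · field_simp; linarith
    · field_simp; linarith
  obtain ⟨κ, h1, h2, h3⟩ := within N G M hM X (fun i => blk M (f i)) (fun i => loc M (f i))
    (fun i => blk_mem G M _ (hf i)) (fun i => loc_mem M hM _)
    (fun i => ⟨(key _).subset (hX i).1, (key _).subset (hX i).2⟩)
    (cnt fun i => blk M (f i)) (fun c => rfl) _ (fun c r => rfl)
  refine ⟨κ, h1, h2, h3.trans (le_of_eq ?_)⟩
  congr 3
  unfold RF
  refine Finset.sum_congr rfl fun c _ => Finset.sum_congr rfl fun r hr => ?_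
  congr 2
  unfold cnt
  refine Finset.sum_congr rfl fun i _ => ?_
  congr 1
  apply propext
  constructor
  · rintro ⟨h1, h2⟩
    rw [← h1, ← h2]
    unfold blk loc
    simp only [Nat.div_add_mod']
  · intro h
    rw [h]
    exact ⟨blk_mk M c r hr, loc_mk M c r hr⟩

lemma YB_nonneg (B m : ℕ) (z : ℕ × ℕ → ℝ) : 0 ≤ YB B m z := Finset.sum_nonneg fun _ _ => sq_nonneg _

lemma EnB_nonneg (B m : ℕ) (wm z : ℕ × ℕ → ℝ) (hwm : ∀ b ∈ sqI B, 0 < wm b) : 0 ≤ EnB B m wm z := by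
  refine Finset.sum_nonneg fun b hb => mul_nonneg (by have := hwm b hb; positivity)
    (Finset.sum_nonneg fun k hk => div_nonneg (sq_nonneg _) ?_)
  by_cases h0 : k = (0, 0)
  · rw [h0, LamF_zero]
  · exact (LamF_pos m k hk h0).le

/-- The bound valid on the good event. -/
def goodB {N : ℕ} (B m M : ℕ) (ε w0 : ℝ) (wm : ℕ × ℕ → ℝ) (f g : Fin N → ℕ × ℕ) : ℝ :=
  (1 + ε) * ((1 + ε) / (1 - 2 * ε) ^ 2 *
      ((1 + ε) * EnB B m wm (fun q => cnt (fun i => blk M (f i)) q - cnt (fun i => blk M (g i)) q) +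
      (1 + 1 / ε) * (8 * (B : ℝ) ^ 4 *
        YB B m (fun q => cnt (fun i => blk M (f i)) q - cnt (fun i => blk M (g i)) q) / w0))) +
    2 * (1 + 1 / ε) * ((2 * N / M ^ 2 + 2 * RF (B * m) M f) + (2 * N / M ^ 2 + 2 * RF (B * m) M g))

lemma goodB_nonneg {N : ℕ} (B m M : ℕ) (ε w0 : ℝ) (hε : 0 < ε) (hw0 : 0 < w0)
    (wm : ℕ × ℕ → ℝ) (hwm : ∀ b ∈ sqI B, 0 < wm b) (f g : Fin N → ℕ × ℕ) : 0 ≤ goodB B m M ε w0 wm f g := by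
  unfold goodB
  have h1 := EnB_nonneg B m wm (fun q => cnt (fun i => blk M (f i)) q - cnt (fun i => blk M (g i)) q) hwm
  have h2 := YB_nonneg B m (fun q => cnt (fun i => blk M (f i)) q - cnt (fun i => blk M (g i)) q)
  have h3 := RF_nonneg (B * m) M f
  have h4 := RF_nonneg (B * m) M g
  positivity

lemma det_bound {N : ℕ} (B m M : ℕ) (hB : 0 < B) (hm : 0 < m) (hM : 0 < M) (X Y : Fin N → ℝ × ℝ)
    (f g : Fin N → ℕ × ℕ) (hf : ∀ i, f i ∈ sqI (B * m * M)) (hg : ∀ i, g i ∈ sqI (B * m * M))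
    (hX : ∀ i, (X i).1 ∈ Set.Ico (((f i).1 : ℝ) / M) (((f i).1 + 1) / M) ∧
      (X i).2 ∈ Set.Ico (((f i).2 : ℝ) / M) (((f i).2 + 1) / M))
    (hY : ∀ i, (Y i).1 ∈ Set.Ico (((g i).1 : ℝ) / M) (((g i).1 + 1) / M) ∧
      (Y i).2 ∈ Set.Ico (((g i).2 : ℝ) / M) (((g i).2 + 1) / M))
    (w wm : ℕ × ℕ → ℝ) (ε δ w0 κ t : ℝ)
    (hε : 0 < ε) (hε4 : ε ≤ 1 / 4) (hδ : 0 ≤ δ) (hδε : δ ≤ ε) (hw0 : 0 < w0) (hκ : 0 ≤ κ)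
    (hw : ∀ p ∈ sqI (B * m), w0 ≤ w p)
    (hwm : ∀ b ∈ sqI B, 0 < wm b) (hwmw : ∀ p ∈ sqI (B * m), wm (blk m p) ≤ w p)
    (hL1 : ∀ i < B * m, ∀ j < B * m, ∀ i' < B * m, |w (i', j) - w (i, j)| ≤ κ * |(i' : ℝ) - i|)
    (hL2 : ∀ i < B * m, ∀ j < B * m, ∀ j' < B * m, |w (i, j') - w (i, j)| ≤ κ * |(j' : ℝ) - j|)
    (hκw : κ * (4 * δ * (B * m : ℕ) + 1) ≤ ε * w0)
    (ht0 : 0 ≤ t) (ht : 7 * t ≤ δ * w0)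
    (htx : ∀ j : Fin 3, ∀ c ∈ sqI (B * m),
      |∑ d ∈ sqI (B * m), tst m j c d * (cnt (fun i => blk M (f i)) d - w d)| ≤ t)
    (hty : ∀ j : Fin 3, ∀ c ∈ sqI (B * m),
      |∑ d ∈ sqI (B * m), tst m j c d * (cnt (fun i => blk M (g i)) d - w d)| ≤ t) :
    (⨅ π : Equiv.Perm (Fin N), ∑ i, d2 (X i) (Y (π i))) ≤ goodB B m M ε w0 wm f g := by
  have hgood := tests_good B m hB hm _ _ w t htx hty
  obtain ⟨κx, hx1, hx2, hx3⟩ := within' N (B * m) M hM X f hf hX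
  obtain ⟨κy, hy1, hy2, hy3⟩ := within' N (B * m) M hM Y g hg hY
  have hsum : ∑ p ∈ sqI (B * m), (cnt (fun i => blk M (f i)) p - cnt (fun i => blk M (g i)) p) = 0 := by
    have h1 := sum_cnt (B * m) (fun i => blk M (f i)) (fun i => blk_mem _ M _ (hf i)) (fun _ => 1)
    have h2 := sum_cnt (B * m) (fun i => blk M (g i)) (fun i => blk_mem _ M _ (hg i)) (fun _ => 1)
    simp only [one_mul] at h1 h2
    rw [Finset.sum_sub_distrib, h1, h2, sub_self]
  obtain ⟨T, hT, hmap, hcost⟩ := macro_bound B m hB hm _ _ w wm ε δ w0 κ hε hε4 hδ hδε hw0 hκ hsum hw hwm hwmw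
    (fun p hp => (hgood p hp).1.trans (by linarith)) (fun p hp => (hgood p hp).2.1.trans (by linarith))
    (fun p hp => (hgood p hp).2.2.trans ht) hL1 hL2 hκw
  have hgl := glue X Y _ κx κy hx1 hy1 T hT hx2 (hy2.trans hmap.symm) ε hε
  have hEn := EnB_nonneg B m wm (fun q => cnt (fun i => blk M (f i)) q - cnt (fun i => blk M (g i)) q) hwm
  have hYn := YB_nonneg B m (fun q => cnt (fun i => blk M (f i)) q - cnt (fun i => blk M (g i)) q)
  have hRf := RF_nonneg (B * m) M f
  have hRg := RF_nonneg (B * m) M g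
  rw [← ENNReal.ofReal_le_ofReal_iff (goodB_nonneg B m M ε w0 hε hw0 wm hwm f g)]
  refine hgl.trans ((add_le_add (mul_le_mul' le_rfl hcost)
    (mul_le_mul' le_rfl (add_le_add hx3 hy3))).trans (le_of_eq ?_))
  unfold goodB
  rw [← ENNReal.ofReal_add (by positivity) (by positivity), ← ENNReal.ofReal_mul (by positivity),
    ← ENNReal.ofReal_mul (by positivity), ← ENNReal.ofReal_add (by positivity) (by positivity)]

end Part10

section Part11
/-! ### Probabilistic estimates for sums of i.i.d. bounded variables -/

section Prob
variable {Ω : Type*} [MeasurableSpace Ω]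

def Sf (μ : Measure Ω) {N : ℕ} (h : Ω → ℝ) (x : Fin N → Ω) : ℝ := ∑ i, h (x i) - N * ∫ u, h u ∂μ

abbrev PN (μ : Measure Ω) (N : ℕ) : Measure (Fin N → Ω) := Measure.pi fun _ => μ

lemma measurable_Sf (μ : Measure Ω) {N : ℕ} (h : Ω → ℝ) (hh : Measurable h) :
    Measurable (fun x : Fin N → Ω => Sf μ h x) := by
  unfold Sf; fun_prop

lemma Sf_bound (μ : Measure Ω) {N : ℕ} (h : Ω → ℝ) (H : ℝ) (hH : ∀ u, |h u| ≤ H) (x : Fin N → Ω) :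
    |Sf μ h x| ≤ N * H + |N * ∫ u, h u ∂μ| := by
  unfold Sf
  refine (abs_sub _ _).trans (add_le_add ?_ le_rfl)
  refine (Finset.abs_sum_le_sum_abs _ _).trans ((Finset.sum_le_sum fun i _ => hH _).trans ?_)
  simp

lemma int_of_bdd {Ω : Type*} [MeasurableSpace Ω] (μ : Measure Ω) [IsFiniteMeasure μ] (h : Ω → ℝ) (hh : Measurable h) (H : ℝ)
    (hH : ∀ u, |h u| ≤ H) : Integrable h μ :=
  Integrable.of_bound hh.aestronglyMeasurable H (Eventually.of_forall hH)

lemma Sf_int (μ : Measure Ω) [IsProbabilityMeasure μ] {N : ℕ} (h : Ω → ℝ) (hh : Measurable h) (H : ℝ)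
    (hH : ∀ u, |h u| ≤ H) : Integrable (fun x => Sf μ h x) (PN μ N) :=
  int_of_bdd _ _ (measurable_Sf μ h hh) _ (Sf_bound μ h H hH)

lemma Sf_sq_int (μ : Measure Ω) [IsProbabilityMeasure μ] {N : ℕ} (h : Ω → ℝ) (hh : Measurable h) (H : ℝ)
    (hH : ∀ u, |h u| ≤ H) : Integrable (fun x => Sf μ h x ^ 2) (PN μ N) := by
  refine int_of_bdd _ _ ((measurable_Sf μ h hh).pow_const 2) ((N * H + |N * ∫ u, h u ∂μ|) ^ 2) fun x => ?_
  rw [abs_pow]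
  exact pow_le_pow_left₀ (abs_nonneg _) (Sf_bound μ h H hH x) 2

lemma Sf_mean (μ : Measure Ω) [IsProbabilityMeasure μ] {N : ℕ} (h : Ω → ℝ) (hh : Measurable h) (H : ℝ)
    (hH : ∀ u, |h u| ≤ H) : ∫ x, Sf μ h x ∂(PN μ N) = 0 := by
  have hi : ∀ i : Fin N, Integrable (fun x : Fin N → Ω => h (x i)) (PN μ N) := fun i =>
    int_of_bdd _ _ (by fun_prop) H fun x => hH _
  unfold Sf
  rw [integral_sub (integrable_finsetSum _ fun i _ => hi i) (integrable_const _),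
    integral_finsetSum _ fun i _ => hi i]
  have : ∀ i : Fin N, ∫ x : Fin N → Ω, h (x i) ∂(PN μ N) = ∫ u, h u ∂μ := fun i =>
    integral_comp_eval (μ := fun _ : Fin N => μ) (i := i) hh.aestronglyMeasurable
  simp [this]

lemma Sf_var (μ : Measure Ω) [IsProbabilityMeasure μ] {N : ℕ} (h : Ω → ℝ) (hh : Measurable h) (H : ℝ)
    (hH : ∀ u, |h u| ≤ H) : ∫ x, Sf μ h x ^ 2 ∂(PN μ N) ≤ N * ∫ u, h u ^ 2 ∂μ := by
  have hm : MemLp h 2 μ := MemLp.of_bound hh.aestronglyMeasurable H (Eventually.of_forall hH)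
  have h1 := ProbabilityTheory.variance_sum_pi (ι := Fin N) (μ := fun _ => μ) (X := fun _ => h) (fun _ => hm)
  have h2 := ProbabilityTheory.variance_le_expectation_sq (μ := μ) (X := h) hh.aestronglyMeasurable
  have hmean := Sf_mean (N := N) μ h hh H hH
  have hi : ∀ i : Fin N, Integrable (fun x : Fin N → Ω => h (x i)) (PN μ N) := fun i =>
    int_of_bdd _ _ (by fun_prop) H fun x => hH _
  have hm2 : ∫ x : Fin N → Ω, ∑ i, h (x i) ∂(PN μ N) = N * ∫ u, h u ∂μ := by
    unfold Sf at hmean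
    rw [integral_sub (integrable_finsetSum _ fun i _ => hi i) (integrable_const _)] at hmean
    simp only [integral_const, probReal_univ, one_smul] at hmean
    linarith
  have e : (∑ i : Fin N, fun ω : Fin N → Ω => h (ω i)) = fun x => ∑ i, h (x i) := by
    ext x; simp
  rw [e, ProbabilityTheory.variance_eq_integral
    (Measurable.aemeasurable (by fun_prop)), hm2] at h1
  unfold Sf
  rw [h1]
  simp only [Finset.sum_const, Finset.card_univ, Fintype.card_fin, nsmul_eq_mul]
  exact mul_le_mul_of_nonneg_left h2 (by positivity)

lemma Sf_abs (μ : Measure Ω) [IsProbabilityMeasure μ] {N : ℕ} (h : Ω → ℝ) (hh : Measurable h) (H : ℝ)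
    (hH : ∀ u, |h u| ≤ H) (τ : ℝ) (hτ : 0 < τ) (hV : N * ∫ u, h u ^ 2 ∂μ ≤ τ ^ 2) :
    ∫ x, |Sf μ h x| ∂(PN μ N) ≤ τ := by
  have h1 := Sf_var (N := N) μ h hh H hH
  have h2 : ∫ x, |Sf μ h x| ∂(PN μ N) ≤ ∫ x, ((1 / (2 * τ)) * Sf μ h x ^ 2 + τ / 2) ∂(PN μ N) := by
    refine integral_mono (Sf_int μ h hh H hH).abs
      (((Sf_sq_int μ h hh H hH).const_mul _).add (integrable_const _)) fun x => ?_
    simp only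
    have : (1 / (2 * τ)) * Sf μ h x ^ 2 + τ / 2 - |Sf μ h x| = (|Sf μ h x| - τ) ^ 2 / (2 * τ) := by
      rw [← sq_abs]; field_simp; ring
    have h3 : 0 ≤ (|Sf μ h x| - τ) ^ 2 / (2 * τ) := by positivity
    linarith
  rw [integral_add ((Sf_sq_int μ h hh H hH).const_mul _) (integrable_const _), integral_const_mul] at h2
  simp only [integral_const, probReal_univ, one_smul] at h2
  refine h2.trans ?_
  have : 1 / (2 * τ) * ∫ x, Sf μ h x ^ 2 ∂(PN μ N) ≤ 1 / (2 * τ) * τ ^ 2 :=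
    mul_le_mul_of_nonneg_left (h1.trans hV) (by positivity)
  have e : 1 / (2 * τ) * τ ^ 2 = τ / 2 := by field_simp
  linarith

lemma Sf_two (μ : Measure Ω) [IsProbabilityMeasure μ] {N : ℕ} (h : Ω → ℝ) (hh : Measurable h) (H : ℝ)
    (hH : ∀ u, |h u| ≤ H) :
    ∫ p, (Sf μ h p.1 - Sf μ h p.2) ^ 2 ∂((PN μ N).prod (PN μ N)) ≤ 2 * N * ∫ u, h u ^ 2 ∂μ := by
  have h1 := Sf_var (N := N) μ h hh H hH
  have e : ∀ p : (Fin N → Ω) × (Fin N → Ω), (Sf μ h p.1 - Sf μ h p.2) ^ 2 =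
      Sf μ h p.1 ^ 2 + Sf μ h p.2 ^ 2 - 2 * (Sf μ h p.1 * Sf μ h p.2) := by intro p; ring
  simp_rw [e]
  have i1 := (Sf_sq_int (N := N) μ h hh H hH).comp_fst (PN μ N)
  have i2 := (Sf_sq_int (N := N) μ h hh H hH).comp_snd (PN μ N)
  have i3 : Integrable (fun p : (Fin N → Ω) × (Fin N → Ω) => Sf μ h p.1 * Sf μ h p.2)
      ((PN μ N).prod (PN μ N)) := (Sf_int μ h hh H hH).mul_prod (Sf_int μ h hh H hH)
  have j1 := integral_fun_fst (μ := PN μ N) (ν := PN μ N) (fun x => Sf μ h x ^ 2)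
  have j2 := integral_fun_snd (μ := PN μ N) (ν := PN μ N) (fun x => Sf μ h x ^ 2)
  have j3 := integral_prod_mul (μ := PN μ N) (ν := PN μ N) (fun x => Sf μ h x) (fun x => Sf μ h x)
  rw [integral_sub (f := fun p : (Fin N → Ω) × (Fin N → Ω) => Sf μ h p.1 ^ 2 + Sf μ h p.2 ^ 2)
    (i1.add i2) (i3.const_mul 2), integral_add i1 i2, integral_const_mul, j1, j2, j3,
    Sf_mean μ h hh H hH]
  simp only [probReal_univ, one_smul]
  linarith

lemma Sf_mgf (μ : Measure Ω) [IsProbabilityMeasure μ] {N : ℕ} (h : Ω → ℝ) (hh : Measurable h)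
    (hH : ∀ u, |h u| ≤ 1) (l : ℝ) (hl : |l| ≤ 1) :
    ∫ x, Real.exp (l * Sf μ h x) ∂(PN μ N) ≤ Real.exp (l ^ 2 * (N * ∫ u, h u ^ 2 ∂μ)) := by
  set e := ∫ u, h u ∂μ with he
  set s := ∫ u, h u ^ 2 ∂μ with hs
  have hi1 : Integrable h μ := int_of_bdd _ _ hh 1 hH
  have hi2 : Integrable (fun u => h u ^ 2) μ := int_of_bdd _ _ (hh.pow_const 2) 1 fun u => by
    rw [abs_pow]; exact pow_le_one₀ (abs_nonneg _) (hH u)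
  have hlh : ∀ u, |l * h u| ≤ 1 := fun u => by
    rw [abs_mul]; exact mul_le_one₀ hl (abs_nonneg _) (hH u)
  have e1 : ∀ x : Fin N → Ω, Real.exp (l * Sf μ h x) = ∏ i, Real.exp (l * h (x i) - l * e) := by
    intro x
    rw [← Real.exp_sum]
    congr 1
    unfold Sf
    rw [Finset.sum_sub_distrib, ← Finset.mul_sum]
    simp only [Finset.sum_const, Finset.card_univ, Fintype.card_fin, nsmul_eq_mul]
    ring
  simp_rw [e1]
  have := integral_fintype_prod_eq_prod (ι := Fin N) (μ := fun _ => μ) (fun _ u => Real.exp (l * h u - l * e))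
  rw [this]
  simp only [Finset.prod_const, Finset.card_univ, Fintype.card_fin]
  have key : ∫ u, Real.exp (l * h u - l * e) ∂μ ≤ Real.exp (l ^ 2 * s) := by
    simp_rw [sub_eq_add_neg, Real.exp_add]
    rw [integral_mul_const]
    have hb : ∫ u, Real.exp (l * h u) ∂μ ≤ ∫ u, (1 + l * h u + l ^ 2 * h u ^ 2) ∂μ := by
      refine integral_mono ?_ (((integrable_const 1).add (hi1.const_mul l)).add (hi2.const_mul _)) fun u => ?_
      · refine int_of_bdd _ _ (by fun_prop) (Real.exp 1) fun u => ?_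
        rw [abs_of_pos (Real.exp_pos _)]
        exact Real.exp_le_exp.2 ((le_abs_self _).trans (hlh u))
      · have := (abs_le.1 (Real.abs_exp_sub_one_sub_id_le (hlh u))).2
        rw [mul_pow] at this
        simp only; linarith
    have hc : ∫ u, (1 + l * h u + l ^ 2 * h u ^ 2) ∂μ = 1 + l * e + l ^ 2 * s := by
      rw [integral_add (f := fun u => 1 + l * h u) ((integrable_const 1).add (hi1.const_mul l)) (hi2.const_mul _),
        integral_add (integrable_const 1) (hi1.const_mul l), integral_const_mul, integral_const_mul]
      simp [he, hs]
    have hd : 1 + l * e + l ^ 2 * s ≤ Real.exp (l * e + l ^ 2 * s) := by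
      have := Real.add_one_le_exp (l * e + l ^ 2 * s); linarith
    calc _ ≤ Real.exp (l * e + l ^ 2 * s) * Real.exp (-(l * e)) :=
          mul_le_mul_of_nonneg_right (hb.trans (hc.le.trans hd)) (Real.exp_pos _).le
      _ = _ := by rw [← Real.exp_add]; congr 1; ring
  calc _ ≤ Real.exp (l ^ 2 * s) ^ N := pow_le_pow_left₀ (integral_nonneg fun _ => (Real.exp_pos _).le) key N
    _ = _ := by rw [← Real.exp_nat_mul]; congr 1; ring

lemma Sf_mgf_int (μ : Measure Ω) [IsProbabilityMeasure μ] {N : ℕ} (h : Ω → ℝ) (hh : Measurable h)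
    (hH : ∀ u, |h u| ≤ 1) (l c : ℝ) : Integrable (fun x => Real.exp (l * Sf μ h x - c)) (PN μ N) := by
  refine int_of_bdd _ _ (by have := measurable_Sf (N := N) μ h hh; fun_prop)
    (Real.exp (|l| * (N * 1 + |N * ∫ u, h u ∂μ|) - c)) fun x => ?_
  rw [abs_of_pos (Real.exp_pos _)]
  apply Real.exp_le_exp.2
  have h1 := le_abs_self (l * Sf μ h x)
  rw [abs_mul] at h1
  have := mul_le_mul_of_nonneg_left (Sf_bound (N := N) μ h 1 hH x) (abs_nonneg l)
  linarith

/-- The exponential penalty of leaving the good event. -/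
def pen (μ : Measure Ω) {N : ℕ} (h : Ω → ℝ) (l t : ℝ) (x : Fin N → Ω) : ℝ :=
  Real.exp (l * Sf μ h x - l * t) + Real.exp ((-l) * Sf μ h x - l * t)

lemma pen_nonneg (μ : Measure Ω) {N : ℕ} (h : Ω → ℝ) (l t : ℝ) (x : Fin N → Ω) : 0 ≤ pen μ h l t x := by
  unfold pen; positivity

lemma pen_ge (μ : Measure Ω) {N : ℕ} (h : Ω → ℝ) (l t : ℝ) (hl : 0 ≤ l) (x : Fin N → Ω) (hx : t < |Sf μ h x|) :
    1 ≤ pen μ h l t x := by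
  unfold pen
  rcases lt_abs.1 hx with hx | hx
  · have : 1 ≤ Real.exp (l * Sf μ h x - l * t) := Real.one_le_exp (by nlinarith)
    have := Real.exp_pos ((-l) * Sf μ h x - l * t)
    linarith
  · have : 1 ≤ Real.exp ((-l) * Sf μ h x - l * t) := Real.one_le_exp (by nlinarith)
    have := Real.exp_pos (l * Sf μ h x - l * t)
    linarith

lemma pen_int (μ : Measure Ω) [IsProbabilityMeasure μ] {N : ℕ} (h : Ω → ℝ) (hh : Measurable h)
    (hH : ∀ u, |h u| ≤ 1) (l t : ℝ) : Integrable (fun x => pen μ h l t x) (PN μ N) :=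
  (Sf_mgf_int μ h hh hH l (l * t)).add (Sf_mgf_int μ h hh hH (-l) (l * t))

lemma pen_le (μ : Measure Ω) [IsProbabilityMeasure μ] {N : ℕ} (h : Ω → ℝ) (hh : Measurable h)
    (hH : ∀ u, |h u| ≤ 1) (l t V : ℝ) (hl : 0 ≤ l) (hl1 : l ≤ 1) (hV : N * ∫ u, h u ^ 2 ∂μ ≤ V) :
    ∫ x, pen μ h l t x ∂(PN μ N) ≤ 2 * Real.exp (l ^ 2 * V - l * t) := by
  have key : ∀ l' : ℝ, |l'| ≤ 1 → l' ^ 2 = l ^ 2 →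
      ∫ x, Real.exp (l' * Sf μ h x - l * t) ∂(PN μ N) ≤ Real.exp (l ^ 2 * V - l * t) := by
    intro l' h1 h2
    simp_rw [sub_eq_add_neg, Real.exp_add]
    rw [integral_mul_const]
    refine mul_le_mul_of_nonneg_right ((Sf_mgf μ h hh hH l' h1).trans (Real.exp_le_exp.2 ?_)) (Real.exp_pos _).le
    rw [h2]
    exact mul_le_mul_of_nonneg_left hV (sq_nonneg _)
  unfold pen
  rw [integral_add (Sf_mgf_int μ h hh hH l (l * t)) (Sf_mgf_int μ h hh hH (-l) (l * t))]
  have h1 := key l (by rwa [abs_of_nonneg hl]) rfl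
  have h2 := key (-l) (by rwa [abs_neg, abs_of_nonneg hl]) (by ring)
  linarith

end Prob

end Part11

section Part12
/-! ### Cell probabilities -/

def cellOf (L : ℕ) (x : E2) : ℕ × ℕ := (⌊(L : ℝ) * x 0⌋₊, ⌊(L : ℝ) * x 1⌋₊)

def pc (μ : Measure E2) (L : ℕ) (c : ℕ × ℕ) : ℝ := μ.real {x | cellOf L x = c}

lemma measurable_cellOf (L : ℕ) : Measurable (cellOf L) := by
  unfold cellOf
  refine Measurable.prodMk ?_ ?_
  · exact Nat.measurable_floor.comp (by fun_prop)
  · exact Nat.measurable_floor.comp (by fun_prop)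

/-- The properties of the sampling measure that are used. -/
structure Nice (μ : Measure E2) (a b K : ℝ) : Prop where
  ha : 0 < a
  hb : 0 < b
  hK : 0 ≤ K
  ae : ∀ᵐ x ∂μ, ∀ i, x i ∈ Set.Ico (0 : ℝ) 1
  lo : ∀ L : ℕ, 0 < L → ∀ c ∈ sqI L, a / (L : ℝ) ^ 2 ≤ pc μ L c
  hi : ∀ L : ℕ, 0 < L → ∀ c ∈ sqI L, pc μ L c ≤ b / (L : ℝ) ^ 2
  lip : ∀ L : ℕ, 0 < L → ∀ c ∈ sqI L, ∀ c' ∈ sqI L,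
    |pc μ L c - pc μ L c'| ≤ K / (L : ℝ) ^ 3 * (|(c.1 : ℝ) - c'.1| + |(c.2 : ℝ) - c'.2|)
  sub : ∀ G M : ℕ, 0 < G → 0 < M → ∀ c ∈ sqI G, ∀ r ∈ sqI M,
    |pc μ (G * M) (c.1 * M + r.1, c.2 * M + r.2) - pc μ G c / (M : ℝ) ^ 2| ≤ K / ((G : ℝ) ^ 3 * (M : ℝ) ^ 2)

def box (L : ℕ) (c : ℕ × ℕ) : Set E2 :=
  {x | x 0 ∈ Set.Ico ((c.1 : ℝ) / L) ((c.1 + 1) / L) ∧ x 1 ∈ Set.Ico ((c.2 : ℝ) / L) ((c.2 + 1) / L)}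

lemma box_meas (L : ℕ) (c : ℕ × ℕ) : MeasurableSet (box L c) := by
  unfold box
  refine MeasurableSet.inter (s₁ := {x : E2 | x 0 ∈ Set.Ico ((c.1 : ℝ) / L) ((c.1 + 1) / L)})
    (s₂ := {x : E2 | x 1 ∈ Set.Ico ((c.2 : ℝ) / L) ((c.2 + 1) / L)}) ?_ ?_
  · exact (by fun_prop : Measurable fun x : E2 => x 0) measurableSet_Ico
  · exact (by fun_prop : Measurable fun x : E2 => x 1) measurableSet_Ico

lemma box_vol (L : ℕ) (hL : 0 < L) (c : ℕ × ℕ) : volume (box L c) = ENNReal.ofReal (1 / (L : ℝ) ^ 2) := by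
  have hL' : (0 : ℝ) < L := by exact_mod_cast hL
  have h := (PiLp.volume_preserving_ofLp (Fin 2)).measure_preimage
    (s := Set.univ.pi fun i : Fin 2 => Set.Ico ((![(c.1 : ℝ) / L, (c.2 : ℝ) / L]) i)
      ((![((c.1 : ℝ) + 1) / L, ((c.2 : ℝ) + 1) / L]) i))
    (MeasurableSet.univ_pi fun i => measurableSet_Ico).nullMeasurableSet
  rw [Real.volume_pi_Ico] at h
  have e : (WithLp.ofLp ⁻¹' (Set.univ.pi fun i : Fin 2 => Set.Ico ((![(c.1 : ℝ) / L, (c.2 : ℝ) / L]) i)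
      ((![((c.1 : ℝ) + 1) / L, ((c.2 : ℝ) + 1) / L]) i)) : Set E2) = box L c := by
    ext x
    simp [box, Set.mem_pi, Fin.forall_fin_two]
  rw [e] at h
  rw [h, Fin.prod_univ_two, ← ENNReal.ofReal_mul]
  · congr 1
    simp only [Matrix.cons_val_zero, Matrix.cons_val_one]
    field_simp; ring
  · simp only [Matrix.cons_val_zero]
    rw [← sub_div]; ring_nf; positivity

lemma box_sub (L : ℕ) (hL : 0 < L) (c : ℕ × ℕ) (hc : c ∈ sqI L) : box L c ⊆ unitSq := by
  have hL' : (0 : ℝ) < L := by exact_mod_cast hL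
  obtain ⟨h1, h2⟩ := mem_sqI.1 hc
  have h1' : (c.1 : ℝ) + 1 ≤ L := by exact_mod_cast h1
  have h2' : (c.2 : ℝ) + 1 ≤ L := by exact_mod_cast h2
  rintro x ⟨⟨a1, a2⟩, ⟨b1, b2⟩⟩ i
  have q1 : ((c.1 : ℝ) + 1) / L ≤ 1 := by rw [div_le_one hL']; exact h1'
  have q2 : ((c.2 : ℝ) + 1) / L ≤ 1 := by rw [div_le_one hL']; exact h2'
  have q3 : 0 ≤ (c.1 : ℝ) / L := by positivity
  have q4 : 0 ≤ (c.2 : ℝ) / L := by positivity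
  fin_cases i
  · exact ⟨by simp only [Fin.zero_eta]; linarith, by simp only [Fin.zero_eta]; linarith⟩
  · exact ⟨by simp only [Fin.mk_one]; linarith, by simp only [Fin.mk_one]; linarith⟩

lemma cell_eq_box (L : ℕ) (hL : 0 < L) (c : ℕ × ℕ) (hc : c ∈ sqI L) :
    {x | cellOf L x = c} ∩ unitSq = box L c := by
  have hL' : (0 : ℝ) < L := by exact_mod_cast hL
  have key : ∀ x ∈ unitSq, (cellOf L x = c ↔ x ∈ box L c) := by
    intro x hx
    have h0 := (hx 0).1
    have h1 := (hx 1).1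
    unfold cellOf box
    rw [Prod.ext_iff]
    simp only [Set.mem_ofPred_eq, Set.mem_Ico]
    rw [Nat.floor_eq_iff (by positivity), Nat.floor_eq_iff (by positivity), div_le_iff₀ hL', lt_div_iff₀ hL',
      div_le_iff₀ hL', lt_div_iff₀ hL', mul_comm (x 0), mul_comm (x 1)]
  ext x
  constructor
  · rintro ⟨h1, h2⟩; exact (key x h2).1 h1
  · intro h
    have := box_sub L hL c hc h
    exact ⟨(key x this).2 h, this⟩

lemma norm_le_coord (v : E2) : ‖v‖ ≤ |v 0| + |v 1| := by
  rw [EuclideanSpace.norm_eq, Fin.sum_univ_two]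
  simp only [Real.norm_eq_abs]
  rw [Real.sqrt_le_iff]
  constructor
  · positivity
  · nlinarith [abs_nonneg (v 0), abs_nonneg (v 1)]

lemma unitSq_meas : MeasurableSet unitSq := by
  unfold unitSq
  rw [Set.ofPred_forall]
  exact MeasurableSet.iInter fun i => (by fun_prop : Measurable fun x : E2 => x i) measurableSet_Icc

lemma mu_cell (ρ : E2 → ℝ) (μ : Measure E2)
    (hμ : μ = (volume.restrict unitSq).withDensity (fun x => ENNReal.ofReal (ρ x)))
    (L : ℕ) (hL : 0 < L) (c : ℕ × ℕ) (hc : c ∈ sqI L) :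
    μ {x | cellOf L x = c} = ∫⁻ x in box L c, ENNReal.ofReal (ρ x) := by
  have hm : MeasurableSet {x | cellOf L x = c} := measurable_cellOf L (measurableSet_singleton c)
  rw [hμ, withDensity_apply _ hm, Measure.restrict_restrict hm, cell_eq_box L hL c hc]

lemma pc_bounds (ρ : E2 → ℝ) (μ : Measure E2)
    (hμ : μ = (volume.restrict unitSq).withDensity (fun x => ENNReal.ofReal (ρ x)))
    (L : ℕ) (hL : 0 < L) (c : ℕ × ℕ) (hc : c ∈ sqI L) (lo hi : ℝ) (hhi : 0 ≤ hi)
    (h : ∀ x ∈ box L c, lo ≤ ρ x ∧ ρ x ≤ hi) :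
    lo / (L : ℝ) ^ 2 ≤ pc μ L c ∧ pc μ L c ≤ hi / (L : ℝ) ^ 2 := by
  have hL' : (0 : ℝ) < L := by exact_mod_cast hL
  have hup : μ {x | cellOf L x = c} ≤ ENNReal.ofReal (hi / (L : ℝ) ^ 2) := by
    rw [mu_cell ρ μ hμ L hL c hc]
    calc _ ≤ ∫⁻ _ in box L c, ENNReal.ofReal hi :=
          setLIntegral_mono' (box_meas L c) fun x hx => ENNReal.ofReal_le_ofReal (h x hx).2
      _ = _ := by rw [setLIntegral_const, box_vol L hL, ← ENNReal.ofReal_mul hhi]; congr 1; ring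
  have hdn : ENNReal.ofReal (lo / (L : ℝ) ^ 2) ≤ μ {x | cellOf L x = c} := by
    rw [mu_cell ρ μ hμ L hL c hc]
    calc ENNReal.ofReal (lo / (L : ℝ) ^ 2) ≤ ∫⁻ _ in box L c, ENNReal.ofReal lo := by
          rw [setLIntegral_const, box_vol L hL, ← ENNReal.ofReal_mul' (by positivity)]
          apply le_of_eq; congr 1; ring
      _ ≤ _ := setLIntegral_mono' (box_meas L c) fun x hx => ENNReal.ofReal_le_ofReal (h x hx).1
  unfold pc Measure.real
  have hfin : μ {x | cellOf L x = c} ≠ ⊤ := ne_top_of_le_ne_top ENNReal.ofReal_ne_top hup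
  exact ⟨(ENNReal.ofReal_le_iff_le_toReal hfin).1 hdn, ENNReal.toReal_le_of_le_ofReal (by positivity) hup⟩

lemma nice_of (ρ : E2 → ℝ) (a : ℝ) (ha : 0 < a) (hlip : ∃ K : ℝ≥0, LipschitzOnWith K ρ unitSq)
    (hpos : ∀ x ∈ unitSq, a ≤ ρ x) (μ : Measure E2)
    (hμ : μ = (volume.restrict unitSq).withDensity (fun x => ENNReal.ofReal (ρ x))) :
    ∃ b K : ℝ, Nice μ a b K := by
  obtain ⟨K, hK⟩ := hlip
  have hlip : ∀ x ∈ unitSq, ∀ y ∈ unitSq, ∀ D : ℝ, |x 0 - y 0| + |x 1 - y 1| ≤ D →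
      |ρ x - ρ y| ≤ K * D := by
    intro x hx y hy D hD
    have h1 := hK.dist_le_mul x hx y hy
    rw [Real.dist_eq, dist_eq_norm] at h1
    have h2 := norm_le_coord (x - y)
    simp only [PiLp.sub_apply] at h2
    exact h1.trans (mul_le_mul_of_nonneg_left (h2.trans hD) K.2)
  have h0 : (0 : E2) ∈ unitSq := by intro i; simp
  -- approximation of a cell probability by a nearby value of the density
  have appr : ∀ L : ℕ, 0 < L → ∀ c ∈ sqI L, ∀ x ∈ unitSq, ∀ D : ℝ, 0 ≤ D →
      (∀ y ∈ box L c, |y 0 - x 0| + |y 1 - x 1| ≤ D) → |pc μ L c - ρ x / (L : ℝ) ^ 2| ≤ K * D / (L : ℝ) ^ 2 := by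
    intro L hL c hc x hx D hD0 hD
    have hKD : (0 : ℝ) ≤ K * D := mul_nonneg K.2 hD0
    have := pc_bounds ρ μ hμ L hL c hc (ρ x - K * D) (ρ x + K * D) (by have := hpos x hx; linarith) (fun y hy => by
      have := abs_le.1 (hlip y (box_sub L hL c hc hy) x hx D (hD y hy))
      constructor <;> linarith)
    rw [sub_div, add_div] at this
    rw [abs_le]
    constructor <;> linarith [this.1, this.2]
  -- the corner
  have corner : ∀ L : ℕ, 0 < L → ∀ c ∈ sqI L, (!₂[(c.1 : ℝ) / L, (c.2 : ℝ) / L] : E2) ∈ unitSq := by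
    intro L hL c hc
    have hL' : (0 : ℝ) < L := by exact_mod_cast hL
    apply box_sub L hL c hc
    constructor
    · simp only [Matrix.cons_val_zero]
      exact ⟨le_rfl, div_lt_div_of_pos_right (lt_add_one _) hL'⟩
    · simp only [Matrix.cons_val_one]
      exact ⟨le_rfl, div_lt_div_of_pos_right (lt_add_one _) hL'⟩
  have apprc : ∀ L : ℕ, 0 < L → ∀ c ∈ sqI L,
      |pc μ L c - ρ !₂[(c.1 : ℝ) / L, (c.2 : ℝ) / L] / (L : ℝ) ^ 2| ≤ K * (2 / L) / (L : ℝ) ^ 2 := by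
    intro L hL c hc
    refine appr L hL c hc _ (corner L hL c hc) _ (by positivity) ?_
    rintro y ⟨⟨h1, h2⟩, ⟨h3, h4⟩⟩
    simp only [Matrix.cons_val_zero, Matrix.cons_val_one]
    rw [add_div] at h2 h4
    rw [abs_of_nonneg (by linarith), abs_of_nonneg (by linarith)]
    have : (2 : ℝ) / L = 1 / L + 1 / L := by ring
    linarith
  have hK0 : (0 : ℝ) ≤ K := K.2
  have hb0 := hpos 0 h0
  refine ⟨ρ 0 + K * 2, 5 * K, ha, by linarith, by linarith, ?_, ?_, ?_, ?_, ?_⟩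
  · have hq : ∀ i : Fin 2, ∀ᵐ x : E2, x i ≠ 1 := by
      intro i
      exact (PiLp.volume_preserving_ofLp (Fin 2)).quasiMeasurePreserving.ae
        (Measure.ae_eval_ne (fun _ => (volume : Measure ℝ)) i (1 : ℝ))
    have hac : μ ≪ volume.restrict unitSq := by rw [hμ]; exact withDensity_absolutelyContinuous _ _
    apply hac.ae_le
    have h1 : ∀ᵐ x ∂(volume.restrict unitSq), x ∈ unitSq := ae_restrict_mem unitSq_meas
    have h2 : ∀ᵐ x : E2 ∂(volume.restrict unitSq), ∀ i, x i ≠ 1 := ae_restrict_of_ae (ae_all_iff.2 hq)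
    filter_upwards [h1, h2] with x hx1 hx2 i
    exact ⟨(hx1 i).1, lt_of_le_of_ne (hx1 i).2 (hx2 i)⟩
  · intro L hL c hc
    refine (pc_bounds ρ μ hμ L hL c hc a (ρ 0 + K * 2) (by linarith) fun x hx => ?_).1
    have hxu := box_sub L hL c hc hx
    refine ⟨hpos x hxu, ?_⟩
    have := (abs_le.1 (hlip x hxu 0 h0 2 (by
      have h1 := hxu 0
      have h2 := hxu 1
      simp only [PiLp.zero_apply, sub_zero]
      rw [abs_of_nonneg h1.1, abs_of_nonneg h2.1]; linarith [h1.2, h2.2]))).2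
    linarith
  · intro L hL c hc
    refine (pc_bounds ρ μ hμ L hL c hc a (ρ 0 + K * 2) (by linarith) fun x hx => ?_).2
    have hxu := box_sub L hL c hc hx
    refine ⟨hpos x hxu, ?_⟩
    have := (abs_le.1 (hlip x hxu 0 h0 2 (by
      have h1 := hxu 0
      have h2 := hxu 1
      simp only [PiLp.zero_apply, sub_zero]
      rw [abs_of_nonneg h1.1, abs_of_nonneg h2.1]; linarith [h1.2, h2.2]))).2
    linarith
  · intro L hL c hc c' hc'
    have hL' : (0 : ℝ) < L := by exact_mod_cast hL
    by_cases hcc : c = c'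
    · subst hcc; simp
    have hS : 1 ≤ |(c.1 : ℝ) - c'.1| + |(c.2 : ℝ) - c'.2| := by
      have key : ∀ i j : ℕ, i ≠ j → 1 ≤ |(i : ℝ) - j| := by
        intro i j hij
        have h : (1 : ℤ) ≤ |(i : ℤ) - j| := Int.one_le_abs (by omega)
        exact_mod_cast h
      by_cases h : c.1 = c'.1
      · have : c.2 ≠ c'.2 := fun h' => hcc (Prod.ext h h')
        linarith [key _ _ this, abs_nonneg ((c.1 : ℝ) - c'.1)]
      · linarith [key _ _ h, abs_nonneg ((c.2 : ℝ) - c'.2)]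
    have h1 := apprc L hL c hc
    have h2 := apprc L hL c' hc'
    have h3 := hlip _ (corner L hL c hc) _ (corner L hL c' hc') _ le_rfl
    simp only [Matrix.cons_val_zero, Matrix.cons_val_one] at h3
    rw [← sub_div, ← sub_div, abs_div, abs_div, abs_of_pos hL', ← add_div] at h3
    set S := |(c.1 : ℝ) - c'.1| + |(c.2 : ℝ) - c'.2|
    set r1 := ρ !₂[(c.1 : ℝ) / L, (c.2 : ℝ) / L]
    set r2 := ρ !₂[(c'.1 : ℝ) / L, (c'.2 : ℝ) / L]
    have h4 : |r1 / (L : ℝ) ^ 2 - r2 / (L : ℝ) ^ 2| ≤ K * (S / L) / (L : ℝ) ^ 2 := by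
      rw [← sub_div, abs_div, abs_of_pos (by positivity : (0 : ℝ) < (L : ℝ) ^ 2)]
      gcongr
    have e1 : (K : ℝ) * (2 / L) / (L : ℝ) ^ 2 = 2 * (K / (L : ℝ) ^ 3) := by field_simp
    have e2 : (K : ℝ) * (S / L) / (L : ℝ) ^ 2 = K / (L : ℝ) ^ 3 * S := by field_simp
    have e3 : 5 * (K : ℝ) / (L : ℝ) ^ 3 * S = 5 * (K / (L : ℝ) ^ 3 * S) := by ring
    rw [e1] at h1 h2
    rw [e2] at h4
    rw [e3]
    have hk : (0 : ℝ) ≤ K / (L : ℝ) ^ 3 := by positivity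
    have hk2 : K / (L : ℝ) ^ 3 ≤ K / (L : ℝ) ^ 3 * S := le_mul_of_one_le_right hk hS
    rw [abs_le] at *
    constructor <;> linarith
  · intro G M hG hM c hc r hr
    have hG' : (0 : ℝ) < G := by exact_mod_cast hG
    have hM' : (0 : ℝ) < M := by exact_mod_cast hM
    obtain ⟨hc1, hc2⟩ := mem_sqI.1 hc
    obtain ⟨hr1, hr2⟩ := mem_sqI.1 hr
    have hmem : (c.1 * M + r.1, c.2 * M + r.2) ∈ sqI (G * M) := by
      rw [mem_sqI]; constructor
      · simp only; nlinarith
      · simp only; nlinarith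
    have h1 := apprc G hG c hc
    have h2 := appr (G * M) (Nat.mul_pos hG hM) _ hmem _ (corner G hG c hc) (2 / G) (by positivity) (by
      have key : ∀ (y : ℝ) (i s : ℕ), s < M → y ∈ Set.Ico (((i * M + s : ℕ) : ℝ) / (G * M : ℕ))
          ((((i * M + s : ℕ) : ℝ) + 1) / (G * M : ℕ)) → |y - i / G| ≤ 1 / G := by
        rintro y i s hs ⟨h1, h2⟩
        have hs' : (s : ℝ) + 1 ≤ M := by exact_mod_cast hs
        push_cast at h1 h2
        have e1 : ((i : ℝ) * M + s) / (G * M) = i / G + s / (G * M) := by field_simp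
        have e2 : ((i : ℝ) * M + s + 1) / (G * M) = i / G + (s + 1) / (G * M) := by field_simp; ring
        have e3 : ((s : ℝ) + 1) / (G * M) ≤ 1 / G := by
          rw [div_le_div_iff₀ (by positivity) hG']; nlinarith
        have e4 : 0 ≤ (s : ℝ) / (G * M) := by positivity
        rw [abs_of_nonneg (by linarith)]; linarith
      rintro y ⟨g1, g2⟩
      have q1 := key _ _ _ hr1 g1
      have q2 := key _ _ _ hr2 g2
      simp only [Matrix.cons_val_zero, Matrix.cons_val_one]
      have : (2 : ℝ) / G = 1 / G + 1 / G := by ring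
      linarith)
    set r1 := ρ !₂[(c.1 : ℝ) / G, (c.2 : ℝ) / G]
    push_cast at h2
    have h3 : |pc μ G c / (M : ℝ) ^ 2 - r1 / ((G : ℝ) * M) ^ 2| ≤ K * (2 / G) / ((G : ℝ) * M) ^ 2 := by
      have e : pc μ G c / (M : ℝ) ^ 2 - r1 / ((G : ℝ) * M) ^ 2 = (pc μ G c - r1 / (G : ℝ) ^ 2) / (M : ℝ) ^ 2 := by
        field_simp
      rw [e, abs_div, abs_of_pos (by positivity : (0 : ℝ) < (M : ℝ) ^ 2), div_le_iff₀ (by positivity)]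
      refine h1.trans (le_of_eq ?_)
      field_simp
    have e : (K : ℝ) * (2 / G) / ((G : ℝ) * M) ^ 2 = 2 * (K / ((G : ℝ) ^ 3 * (M : ℝ) ^ 2)) := by field_simp
    rw [e] at h2 h3
    have e5 : 5 * (K : ℝ) / ((G : ℝ) ^ 3 * (M : ℝ) ^ 2) = 5 * (K / ((G : ℝ) ^ 3 * (M : ℝ) ^ 2)) := by ring
    rw [e5]
    have hk : (0 : ℝ) ≤ K / ((G : ℝ) ^ 3 * (M : ℝ) ^ 2) := by positivity
    rw [abs_le] at *
    constructor <;> linarith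

end Part12

section Part13
/-! ### Integrability bookkeeping and cell functionals -/

/-- `f` is integrable with integral at most `C`. -/
def IB {α : Type*} [MeasurableSpace α] (P : Measure α) (f : α → ℝ) (C : ℝ) : Prop :=
  Integrable f P ∧ ∫ x, f x ∂P ≤ C

section IBsec
variable {α : Type*} [MeasurableSpace α] {P : Measure α}

lemma IB.add {f g : α → ℝ} {C D : ℝ} (hf : IB P f C) (hg : IB P g D) : IB P (fun x => f x + g x) (C + D) :=
  ⟨hf.1.add hg.1, by rw [integral_add hf.1 hg.1]; exact add_le_add hf.2 hg.2⟩

lemma IB.cmul {f : α → ℝ} {C : ℝ} (hf : IB P f C) (c : ℝ) (hc : 0 ≤ c) : IB P (fun x => c * f x) (c * C) :=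
  ⟨hf.1.const_mul c, by rw [integral_const_mul]; exact mul_le_mul_of_nonneg_left hf.2 hc⟩

lemma IB.const [IsProbabilityMeasure P] (c : ℝ) : IB P (fun _ => c) c :=
  ⟨integrable_const _, by simp⟩

lemma IB.sum {ι : Type*} (s : Finset ι) (f : ι → α → ℝ) (C : ι → ℝ) (h : ∀ i ∈ s, IB P (f i) (C i)) :
    IB P (fun x => ∑ i ∈ s, f i x) (∑ i ∈ s, C i) :=
  ⟨integrable_finsetSum _ fun i hi => (h i hi).1, by
    rw [integral_finsetSum _ fun i hi => (h i hi).1]; exact Finset.sum_le_sum fun i hi => (h i hi).2⟩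

lemma IB.mono {f : α → ℝ} {C D : ℝ} (hf : IB P f C) (h : C ≤ D) : IB P f D := ⟨hf.1, hf.2.trans h⟩

lemma IB.fst {β : Type*} [MeasurableSpace β] {Q : Measure β} [IsProbabilityMeasure P] [IsProbabilityMeasure Q]
    {f : α → ℝ} {C : ℝ} (hf : IB P f C) : IB (P.prod Q) (fun p => f p.1) C :=
  ⟨hf.1.comp_fst Q, by rw [integral_fun_fst]; simpa using hf.2⟩

lemma IB.snd {β : Type*} [MeasurableSpace β] {Q : Measure β} [IsProbabilityMeasure P] [IsProbabilityMeasure Q]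
    {f : α → ℝ} {C : ℝ} (hf : IB P f C) : IB (Q.prod P) (fun p => f p.2) C :=
  ⟨hf.1.comp_snd Q, by rw [integral_fun_snd]; simpa using hf.2⟩

end IBsec

lemma cellOf_mem (L : ℕ) (hL : 0 < L) (x : E2) (hx : ∀ i, x i ∈ Set.Ico (0 : ℝ) 1) : cellOf L x ∈ sqI L := by
  have hL' : (0 : ℝ) < L := by exact_mod_cast hL
  have key : ∀ i, ⌊(L : ℝ) * x i⌋₊ < L := by
    intro i
    rw [Nat.floor_lt (mul_nonneg hL'.le (hx i).1)]
    nlinarith [(hx i).2]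
  exact mem_sqI.2 ⟨key 0, key 1⟩

lemma blk_cellOf (G M : ℕ) (hM : 0 < M) (x : E2) : blk M (cellOf (G * M) x) = cellOf G x := by
  have hM' : (M : ℝ) ≠ 0 := by exact_mod_cast hM.ne'
  unfold blk cellOf
  simp only
  rw [← Nat.floor_div_natCast, ← Nat.floor_div_natCast]
  push_cast
  congr 2 <;> field_simp

lemma integral_cell (μ : Measure E2) [IsProbabilityMeasure μ]
    (hae : ∀ᵐ x ∂μ, ∀ i, x i ∈ Set.Ico (0 : ℝ) 1) (L : ℕ) (hL : 0 < L) (g : ℕ × ℕ → ℝ) :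
    ∫ x, g (cellOf L x) ∂μ = ∑ c ∈ sqI L, g c * pc μ L c := by
  have hm : ∀ c, MeasurableSet {x | cellOf L x = c} := fun c => measurable_cellOf L (measurableSet_singleton c)
  have h1 : ∀ᵐ x ∂μ, g (cellOf L x) = ∑ c ∈ sqI L, Set.indicator {x | cellOf L x = c} (fun _ => g c) x := by
    filter_upwards [hae] with x hx
    have := cellOf_mem L hL x hx
    simp only [Set.indicator_apply, Set.mem_ofPred_eq]
    rw [Finset.sum_ite_eq, if_pos this]
  rw [integral_congr_ae h1, integral_finsetSum _ fun c _ => (integrable_const _).indicator (hm c)]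
  refine Finset.sum_congr rfl fun c _ => ?_
  rw [integral_indicator_const _ (hm c), smul_eq_mul, mul_comm]; rfl

lemma integral_cell_sq (μ : Measure E2) [IsProbabilityMeasure μ] {a b K : ℝ} (hn : Nice μ a b K)
    (L : ℕ) (hL : 0 < L) (g : ℕ × ℕ → ℝ) (W : ℝ) (hW : ∀ c ∈ sqI L, g c ≠ 0 → pc μ L c ≤ W)
    (hg : ∑ c ∈ sqI L, g c ^ 2 ≤ 1) (hW0 : 0 ≤ W) :
    ∫ x, g (cellOf L x) ^ 2 ∂μ ≤ W := by
  rw [integral_cell μ hn.ae L hL (fun c => g c ^ 2)]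
  calc _ ≤ ∑ c ∈ sqI L, g c ^ 2 * W := Finset.sum_le_sum fun c hc => by
        by_cases h : g c = 0
        · simp [h]
        · exact mul_le_mul_of_nonneg_left (hW c hc h) (sq_nonneg _)
    _ = (∑ c ∈ sqI L, g c ^ 2) * W := by rw [Finset.sum_mul]
    _ ≤ 1 * W := mul_le_mul_of_nonneg_right hg hW0
    _ = W := one_mul W

lemma Sf_cell (μ : Measure E2) [IsProbabilityMeasure μ]
    (hae : ∀ᵐ x ∂μ, ∀ i, x i ∈ Set.Ico (0 : ℝ) 1) (L : ℕ) (hL : 0 < L) (g : ℕ × ℕ → ℝ) {N : ℕ}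
    (x : Fin N → E2) (hx : ∀ j i, x j i ∈ Set.Ico (0 : ℝ) 1) :
    Sf μ (fun u => g (cellOf L u)) x =
      ∑ c ∈ sqI L, g c * (cnt (fun i => cellOf L (x i)) c - N * pc μ L c) := by
  unfold Sf
  rw [integral_cell μ hae L hL g, ← sum_cnt L (fun i => cellOf L (x i)) (fun i => cellOf_mem L hL _ (hx i)) g,
    Finset.mul_sum, ← Finset.sum_sub_distrib]
  exact Finset.sum_congr rfl fun c _ => by ring

lemma Sf_cell_sub (μ : Measure E2) [IsProbabilityMeasure μ]
    (hae : ∀ᵐ x ∂μ, ∀ i, x i ∈ Set.Ico (0 : ℝ) 1) (L : ℕ) (hL : 0 < L) (g : ℕ × ℕ → ℝ) {N : ℕ}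
    (x y : Fin N → E2) (hx : ∀ j i, x j i ∈ Set.Ico (0 : ℝ) 1) (hy : ∀ j i, y j i ∈ Set.Ico (0 : ℝ) 1) :
    ∑ c ∈ sqI L, g c * (cnt (fun i => cellOf L (x i)) c - cnt (fun i => cellOf L (y i)) c) =
    Sf μ (fun u => g (cellOf L u)) x - Sf μ (fun u => g (cellOf L u)) y := by
  rw [Sf_cell μ hae L hL g x hx, Sf_cell μ hae L hL g y hy, ← Finset.sum_sub_distrib]
  exact Finset.sum_congr rfl fun c _ => by ring

/-- Block functions. -/
def gB (m : ℕ) (b : ℕ × ℕ) (φ : ℕ × ℕ → ℝ) (d : ℕ × ℕ) : ℝ := if blk m d = b then φ (loc m d) else 0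

lemma gB_sum (B m : ℕ) (b : ℕ × ℕ) (hb : b ∈ sqI B) (φ z : ℕ × ℕ → ℝ) :
    ∑ d ∈ sqI (B * m), gB m b φ d * z d = ∑ c ∈ sqI m, φ c * zS m z b c := by
  have := sum_blk B m b hb (fun d => φ (loc m d) * z d)
  simp only [gB, ite_mul, zero_mul]
  refine this.trans (Finset.sum_congr rfl fun c hc => ?_)
  rw [loc_mk m b c hc]; rfl

lemma gB_sq (B m : ℕ) (b : ℕ × ℕ) (hb : b ∈ sqI B) (φ : ℕ × ℕ → ℝ) :
    ∑ d ∈ sqI (B * m), gB m b φ d ^ 2 = ∑ c ∈ sqI m, φ c ^ 2 := by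
  have := sum_blk B m b hb (fun d => φ (loc m d) ^ 2)
  have e : ∀ d, gB m b φ d ^ 2 = if blk m d = b then φ (loc m d) ^ 2 else 0 := by
    intro d; unfold gB; split_ifs <;> simp
  simp_rw [e]
  refine this.trans (Finset.sum_congr rfl fun c hc => ?_)
  rw [loc_mk m b c hc]

lemma gB_bdd (m : ℕ) (hm : 0 < m) (b : ℕ × ℕ) (φ : ℕ × ℕ → ℝ) (d : ℕ × ℕ) :
    |gB m b φ d| ≤ ∑ c ∈ sqI m, |φ c| := by
  have h0 : 0 ≤ ∑ c ∈ sqI m, |φ c| := Finset.sum_nonneg fun _ _ => abs_nonneg _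
  unfold gB
  split_ifs
  · exact Finset.single_le_sum (f := fun c => |φ c|) (fun _ _ => abs_nonneg _) (loc_mem m hm d)
  · simpa using h0

lemma tst_bdd (m : ℕ) (hm : 0 < m) (j : Fin 3) (c d : ℕ × ℕ) : |tst m j c d| ≤ 1 := by
  have hm1 : (1 : ℝ) ≤ (m : ℝ) ^ 2 := one_le_pow₀ (by exact_mod_cast hm)
  unfold tst
  split_ifs
  · simp
  · simp
  · exact HF_abs_le m _ _ (loc_mem m hm c) (loc_mem m hm d)
  · simp
  · rw [abs_of_nonneg (by positivity)]; exact (div_le_one (by positivity)).2 hm1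
  · simp

lemma tst_sq (B m : ℕ) (hm : 0 < m) (j : Fin 3) (c : ℕ × ℕ) (hc : c ∈ sqI (B * m)) :
    ∑ d ∈ sqI (B * m), tst m j c d ^ 2 ≤ 1 := by
  have hm1 : (1 : ℝ) ≤ (m : ℝ) ^ 2 := one_le_pow₀ (by exact_mod_cast hm)
  simp_rw [pow_two (tst m j c _)]
  fin_cases j
  · refine (tst0_sum B m c hc (tst m 0 c)).le.trans ?_
    simp [tst]
  · refine (tst1_sum B m c hc (tst m 1 c)).le.trans (le_trans (le_of_eq ?_)
      (HF_sq_sum m (loc m c) (loc_mem m hm c)))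
    refine Finset.sum_congr rfl fun d hd => ?_
    unfold zS tst
    rw [blk_mk m _ d hd, loc_mk m _ d hd]
    simp [pow_two]
  · refine (tst2_sum B m c hc (tst m 2 c)).le.trans ?_
    unfold vF ZS
    have : ∀ d ∈ sqI m, zS m (tst m 2 c) (blk m c) d = 1 / (m : ℝ) ^ 2 := by
      intro d hd
      unfold zS tst
      rw [blk_mk m _ d hd]
      simp
    rw [Finset.sum_congr rfl this, Finset.sum_const, nsmul_eq_mul]
    have hcard : ((sqI m).card : ℝ) = m ^ 2 := by unfold sqI; rw [Finset.card_product]; simp; ring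
    rw [hcard, mul_one_div_cancel (by positivity)]
    exact (div_le_one (by positivity)).2 hm1

lemma card_sqI (m : ℕ) : ((sqI m).card : ℝ) = (m : ℝ) ^ 2 := by
  unfold sqI; rw [Finset.card_product]; simp; ring

/-! ### Expectations of the pieces -/

section Exps
variable {μ : Measure E2} [IsProbabilityMeasure μ] {a b K : ℝ}

abbrev P2 (μ : Measure E2) (N : ℕ) : Measure ((Fin N → E2) × (Fin N → E2)) := (PN μ N).prod (PN μ N)

/-- Two-sample block functional. -/
def DB (μ : Measure E2) {N : ℕ} (B m : ℕ) (β : ℕ × ℕ) (φ : ℕ × ℕ → ℝ) (p : (Fin N → E2) × (Fin N → E2)) : ℝ :=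
  Sf μ (fun u => gB m β φ (cellOf (B * m) u)) p.1 - Sf μ (fun u => gB m β φ (cellOf (B * m) u)) p.2

lemma DB_IB (hn : Nice μ a b K) (N B m : ℕ) (hB : 0 < B) (hm : 0 < m) (β : ℕ × ℕ) (hβ : β ∈ sqI B)
    (φ : ℕ × ℕ → ℝ) (S W : ℝ) (hφ : ∑ c ∈ sqI m, φ c ^ 2 ≤ S) (hS : 0 < S) (hW0 : 0 ≤ W)
    (hW : ∀ d ∈ sqI (B * m), blk m d = β → pc μ (B * m) d ≤ W) :
    IB (P2 μ N) (fun p => DB μ B m β φ p ^ 2) (2 * N * (S * W)) := by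
  have hms : Measurable (fun u => gB m β φ (cellOf (B * m) u)) :=
    (measurable_of_countable (fun d => gB m β φ d)).comp (measurable_cellOf (B * m))
  have hbd : ∀ u, |gB m β φ (cellOf (B * m) u)| ≤ ∑ c ∈ sqI m, |φ c| := fun u => gB_bdd m hm β φ _
  have hI : ∫ u, gB m β φ (cellOf (B * m) u) ^ 2 ∂μ ≤ S * W := by
    have hpos : 0 < Real.sqrt S := Real.sqrt_pos.2 hS
    have h := integral_cell_sq μ hn (B * m) (Nat.mul_pos hB hm) (fun d => gB m β φ d / Real.sqrt S) W
      (fun d hd hne => hW d hd (by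
        by_contra hbk
        apply hne
        unfold gB
        rw [if_neg hbk, zero_div])) (by
        simp_rw [div_pow, ← Finset.sum_div]
        rw [Real.sq_sqrt hS.le, gB_sq B m β hβ, div_le_one hS]
        exact hφ) hW0
    simp_rw [div_pow, Real.sq_sqrt hS.le] at h
    rw [integral_div, div_le_iff₀ hS] at h
    linarith
  refine ⟨?_, (Sf_two μ _ hms _ hbd).trans (mul_le_mul_of_nonneg_left hI (by positivity))⟩
  have h1 := measurable_Sf (N := N) μ _ hms
  refine int_of_bdd _ _ ?_ ((2 * (N * (∑ c ∈ sqI m, |φ c|) + |N * ∫ u, gB m β φ (cellOf (B * m) u) ∂μ|)) ^ 2) fun p => ?_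
  · unfold DB
    exact ((h1.comp measurable_fst).sub (h1.comp measurable_snd)).pow_const 2
  · rw [abs_pow]
    refine pow_le_pow_left₀ (abs_nonneg _) ?_ 2
    unfold DB
    refine (abs_sub _ _).trans ?_
    have q1 := Sf_bound μ _ _ hbd p.1
    have q2 := Sf_bound μ _ _ hbd p.2
    linarith

lemma abs_IB (hn : Nice μ a b K) (N L : ℕ) (hN : 0 < N) (hL : 0 < L) (s : ℕ × ℕ) (hs : s ∈ sqI L) :
    IB (PN μ N) (fun x => |Sf μ (fun u => if cellOf L u = s then (1 : ℝ) else 0) x|) (Real.sqrt (N * b) / L) := by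
  have hL' : (0 : ℝ) < L := by exact_mod_cast hL
  have hN' : (0 : ℝ) < N := by exact_mod_cast hN
  have hb := hn.hb
  have hms : Measurable (fun u => if cellOf L u = s then (1 : ℝ) else 0) :=
    (measurable_of_countable (fun d => if d = s then (1 : ℝ) else 0)).comp (measurable_cellOf L)
  have hbd : ∀ u, |if cellOf L u = s then (1 : ℝ) else 0| ≤ 1 := fun u => by split_ifs <;> simp
  have hI := integral_cell_sq μ hn L hL (fun d => if d = s then (1 : ℝ) else 0) (b / (L : ℝ) ^ 2)
    (fun d hd _ => hn.hi L hL d hd) (by simp [hs]) (by positivity)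
  refine ⟨(Sf_int μ _ hms 1 hbd).abs, Sf_abs μ _ hms 1 hbd _ (by positivity) ?_⟩
  rw [div_pow, Real.sq_sqrt (by positivity), mul_div_assoc]
  exact mul_le_mul_of_nonneg_left hI hN'.le

lemma pen_IB (hn : Nice μ a b K) (N B m : ℕ) (hB : 0 < B) (hm : 0 < m) (j : Fin 3) (c : ℕ × ℕ)
    (hc : c ∈ sqI (B * m)) (l t : ℝ) (hl : 0 ≤ l) (hl1 : l ≤ 1) :
    IB (PN μ N) (fun x => pen μ (fun u => tst m j c (cellOf (B * m) u)) l t x)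
      (2 * Real.exp (l ^ 2 * (N * (b / ((B * m : ℕ) : ℝ) ^ 2)) - l * t)) := by
  have hms : Measurable (fun u => tst m j c (cellOf (B * m) u)) :=
    (measurable_of_countable (fun d => tst m j c d)).comp (measurable_cellOf _)
  have hbd : ∀ u, |tst m j c (cellOf (B * m) u)| ≤ 1 := fun u => tst_bdd m hm j c _
  have hb := hn.hb
  have hI := integral_cell_sq μ hn (B * m) (Nat.mul_pos hB hm) (tst m j c) (b / ((B * m : ℕ) : ℝ) ^ 2)
    (fun d hd _ => hn.hi _ (Nat.mul_pos hB hm) d hd) (tst_sq B m hm j c hc) (by positivity)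
  exact ⟨pen_int μ _ hms hbd l t, pen_le μ _ hms hbd l t _ hl hl1 (mul_le_mul_of_nonneg_left hI (by positivity))⟩

end Exps

end Part13

section Part14
/-! ### Expected cost bound -/

lemma normsq_eq (x y : E2) (G : ℝ) :
    d2 (G * x 0, G * x 1) (G * y 0, G * y 1) = G ^ 2 * ‖x - y‖ ^ 2 := by
  rw [EuclideanSpace.norm_eq, Real.sq_sqrt (by positivity), Fin.sum_univ_two]
  simp only [Real.norm_eq_abs, sq_abs, PiLp.sub_apply]
  unfold d2
  ring

lemma matchCost_scale {N : ℕ} (x y : Fin N → E2) (G : ℝ) :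
    (⨅ π : Equiv.Perm (Fin N), ∑ i, d2 (G * x i 0, G * x i 1) (G * y (π i) 0, G * y (π i) 1)) =
      G ^ 2 * matchCost x y := by
  unfold matchCost
  rw [Real.mul_iInf_of_nonneg (sq_nonneg G)]
  congr 1
  ext π
  rw [Finset.mul_sum]
  exact Finset.sum_congr rfl fun i _ => normsq_eq _ _ _

lemma matchCost_nonneg {N : ℕ} (x y : Fin N → E2) : 0 ≤ matchCost x y :=
  Real.iInf_nonneg fun _ => Finset.sum_nonneg fun _ _ => sq_nonneg _

lemma matchCost_le {N : ℕ} (x y : Fin N → E2) (hx : ∀ j i, x j i ∈ Set.Ico (0 : ℝ) 1)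
    (hy : ∀ j i, y j i ∈ Set.Ico (0 : ℝ) 1) : matchCost x y ≤ 2 * N := by
  unfold matchCost
  refine (ciInf_le ⟨0, ?_⟩ (1 : Equiv.Perm (Fin N))).trans ?_
  · rintro _ ⟨π, rfl⟩; exact Finset.sum_nonneg fun _ _ => sq_nonneg _
  · calc _ ≤ ∑ i : Fin N, (2 : ℝ) := Finset.sum_le_sum fun i _ => by
          have h := normsq_eq (x i) (y i) 1
          simp only [one_mul, one_pow] at h
          simp only [Equiv.Perm.coe_one, id_eq]
          rw [← h]
          unfold d2
          simp only
          obtain ⟨a1, a2⟩ := hx i 0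
          obtain ⟨b1, b2⟩ := hy i 0
          obtain ⟨c1, c2⟩ := hx i 1
          obtain ⟨d1, d2⟩ := hy i 1
          nlinarith
      _ = 2 * N := by simp; ring

section Maj
variable (μ : Measure E2) {N : ℕ}

def majEn (B m : ℕ) (wm : ℕ × ℕ → ℝ) (p : (Fin N → E2) × (Fin N → E2)) : ℝ :=
  ∑ β ∈ sqI B, (1 / wm β) * ∑ k ∈ sqI m, (1 / LamF m k) * DB μ B m β (psiF m k) p ^ 2

def majY (B m : ℕ) (p : (Fin N → E2) × (Fin N → E2)) : ℝ :=
  ∑ β ∈ sqI B, DB μ B m β (fun _ => 1) p ^ 2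

def majR (G M : ℕ) (e : ℝ) (x : Fin N → E2) : ℝ :=
  ∑ c ∈ sqI G, ∑ r ∈ sqI M,
    (|Sf μ (fun u => if cellOf (G * M) u = (c.1 * M + r.1, c.2 * M + r.2) then (1 : ℝ) else 0) x| +
      1 / (M : ℝ) ^ 2 * |Sf μ (fun u => if cellOf G u = c then (1 : ℝ) else 0) x| + e)

def majP (B m : ℕ) (l t : ℝ) (x : Fin N → E2) : ℝ :=
  ∑ j : Fin 3, ∑ c ∈ sqI (B * m), pen μ (fun u => tst m j c (cellOf (B * m) u)) l t x

end Maj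

section
variable {μ : Measure E2} [IsProbabilityMeasure μ] {a b K : ℝ}

lemma EnB_eq (hn : Nice μ a b K) {N : ℕ} (B m : ℕ) (hB : 0 < B) (hm : 0 < m) (wm : ℕ × ℕ → ℝ)
    (p : (Fin N → E2) × (Fin N → E2))
    (hx : ∀ j i, p.1 j i ∈ Set.Ico (0 : ℝ) 1) (hy : ∀ j i, p.2 j i ∈ Set.Ico (0 : ℝ) 1) :
    EnB B m wm (fun q => cnt (fun i => cellOf (B * m) (p.1 i)) q - cnt (fun i => cellOf (B * m) (p.2 i)) q) =
      majEn μ B m wm p := by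
  unfold EnB majEn
  refine Finset.sum_congr rfl fun β hβ => ?_
  congr 1
  refine Finset.sum_congr rfl fun k _ => ?_
  unfold DB
  rw [← Sf_cell_sub μ hn.ae (B * m) (Nat.mul_pos hB hm) (gB m β (psiF m k)) p.1 p.2 hx hy]
  rw [gB_sum B m β hβ (psiF m k)
    (fun q => cnt (fun i => cellOf (B * m) (p.1 i)) q - cnt (fun i => cellOf (B * m) (p.2 i)) q)]
  unfold hatF
  ring

lemma YB_eq (hn : Nice μ a b K) {N : ℕ} (B m : ℕ) (hB : 0 < B) (hm : 0 < m)
    (p : (Fin N → E2) × (Fin N → E2))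
    (hx : ∀ j i, p.1 j i ∈ Set.Ico (0 : ℝ) 1) (hy : ∀ j i, p.2 j i ∈ Set.Ico (0 : ℝ) 1) :
    YB B m (fun q => cnt (fun i => cellOf (B * m) (p.1 i)) q - cnt (fun i => cellOf (B * m) (p.2 i)) q) =
      majY μ B m p := by
  unfold YB majY
  refine Finset.sum_congr rfl fun β hβ => ?_
  unfold DB
  rw [← Sf_cell_sub μ hn.ae (B * m) (Nat.mul_pos hB hm) (gB m β (fun _ => 1)) p.1 p.2 hx hy]
  rw [gB_sum B m β hβ (fun _ => 1)
    (fun q => cnt (fun i => cellOf (B * m) (p.1 i)) q - cnt (fun i => cellOf (B * m) (p.2 i)) q)]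
  unfold ZS
  simp

lemma Sf_ind (hn : Nice μ a b K) {N : ℕ} (L : ℕ) (hL : 0 < L) (s : ℕ × ℕ) (hs : s ∈ sqI L) (x : Fin N → E2)
    (hx : ∀ j i, x j i ∈ Set.Ico (0 : ℝ) 1) :
    Sf μ (fun u => if cellOf L u = s then (1 : ℝ) else 0) x =
      cnt (fun i => cellOf L (x i)) s - N * pc μ L s := by
  rw [Sf_cell μ hn.ae L hL (fun d => if d = s then (1 : ℝ) else 0) x hx]
  simp [hs]

lemma subcell_mem (G M : ℕ) (c r : ℕ × ℕ) (hc : c ∈ sqI G) (hr : r ∈ sqI M) :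
    (c.1 * M + r.1, c.2 * M + r.2) ∈ sqI (G * M) := by
  obtain ⟨hc1, hc2⟩ := mem_sqI.1 hc
  obtain ⟨hr1, hr2⟩ := mem_sqI.1 hr
  rw [mem_sqI]; constructor
  · simp only; nlinarith
  · simp only; nlinarith

lemma RF_le (hn : Nice μ a b K) {N : ℕ} (G M : ℕ) (hG : 0 < G) (hM : 0 < M) (x : Fin N → E2)
    (hx : ∀ j i, x j i ∈ Set.Ico (0 : ℝ) 1) :
    RF G M (fun i => cellOf (G * M) (x i)) ≤ majR μ G M (N * (K / ((G : ℝ) ^ 3 * (M : ℝ) ^ 2))) x := by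
  have hM' : (0 : ℝ) < M := by exact_mod_cast hM
  unfold RF majR
  refine Finset.sum_le_sum fun c hc => Finset.sum_le_sum fun r hr => ?_
  simp_rw [blk_cellOf G M hM]
  rw [Sf_ind hn (G * M) (Nat.mul_pos hG hM) _ (subcell_mem G M c r hc hr) x hx, Sf_ind hn G hG c hc x hx]
  have h := hn.sub G M hG hM c hc r hr
  set A := cnt (fun i => cellOf (G * M) (x i)) (c.1 * M + r.1, c.2 * M + r.2)
  set C := cnt (fun i => cellOf G (x i)) c
  set P := pc μ (G * M) (c.1 * M + r.1, c.2 * M + r.2)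
  set Q := pc μ G c
  have e : A - C / (M : ℝ) ^ 2 = (A - N * P) - 1 / (M : ℝ) ^ 2 * (C - N * Q) + N * (P - Q / (M : ℝ) ^ 2) := by
    field_simp; ring
  rw [e]
  refine (abs_add_le _ _).trans (add_le_add ((abs_sub _ _).trans (add_le_add le_rfl ?_)) ?_)
  · rw [abs_mul, abs_of_nonneg (by positivity)]
  · rw [abs_mul, abs_of_nonneg (by positivity)]
    exact mul_le_mul_of_nonneg_left h (by positivity)

lemma majR_IB (hn : Nice μ a b K) (N G M : ℕ) (hN : 0 < N) (hG : 0 < G) (hM : 0 < M) (e : ℝ) :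
    IB (PN μ N) (fun x => majR μ G M e x)
      ((G : ℝ) ^ 2 * ((M : ℝ) ^ 2 * (Real.sqrt (N * b) / (G * M : ℕ) + 1 / (M : ℝ) ^ 2 * (Real.sqrt (N * b) / G) + e))) := by
  unfold majR
  refine (IB.sum (sqI G) _ (fun _ => (M : ℝ) ^ 2 * (Real.sqrt (N * b) / (G * M : ℕ) +
    1 / (M : ℝ) ^ 2 * (Real.sqrt (N * b) / G) + e)) fun c hc => ?_).mono (by
      rw [Finset.sum_const, nsmul_eq_mul, card_sqI])
  refine (IB.sum (sqI M) _ (fun _ => (Real.sqrt (N * b) / (G * M : ℕ) +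
    1 / (M : ℝ) ^ 2 * (Real.sqrt (N * b) / G) + e)) fun r hr => ?_).mono (by
      rw [Finset.sum_const, nsmul_eq_mul, card_sqI])
  exact ((abs_IB hn N (G * M) hN (Nat.mul_pos hG hM) _ (subcell_mem G M c r hc hr)).add
    ((abs_IB hn N G hN hG c hc).cmul _ (by positivity))).add (IB.const e)

lemma majP_IB (hn : Nice μ a b K) (N B m : ℕ) (hB : 0 < B) (hm : 0 < m) (l t : ℝ) (hl : 0 ≤ l) (hl1 : l ≤ 1) :
    IB (PN μ N) (fun x => majP μ B m l t x)
      (3 * (((B * m : ℕ) : ℝ) ^ 2 * (2 * Real.exp (l ^ 2 * (N * (b / ((B * m : ℕ) : ℝ) ^ 2)) - l * t)))) := by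
  unfold majP
  refine (IB.sum Finset.univ _ (fun _ => (((B * m : ℕ) : ℝ) ^ 2 *
    (2 * Real.exp (l ^ 2 * (N * (b / ((B * m : ℕ) : ℝ) ^ 2)) - l * t)))) fun j _ => ?_).mono (by
      rw [Finset.sum_const, nsmul_eq_mul]; simp)
  refine (IB.sum (sqI (B * m)) _ (fun _ =>
    (2 * Real.exp (l ^ 2 * (N * (b / ((B * m : ℕ) : ℝ) ^ 2)) - l * t))) fun c hc => ?_).mono (by
      rw [Finset.sum_const, nsmul_eq_mul, card_sqI])
  exact pen_IB hn N B m hB hm j c hc l t hl hl1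

lemma majY_IB (hn : Nice μ a b K) (N B m : ℕ) (hB : 0 < B) (hm : 0 < m) :
    IB (P2 μ N) (fun p => majY μ B m p) (2 * N * b) := by
  have hB' : (0 : ℝ) < B := by exact_mod_cast hB
  have hm' : (0 : ℝ) < m := by exact_mod_cast hm
  have hb := hn.hb
  unfold majY
  refine (IB.sum (sqI B) _ (fun _ => 2 * N * ((m : ℝ) ^ 2 * (b / ((B * m : ℕ) : ℝ) ^ 2))) fun β hβ => ?_).mono ?_
  · refine DB_IB hn N B m hB hm β hβ _ _ _ ?_ (by positivity) (by positivity)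
      fun d hd _ => hn.hi _ (Nat.mul_pos hB hm) d hd
    simp [card_sqI]
  · rw [Finset.sum_const, nsmul_eq_mul, card_sqI]
    push_cast
    apply le_of_eq; field_simp

lemma LamF_nonneg (m : ℕ) (k : ℕ × ℕ) (hk : k ∈ sqI m) : 0 ≤ LamF m k := by
  by_cases h0 : k = (0, 0)
  · rw [h0, LamF_zero]
  · exact (LamF_pos m k hk h0).le

lemma majEn_IB (hn : Nice μ a b K) (N B m : ℕ) (hB : 0 < B) (hm : 0 < m) (wm W : ℕ × ℕ → ℝ) (r : ℝ)
    (hwm : ∀ β ∈ sqI B, 0 < wm β) (hW0 : ∀ β ∈ sqI B, 0 ≤ W β)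
    (hW : ∀ d ∈ sqI (B * m), pc μ (B * m) d ≤ W (blk m d))
    (hr : ∀ β ∈ sqI B, N * W β ≤ r * wm β) :
    IB (P2 μ N) (fun p => majEn μ B m wm p) ((B : ℝ) ^ 2 * (2 * r * ∑ k ∈ sqI m, 1 / LamF m k)) := by
  unfold majEn
  refine (IB.sum (sqI B) _ (fun _ => 2 * r * ∑ k ∈ sqI m, 1 / LamF m k) fun β hβ => ?_).mono (by
      rw [Finset.sum_const, nsmul_eq_mul, card_sqI])
  have hw := hwm β hβ
  refine ((IB.sum (sqI m) _ (fun k => 1 / LamF m k * (2 * N * (1 * W β))) fun k hk => ?_).cmul (1 / wm β)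
    (by positivity)).mono ?_
  · refine (DB_IB hn N B m hB hm β hβ (psiF m k) 1 (W β) ?_ one_pos (hW0 β hβ) ?_).cmul _
      (by have := LamF_nonneg m k hk; positivity)
    · have := psiF_orth m k k hk hk
      rw [if_pos rfl] at this
      simp_rw [pow_two]; exact this.le
    · intro d hd hbd; rw [← hbd]; exact hW d hd
  · rw [← Finset.sum_mul]
    have hS : 0 ≤ ∑ k ∈ sqI m, 1 / LamF m k := Finset.sum_nonneg fun k hk => by
      have := LamF_nonneg m k hk; positivity
    have h2 : 1 / wm β * (N * W β) ≤ r := by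
      rw [one_div, inv_mul_le_iff₀ hw]; linarith [hr β hβ]
    calc _ = (1 / wm β * (N * W β)) * (2 * ∑ k ∈ sqI m, 1 / LamF m k) := by ring
      _ ≤ r * (2 * ∑ k ∈ sqI m, 1 / LamF m k) := mul_le_mul_of_nonneg_right h2 (by positivity)
      _ = _ := by ring

end

end Part14

section Part15
section
variable (μ : Measure E2) {N : ℕ}

/-- The combination rule appearing in the good-event bound. -/
def comb (B M : ℕ) (ε w0 n En Y R1 R2 : ℝ) : ℝ :=
  (1 + ε) * ((1 + ε) / (1 - 2 * ε) ^ 2 * ((1 + ε) * En + (1 + 1 / ε) * (8 * (B : ℝ) ^ 4 / w0 * Y))) +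
    2 * (1 + 1 / ε) * ((2 * n / (M : ℝ) ^ 2 + 2 * R1) + (2 * n / (M : ℝ) ^ 2 + 2 * R2))

def majT (B m M : ℕ) (ε w0 : ℝ) (wm : ℕ × ℕ → ℝ) (e l t : ℝ) (p : (Fin N → E2) × (Fin N → E2)) : ℝ :=
  1 / ((B * m : ℕ) : ℝ) ^ 2 * comb B M ε w0 N (majEn μ B m wm p) (majY μ B m p)
    (majR μ (B * m) M e p.1) (majR μ (B * m) M e p.2) +
  2 * N * (majP μ B m l t p.1 + majP μ B m l t p.2)
end

section
variable {μ : Measure E2} [IsProbabilityMeasure μ] {a b K : ℝ}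

lemma cell_Ico (G M : ℕ) (hM : 0 < M) (u : ℝ) (hu : 0 ≤ u) :
    (G : ℝ) * u ∈ Set.Ico ((⌊((G * M : ℕ) : ℝ) * u⌋₊ : ℝ) / M) (((⌊((G * M : ℕ) : ℝ) * u⌋₊ : ℝ) + 1) / M) := by
  have hM' : (0 : ℝ) < M := by exact_mod_cast hM
  have h1 := Nat.floor_le (a := ((G * M : ℕ) : ℝ) * u) (by positivity)
  have h2 := Nat.lt_floor_add_one (((G * M : ℕ) : ℝ) * u)
  have h3 : ((G * M : ℕ) : ℝ) * u = G * u * M := by push_cast; ring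
  constructor
  · rw [div_le_iff₀ hM']; linarith
  · rw [lt_div_iff₀ hM']; linarith

lemma majP_nonneg (B m : ℕ) (l t : ℝ) {N : ℕ} (x : Fin N → E2) : 0 ≤ majP μ B m l t x :=
  Finset.sum_nonneg fun _ _ => Finset.sum_nonneg fun _ _ => pen_nonneg _ _ _ _ _

lemma majP_ge (B m : ℕ) (l t : ℝ) (hl : 0 ≤ l) {N : ℕ} (x : Fin N → E2) (j : Fin 3) (c : ℕ × ℕ)
    (hc : c ∈ sqI (B * m)) (h : t < |Sf μ (fun u => tst m j c (cellOf (B * m) u)) x|) :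
    1 ≤ majP μ B m l t x := by
  refine (pen_ge μ _ l t hl x h).trans ?_
  unfold majP
  refine (Finset.single_le_sum (f := fun c => pen μ (fun u => tst m j c (cellOf (B * m) u)) l t x)
    (fun _ _ => pen_nonneg _ _ _ _ _) hc).trans ?_
  exact Finset.single_le_sum
    (f := fun j => ∑ c ∈ sqI (B * m), pen μ (fun u => tst m j c (cellOf (B * m) u)) l t x)
    (fun _ _ => Finset.sum_nonneg fun _ _ => pen_nonneg _ _ _ _ _) (Finset.mem_univ j)

lemma pt_bound (hn : Nice μ a b K) {N : ℕ} (hN : 0 < N) (B m M : ℕ) (hB : 0 < B) (hm : 0 < m) (hM : 0 < M)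
    (wm : ℕ × ℕ → ℝ) (ε δ l : ℝ) (hε : 0 < ε) (hε4 : ε ≤ 1 / 4) (hδ : 0 < δ) (hδε : δ ≤ ε) (hl : 0 ≤ l)
    (hwm : ∀ b ∈ sqI B, 0 < wm b) (hwmw : ∀ p ∈ sqI (B * m), wm (blk m p) ≤ N * pc μ (B * m) p)
    (hδK : 8 * δ * K ≤ ε * a) (hBK : 6 * K ≤ ε * a * B)
    (p : (Fin N → E2) × (Fin N → E2))
    (hx : ∀ j i, p.1 j i ∈ Set.Ico (0 : ℝ) 1) (hy : ∀ j i, p.2 j i ∈ Set.Ico (0 : ℝ) 1) :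
    matchCost p.1 p.2 ≤ majT μ B m M ε (a * N / ((B * m : ℕ) : ℝ) ^ 2) wm
      (N * (K / (((B * m : ℕ) : ℝ) ^ 3 * (M : ℝ) ^ 2))) l (δ * (a * N / ((B * m : ℕ) : ℝ) ^ 2) / 7) p := by
  have hG : 0 < B * m := Nat.mul_pos hB hm
  have hG' : (0 : ℝ) < ((B * m : ℕ) : ℝ) := by exact_mod_cast hG
  have hN' : (0 : ℝ) < N := by exact_mod_cast hN
  have hM' : (0 : ℝ) < M := by exact_mod_cast hM
  have ha := hn.ha
  have hK := hn.hK
  set G := B * m with hGd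
  set w0 := a * N / (G : ℝ) ^ 2 with hw0d
  set t := δ * w0 / 7 with htd
  have hw0 : 0 < w0 := by positivity
  have hmP1 := majP_nonneg (μ := μ) B m l t p.1
  have hmP2 := majP_nonneg (μ := μ) B m l t p.2
  have hGB := goodB_nonneg B m M ε w0 hε hw0 wm hwm (fun i => cellOf (G * M) (p.1 i)) (fun i => cellOf (G * M) (p.2 i))
  have hcomb : goodB B m M ε w0 wm (fun i => cellOf (G * M) (p.1 i)) (fun i => cellOf (G * M) (p.2 i)) ≤
      comb B M ε w0 N (majEn μ B m wm p) (majY μ B m p)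
        (majR μ G M (N * (K / ((G : ℝ) ^ 3 * (M : ℝ) ^ 2))) p.1)
        (majR μ G M (N * (K / ((G : ℝ) ^ 3 * (M : ℝ) ^ 2))) p.2) := by
    unfold goodB comb
    simp_rw [blk_cellOf G M hM]
    rw [EnB_eq hn B m hB hm wm p hx hy, YB_eq hn B m hB hm p hx hy]
    have r1 := RF_le hn G M hG hM p.1 hx
    have r2 := RF_le hn G M hG hM p.2 hy
    have e1 : 8 * (B : ℝ) ^ 4 * majY μ B m p / w0 = 8 * (B : ℝ) ^ 4 / w0 * majY μ B m p := by ring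
    rw [e1]
    have : 0 ≤ 2 * (1 + 1 / ε) := by positivity
    refine add_le_add le_rfl (mul_le_mul_of_nonneg_left ?_ this)
    linarith
  by_cases hgood : ∀ j : Fin 3, ∀ c ∈ sqI G, |Sf μ (fun u => tst m j c (cellOf G u)) p.1| ≤ t ∧
      |Sf μ (fun u => tst m j c (cellOf G u)) p.2| ≤ t
  · have hd := det_bound B m M hB hm hM (fun i => ((G : ℝ) * p.1 i 0, (G : ℝ) * p.1 i 1))
      (fun i => ((G : ℝ) * p.2 i 0, (G : ℝ) * p.2 i 1))
      (fun i => cellOf (G * M) (p.1 i)) (fun i => cellOf (G * M) (p.2 i))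
      (fun i => cellOf_mem _ (Nat.mul_pos hG hM) _ (hx i)) (fun i => cellOf_mem _ (Nat.mul_pos hG hM) _ (hy i))
      (fun i => ⟨cell_Ico G M hM _ (hx i 0).1, cell_Ico G M hM _ (hx i 1).1⟩)
      (fun i => ⟨cell_Ico G M hM _ (hy i 0).1, cell_Ico G M hM _ (hy i 1).1⟩)
      (fun c => N * pc μ G c) wm ε δ w0 (K * N / (G : ℝ) ^ 3) t hε hε4 hδ.le hδε hw0 (by positivity)
      (fun q hq => by
        have := hn.lo G hG q hq
        calc w0 = N * (a / (G : ℝ) ^ 2) := by rw [hw0d]; ring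
          _ ≤ _ := mul_le_mul_of_nonneg_left this hN'.le)
      hwm hwmw
      (fun i hi j hj i' hi' => by
        have := hn.lip G hG (i', j) (mem_sqI.2 ⟨hi', hj⟩) (i, j) (mem_sqI.2 ⟨hi, hj⟩)
        simp only [sub_self, abs_zero, add_zero] at this
        rw [← mul_sub, abs_mul, abs_of_pos hN']
        calc _ ≤ N * (K / (G : ℝ) ^ 3 * |(i' : ℝ) - i|) := mul_le_mul_of_nonneg_left this hN'.le
          _ = _ := by ring)
      (fun i hi j hj j' hj' => by
        have := hn.lip G hG (i, j') (mem_sqI.2 ⟨hi, hj'⟩) (i, j) (mem_sqI.2 ⟨hi, hj⟩)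
        simp only [sub_self, abs_zero, zero_add] at this
        rw [← mul_sub, abs_mul, abs_of_pos hN']
        calc _ ≤ N * (K / (G : ℝ) ^ 3 * |(j' : ℝ) - j|) := mul_le_mul_of_nonneg_left this hN'.le
          _ = _ := by ring)
      (by
        have hBG : (B : ℝ) ≤ G := by exact_mod_cast Nat.le_mul_of_pos_right B hm
        have h1 : 6 * K ≤ ε * a * G := hBK.trans (mul_le_mul_of_nonneg_left hBG (by positivity))
        have e1 : K * N / (G : ℝ) ^ 3 * (4 * δ * G + 1) = (N / (G : ℝ) ^ 3) * (4 * δ * K * G + K) := by ring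
        have e2 : ε * w0 = (N / (G : ℝ) ^ 3) * (ε * a * G) := by rw [hw0d]; field_simp
        rw [e1, e2]
        refine mul_le_mul_of_nonneg_left ?_ (by positivity)
        nlinarith)
      (by positivity) (by rw [htd]; linarith)
      (fun j c hc => by
        simp_rw [blk_cellOf G M hM]
        have := (hgood j c hc).1
        rwa [Sf_cell μ hn.ae G hG (fun d => tst m j c d) p.1 hx] at this)
      (fun j c hc => by
        simp_rw [blk_cellOf G M hM]
        have := (hgood j c hc).2
        rwa [Sf_cell μ hn.ae G hG (fun d => tst m j c d) p.2 hy] at this)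
    rw [matchCost_scale] at hd
    have h3 := hd.trans hcomb
    unfold majT
    have : matchCost p.1 p.2 ≤ 1 / (G : ℝ) ^ 2 * comb B M ε w0 N (majEn μ B m wm p) (majY μ B m p)
        (majR μ G M (N * (K / ((G : ℝ) ^ 3 * (M : ℝ) ^ 2))) p.1)
        (majR μ G M (N * (K / ((G : ℝ) ^ 3 * (M : ℝ) ^ 2))) p.2) := by
      rw [one_div, inv_mul_eq_div, le_div_iff₀ (by positivity)]; linarith
    have h5 : 0 ≤ 2 * N * (majP μ B m l t p.1 + majP μ B m l t p.2) := by positivity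
    exact this.trans (le_add_of_nonneg_right h5)
  · have h1 : 1 ≤ majP μ B m l t p.1 + majP μ B m l t p.2 := by
      push Not at hgood
      obtain ⟨j, c, hc, h⟩ := hgood
      by_cases h' : |Sf μ (fun u => tst m j c (cellOf G u)) p.1| ≤ t
      · have := majP_ge B m l t hl p.2 j c hc (h h'); linarith
      · have := majP_ge B m l t hl p.1 j c hc (not_le.1 h'); linarith
    have h2 := matchCost_le p.1 p.2 hx hy
    unfold majT
    have h3 := hGB.trans hcomb
    have h4 : (0 : ℝ) ≤ 1 / (G : ℝ) ^ 2 := by positivity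
    have h5 := mul_nonneg h4 h3
    have h6 : (2 : ℝ) * N * 1 ≤ 2 * N * (majP μ B m l t p.1 + majP μ B m l t p.2) :=
      mul_le_mul_of_nonneg_left h1 (by positivity)
    linarith

lemma comb_IB {α : Type*} [MeasurableSpace α] {P : Measure α} [IsProbabilityMeasure P] (B M : ℕ) (ε w0 n : ℝ)
    (hε : 0 < ε) (hw0 : 0 < w0) {f1 f2 f3 f4 : α → ℝ} {c1 c2 c3 c4 : ℝ}
    (h1 : IB P f1 c1) (h2 : IB P f2 c2) (h3 : IB P f3 c3) (h4 : IB P f4 c4) :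
    IB P (fun p => comb B M ε w0 n (f1 p) (f2 p) (f3 p) (f4 p)) (comb B M ε w0 n c1 c2 c3 c4) := by
  unfold comb
  exact (((((h1.cmul (1 + ε) (by positivity)).add ((h2.cmul _ (by positivity)).cmul _ (by positivity))).cmul _
    (by positivity)).cmul _ (by positivity)).add
    (((IB.const _).add (h3.cmul 2 (by norm_num))).add ((IB.const _).add (h4.cmul 2 (by norm_num))) |>.cmul _
      (by positivity)))

lemma ae_pair (hn : Nice μ a b K) (N : ℕ) : ∀ᵐ p ∂(P2 μ N), (∀ j i, p.1 j i ∈ Set.Ico (0 : ℝ) 1) ∧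
    (∀ j i, p.2 j i ∈ Set.Ico (0 : ℝ) 1) := by
  have h0 : ∀ᵐ x ∂(PN μ N), ∀ j i, x j i ∈ Set.Ico (0 : ℝ) 1 := by
    rw [ae_all_iff]
    intro j
    exact (measurePreserving_eval (fun _ : Fin N => μ) j).quasiMeasurePreserving.ae hn.ae
  unfold P2
  exact (Measure.quasiMeasurePreserving_fst.ae h0).and (Measure.quasiMeasurePreserving_snd.ae h0)

lemma exp_bound (hn : Nice μ a b K) {N : ℕ} (hN : 0 < N) (B m M : ℕ) (hB : 0 < B) (hm : 0 < m) (hM : 0 < M)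
    (ε δ l : ℝ) (hε : 0 < ε) (hε4 : ε ≤ 1 / 4) (hδ : 0 < δ) (hδε : δ ≤ ε) (hl : 0 ≤ l) (hl1 : l ≤ 1)
    (hδK : 8 * δ * K ≤ ε * a) (hBK : 6 * K ≤ ε * a * B) :
    ∫ p, matchCost p.1 p.2 ∂(P2 μ N) ≤
      1 / ((B * m : ℕ) : ℝ) ^ 2 * comb B M ε (a * N / ((B * m : ℕ) : ℝ) ^ 2) N
        ((B : ℝ) ^ 2 * (2 * (1 + ε) * ∑ k ∈ sqI m, 1 / LamF m k)) (2 * N * b)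
        (((B * m : ℕ) : ℝ) ^ 2 * ((M : ℝ) ^ 2 * (Real.sqrt (N * b) / (B * m * M : ℕ) +
          1 / (M : ℝ) ^ 2 * (Real.sqrt (N * b) / (B * m : ℕ)) + N * (K / (((B * m : ℕ) : ℝ) ^ 3 * (M : ℝ) ^ 2)))))
        (((B * m : ℕ) : ℝ) ^ 2 * ((M : ℝ) ^ 2 * (Real.sqrt (N * b) / (B * m * M : ℕ) +
          1 / (M : ℝ) ^ 2 * (Real.sqrt (N * b) / (B * m : ℕ)) + N * (K / (((B * m : ℕ) : ℝ) ^ 3 * (M : ℝ) ^ 2))))) +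
      2 * N * (3 * (((B * m : ℕ) : ℝ) ^ 2 * (2 * Real.exp (l ^ 2 * (N * (b / ((B * m : ℕ) : ℝ) ^ 2)) -
          l * (δ * (a * N / ((B * m : ℕ) : ℝ) ^ 2) / 7)))) +
        3 * (((B * m : ℕ) : ℝ) ^ 2 * (2 * Real.exp (l ^ 2 * (N * (b / ((B * m : ℕ) : ℝ) ^ 2)) -
          l * (δ * (a * N / ((B * m : ℕ) : ℝ) ^ 2) / 7))))) := by
  have hG : 0 < B * m := Nat.mul_pos hB hm
  have hG' : (0 : ℝ) < ((B * m : ℕ) : ℝ) := by exact_mod_cast hG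
  have hN' : (0 : ℝ) < N := by exact_mod_cast hN
  have hm' : (0 : ℝ) < m := by exact_mod_cast hm
  have hB' : (0 : ℝ) < B := by exact_mod_cast hB
  have ha := hn.ha
  have hK := hn.hK
  set G := B * m with hGd
  have hGr : (G : ℝ) = B * m := by rw [hGd]; push_cast; ring
  set v : ℝ := 2 * K * m / (G : ℝ) ^ 3 with hv
  have hv0 : 0 ≤ v := by positivity
  set q : ℕ × ℕ → ℝ := fun β => pc μ G (β.1 * m, β.2 * m) with hq
  have hcor : ∀ β ∈ sqI B, (β.1 * m, β.2 * m) ∈ sqI G := by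
    intro β hβ
    obtain ⟨h1, h2⟩ := mem_sqI.1 hβ
    exact mem_sqI.2 ⟨Nat.mul_lt_mul_of_pos_right h1 hm, Nat.mul_lt_mul_of_pos_right h2 hm⟩
  have hqlo : ∀ β ∈ sqI B, (3 / ε) * v ≤ q β := by
    intro β hβ
    refine le_trans ?_ (hn.lo G hG _ (hcor β hβ))
    have e1 : 3 / ε * v = 6 * K * (m / (ε * (G : ℝ) ^ 3)) := by rw [hv]; field_simp; ring
    rw [e1]
    calc _ ≤ (ε * a * B) * (m / (ε * (G : ℝ) ^ 3)) := mul_le_mul_of_nonneg_right hBK (by positivity)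
      _ = a * (B * m) / (G : ℝ) ^ 3 := by field_simp
      _ = a / (G : ℝ) ^ 2 := by rw [← hGr]; field_simp
  have hqpos : ∀ β ∈ sqI B, 0 < q β := fun β hβ =>
    lt_of_lt_of_le (by positivity) (hn.lo G hG _ (hcor β hβ))
  have hdiff : ∀ p ∈ sqI G, |pc μ G p - q (blk m p)| ≤ v := by
    intro p hp
    obtain ⟨h1, h2⟩ := mem_sqI.1 hp
    have hb : blk m p ∈ sqI B := by
      refine mem_sqI.2 ⟨?_, ?_⟩
      · exact (Nat.div_lt_iff_lt_mul hm).2 h1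
      · exact (Nat.div_lt_iff_lt_mul hm).2 h2
    refine (hn.lip G hG p hp _ (hcor _ hb)).trans ?_
    have key : ∀ i : ℕ, |(i : ℝ) - ((i / m * m : ℕ) : ℝ)| ≤ m := by
      intro i
      have h := Nat.div_add_mod i m
      have h' := Nat.mod_lt i hm
      have e : (i : ℝ) - ((i / m * m : ℕ) : ℝ) = ((i % m : ℕ) : ℝ) := by
        have : ((m * (i / m) + i % m : ℕ) : ℝ) = i := by exact_mod_cast h
        push_cast at this ⊢; linarith
      rw [e, abs_of_nonneg (by positivity)]
      exact_mod_cast h'.le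
    have k1 := key p.1
    have k2 := key p.2
    have hc : 0 ≤ K / (G : ℝ) ^ 3 := by positivity
    calc _ ≤ K / (G : ℝ) ^ 3 * (m + m) := mul_le_mul_of_nonneg_left (add_le_add k1 k2) hc
      _ = v := by rw [hv]; ring
  set wm : ℕ × ℕ → ℝ := fun β => N * (q β - v) with hwmd
  have hvq : ∀ β ∈ sqI B, 12 * v ≤ q β := by
    intro β hβ
    refine le_trans (mul_le_mul_of_nonneg_right ?_ hv0) (hqlo β hβ)
    rw [le_div_iff₀ hε]; linarith
  have hwm : ∀ β ∈ sqI B, 0 < wm β := by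
    intro β hβ
    have h1 := hvq β hβ
    have h2 := hqpos β hβ
    exact mul_pos hN' (by linarith)
  have hwmw : ∀ p ∈ sqI G, wm (blk m p) ≤ N * pc μ G p := by
    intro p hp
    have := (abs_le.1 (hdiff p hp)).1
    exact mul_le_mul_of_nonneg_left (by linarith) hN'.le
  have hEn := majEn_IB hn N B m hB hm wm (fun β => q β + v) (1 + ε) hwm
    (fun β hβ => by have := hqpos β hβ; positivity)
    (fun d hd => by have := (abs_le.1 (hdiff d hd)).2; linarith)
    (fun β hβ => by
      have h1 := hqlo β hβ
      rw [div_mul_eq_mul_div, div_le_iff₀ hε] at h1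
      have h2 : q β + v ≤ (1 + ε) * (q β - v) := by nlinarith
      have := mul_le_mul_of_nonneg_left h2 hN'.le
      rw [hwmd]; linarith)
  have hY := majY_IB hn N B m hB hm
  have hR := majR_IB hn N G M hN hG hM (N * (K / ((G : ℝ) ^ 3 * (M : ℝ) ^ 2)))
  have hP := majP_IB hn N B m hB hm l (δ * (a * N / (G : ℝ) ^ 2) / 7) hl hl1
  have hPN : IsProbabilityMeasure (PN μ N) := by unfold PN; infer_instance
  have hP2 : IsProbabilityMeasure (P2 μ N) := by unfold P2; infer_instance
  have hT : IB (P2 μ N) (fun p => majT μ B m M ε (a * N / (G : ℝ) ^ 2) wm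
      (N * (K / ((G : ℝ) ^ 3 * (M : ℝ) ^ 2))) l (δ * (a * N / (G : ℝ) ^ 2) / 7) p) _ :=
    ((comb_IB B M ε (a * N / (G : ℝ) ^ 2) N hε (by positivity) hEn hY
      (hR.fst (Q := PN μ N)) (hR.snd (Q := PN μ N))).cmul (1 / (G : ℝ) ^ 2) (by positivity)).add
      (((hP.fst (Q := PN μ N)).add (hP.snd (Q := PN μ N))).cmul (2 * N) (by positivity))
  refine le_trans ?_ hT.2
  refine integral_mono_of_nonneg (Eventually.of_forall fun p => matchCost_nonneg _ _) hT.1 ?_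
  filter_upwards [ae_pair hn N] with p hp
  exact pt_bound hn hN B m M hB hm hM wm ε δ l hε hε4 hδ hδε hl hwm hwmw hδK hBK p hp.1 hp.2

end

end Part15

section Part16
section
variable {μ : Measure E2} [IsProbabilityMeasure μ] {a b K : ℝ}

lemma exp_bound2 (hn : Nice μ a b K) {N : ℕ} (hN : 0 < N) (B m M : ℕ) (hB : 0 < B) (hm : 0 < m) (hM : 0 < M)
    (ε δ l C n : ℝ) (hε : 0 < ε) (hε4 : ε ≤ 1 / 4) (hδ : 0 < δ) (hδε : δ ≤ ε) (hl : 0 ≤ l) (hl1 : l ≤ 1)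
    (hδK : 8 * δ * K ≤ ε * a) (hBK : 6 * K ≤ ε * a * B)
    (hS : ∑ k ∈ sqI m, 1 / LamF m k ≤ (m : ℝ) ^ 2 * ((1 + ε) * Real.log m / (2 * Real.pi) + C))
    (hnd : n = N / ((B * m : ℕ) : ℝ) ^ 2) (hlb : l * b ≤ δ * a / 14) :
    ∫ p, matchCost p.1 p.2 ∂(P2 μ N) ≤
      (1 + ε) ^ 2 / (1 - 2 * ε) ^ 2 * ((1 + ε) ^ 2 * (2 * ((1 + ε) * Real.log m / (2 * Real.pi) + C)) +
        (1 + 1 / ε) * (16 * (B : ℝ) ^ 4 * b / a)) +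
      8 * (1 + 1 / ε) * (n / (M : ℝ) ^ 2 + (M + 1) * Real.sqrt (b * n) + n * K / (B * m : ℕ)) +
      24 * N * ((B * m : ℕ) : ℝ) ^ 2 * Real.exp (-(l * δ * a / 14 * n)) := by
  have hG : 0 < B * m := Nat.mul_pos hB hm
  have hG' : (0 : ℝ) < ((B * m : ℕ) : ℝ) := by exact_mod_cast hG
  have hN' : (0 : ℝ) < N := by exact_mod_cast hN
  have hm' : (0 : ℝ) < m := by exact_mod_cast hm
  have hM' : (0 : ℝ) < M := by exact_mod_cast hM
  have hB' : (0 : ℝ) < B := by exact_mod_cast hB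
  have ha := hn.ha
  have hb := hn.hb
  have hK := hn.hK
  refine (exp_bound hn hN B m M hB hm hM ε δ l hε hε4 hδ hδε hl hl1 hδK hBK).trans ?_
  have hGM : ((B * m * M : ℕ) : ℝ) = (B * m : ℕ) * M := by push_cast; ring
  rw [hGM]
  have hGBm : ((B * m : ℕ) : ℝ) = B * m := by push_cast; ring
  set G : ℝ := ((B * m : ℕ) : ℝ) with hGd
  have hn0 : 0 < n := by rw [hnd]; positivity
  have hNn : (N : ℝ) = n * G ^ 2 := by rw [hnd]; field_simp
  have hsq : Real.sqrt (N * b) = G * Real.sqrt (b * n) := by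
    rw [hNn, show n * G ^ 2 * b = G ^ 2 * (b * n) by ring, Real.sqrt_mul (by positivity), Real.sqrt_sq hG'.le]
  set s := Real.sqrt (b * n)
  set S := ∑ k ∈ sqI m, 1 / LamF m k
  set T := (1 + ε) * Real.log m / (2 * Real.pi) + C
  refine add_le_add ?_ ?_
  · unfold comb
    rw [hsq]
    have e1 : 1 / G ^ 2 * ((1 + ε) * ((1 + ε) / (1 - 2 * ε) ^ 2 * ((1 + ε) * ((B : ℝ) ^ 2 * (2 * (1 + ε) * S)) +
        (1 + 1 / ε) * (8 * (B : ℝ) ^ 4 / (a * N / G ^ 2) * (2 * N * b)))) +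
        2 * (1 + 1 / ε) * (2 * N / (M : ℝ) ^ 2 + 2 * (G ^ 2 * ((M : ℝ) ^ 2 * (G * s / (G * M) + 1 / (M : ℝ) ^ 2 * (G * s / G) +
          N * (K / (G ^ 3 * (M : ℝ) ^ 2))))) +
        (2 * N / (M : ℝ) ^ 2 + 2 * (G ^ 2 * ((M : ℝ) ^ 2 * (G * s / (G * M) + 1 / (M : ℝ) ^ 2 * (G * s / G) +
          N * (K / (G ^ 3 * (M : ℝ) ^ 2)))))))) =
        (1 + ε) ^ 2 / (1 - 2 * ε) ^ 2 * ((1 + ε) ^ 2 * (2 * ((B : ℝ) ^ 2 * S / G ^ 2)) +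
        (1 + 1 / ε) * (16 * (B : ℝ) ^ 4 * b / a)) +
        8 * (1 + 1 / ε) * (n / (M : ℝ) ^ 2 + (M + 1) * s + n * K / G) := by
      have h0 : (1 - 2 * ε) ≠ 0 := by linarith
      have x1 : 8 * (B : ℝ) ^ 4 / (a * N / G ^ 2) * (2 * N * b) = G ^ 2 * (16 * (B : ℝ) ^ 4 * b / a) := by
        field_simp; ring
      have x2 : G ^ 2 * ((M : ℝ) ^ 2 * (G * s / (G * M) + 1 / (M : ℝ) ^ 2 * (G * s / G) +
          N * (K / (G ^ 3 * (M : ℝ) ^ 2)))) = G ^ 2 * ((M + 1) * s + n * K / G) := by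
        rw [hNn]; field_simp
      have x3 : 2 * (N : ℝ) / (M : ℝ) ^ 2 = G ^ 2 * (2 * (n / (M : ℝ) ^ 2)) := by rw [hNn]; ring
      have x4 : (B : ℝ) ^ 2 * (2 * (1 + ε) * S) = G ^ 2 * (2 * (1 + ε) * ((B : ℝ) ^ 2 * S / G ^ 2)) := by
        field_simp
      rw [x1, x2, x3, x4]
      generalize (B : ℝ) ^ 2 * S / G ^ 2 = u1
      generalize 16 * (B : ℝ) ^ 4 * b / a = u2
      generalize n / (M : ℝ) ^ 2 = u3
      generalize n * K / G = u4
      generalize 1 + 1 / ε = u5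
      have : G ≠ 0 := hG'.ne'
      field_simp
      ring
    rw [e1]
    have h2 : (B : ℝ) ^ 2 * S / G ^ 2 ≤ T := by
      rw [div_le_iff₀ (by positivity)]
      calc (B : ℝ) ^ 2 * S ≤ (B : ℝ) ^ 2 * ((m : ℝ) ^ 2 * T) := mul_le_mul_of_nonneg_left hS (by positivity)
        _ = _ := by rw [hGBm]; ring
    have h3 : 0 ≤ (1 + ε) ^ 2 / (1 - 2 * ε) ^ 2 := by positivity
    refine add_le_add (mul_le_mul_of_nonneg_left (add_le_add (mul_le_mul_of_nonneg_left ?_ (by positivity)) le_rfl) h3) le_rfl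
    linarith
  · have h1 : l ^ 2 * (N * (b / G ^ 2)) - l * (δ * (a * N / G ^ 2) / 7) ≤ -(l * δ * a / 14 * n) := by
      have y1 : (N : ℝ) * (b / G ^ 2) = b * n := by rw [hnd]; ring
      have y2 : a * N / G ^ 2 = a * n := by rw [hnd]; ring
      rw [y1, y2]
      have := mul_le_mul_of_nonneg_left hlb (mul_nonneg hl hn0.le)
      nlinarith
    have h2 := Real.exp_le_exp.2 h1
    have h3 := mul_le_mul_of_nonneg_left h2 (show 0 ≤ 24 * N * G ^ 2 by positivity)
    linarith

/-- Choice of the grid size. -/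
lemma choose_m (B N : ℕ) (hB : 0 < B) (A L T : ℝ) (hT : 1 ≤ T) (hA : 0 < A) (hAL : 1 ≤ A * L)
    (hbig : A * (T * (2 * B)) ^ 2 * L ≤ N) :
    ∃ m : ℕ, 0 < m ∧ A * L ≤ N / ((B * m : ℕ) : ℝ) ^ 2 ∧ N / ((B * m : ℕ) : ℝ) ^ 2 ≤ 4 * A * L ∧ T ≤ ((B * m : ℕ) : ℝ) ∧
      (m : ℝ) ^ 2 ≤ N ∧ ((B * m : ℕ) : ℝ) ^ 2 ≤ N := by
  have hB1 : (1 : ℝ) ≤ B := by exact_mod_cast hB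
  have hB' : (0 : ℝ) < B := by linarith
  have hAL0 : 0 < A * L := by linarith
  set s := Real.sqrt (N / (A * L)) with hs
  have hs2 : s ^ 2 = N / (A * L) := Real.sq_sqrt (by positivity)
  have hsT : T * (2 * B) ≤ s := by
    apply Real.le_sqrt_of_sq_le
    rw [le_div_iff₀ hAL0]; linarith
  have hs0 : 0 < s := by nlinarith
  have hsN : N = s ^ 2 * (A * L) := by rw [hs2, div_mul_cancel₀ _ hAL0.ne']
  set m := ⌊s / B⌋₊
  have h1 : (m : ℝ) ≤ s / B := Nat.floor_le (by positivity)
  have h2 : s / B < m + 1 := Nat.lt_floor_add_one _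
  rw [le_div_iff₀ hB'] at h1
  rw [div_lt_iff₀ hB'] at h2
  have hG1 : ((B * m : ℕ) : ℝ) ≤ s := by push_cast; linarith
  have hTB : (B : ℝ) ≤ T * B := by nlinarith
  have hG2 : s / 2 ≤ ((B * m : ℕ) : ℝ) := by push_cast; linarith
  have hm : 0 < m := by
    rcases Nat.eq_zero_or_pos m with h | h
    · rw [h] at hG2; simp at hG2; linarith
    · exact h
  have hG0 : 0 < ((B * m : ℕ) : ℝ) := by exact_mod_cast Nat.mul_pos hB hm
  have hGsq : ((B * m : ℕ) : ℝ) ^ 2 ≤ s ^ 2 := by nlinarith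
  have hGN : ((B * m : ℕ) : ℝ) ^ 2 ≤ N := by rw [hsN]; nlinarith [sq_nonneg s]
  refine ⟨m, hm, ?_, ?_, by nlinarith, ?_, hGN⟩
  · rw [le_div_iff₀ (by positivity), hsN]; nlinarith
  · rw [div_le_iff₀ (by positivity), hsN]
    have : s ^ 2 ≤ 4 * ((B * m : ℕ) : ℝ) ^ 2 := by nlinarith
    nlinarith
  · refine le_trans ?_ hGN
    have : (m : ℝ) ≤ ((B * m : ℕ) : ℝ) := by exact_mod_cast Nat.le_mul_of_pos_left m hB
    gcongr

set_option maxHeartbeats 2000000 in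
lemma ev_bound (hn : Nice μ a b K) (ε : ℝ) (hε : 0 < ε) (hε4 : ε ≤ 1 / 4) :
    ∀ᶠ N : ℕ in atTop, 2 * Real.pi / Real.log N * ∫ p, matchCost p.1 p.2 ∂(P2 μ N) ≤
      (1 + ε) ^ 5 / (1 - 2 * ε) ^ 2 + 4 * ε := by
  have ha := hn.ha
  have hb := hn.hb
  have hK := hn.hK
  have hpi := Real.pi_pos
  obtain ⟨C, hC, hLam⟩ := Lam_sum_le ε hε
  obtain ⟨δ, hδ, hδε, hδK⟩ : ∃ δ : ℝ, 0 < δ ∧ δ ≤ ε ∧ 8 * δ * K ≤ ε * a := by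
    refine ⟨min ε (ε * a / (8 * (K + 1))), lt_min hε (by positivity), min_le_left _ _, ?_⟩
    have h := min_le_right ε (ε * a / (8 * (K + 1)))
    rw [le_div_iff₀ (by positivity)] at h
    have h0 : 0 ≤ min ε (ε * a / (8 * (K + 1))) := (lt_min hε (by positivity)).le
    nlinarith
  obtain ⟨B, hBK0⟩ := exists_nat_gt (6 * K / (ε * a))
  have hB' : (0 : ℝ) < B := lt_of_le_of_lt (by positivity) hBK0
  have hB : 0 < B := by exact_mod_cast hB'
  have hBK : 6 * K ≤ ε * a * B := by
    rw [div_lt_iff₀ (by positivity)] at hBK0; linarith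
  obtain ⟨l, hl, hl1, hlb⟩ : ∃ l : ℝ, 0 < l ∧ l ≤ 1 ∧ l * b ≤ δ * a / 14 := by
    refine ⟨min 1 (δ * a / (14 * b)), lt_min one_pos (by positivity), min_le_left _ _, ?_⟩
    have h := min_le_right 1 (δ * a / (14 * b))
    rw [le_div_iff₀ (by positivity)] at h
    linarith
  set γ := l * δ * a / 14 with hγ
  have hγ0 : 0 < γ := by positivity
  set A := 3 / γ with hA
  have hA0 : 0 < A := by positivity
  have hγA : γ * A = 3 := by rw [hA]; field_simp
  set E := 8 * (1 + 1 / ε) with hE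
  have hE0 : 0 < E := by positivity
  set η := ε / (2 * Real.pi) with hη
  have hη0 : 0 < η := by positivity
  obtain ⟨M, hM0⟩ := exists_nat_gt (E * (4 * A) / η + 1)
  have hM1 : (1 : ℝ) < M := lt_of_le_of_lt (by have : 0 ≤ E * (4 * A) / η := by positivity
                                               linarith) hM0
  have hM : 0 < M := by exact_mod_cast (by linarith : (0 : ℝ) < M)
  have hM2 : E * (4 * A / (M : ℝ) ^ 2) ≤ η := by
    have h1 : E * (4 * A) / η ≤ (M : ℝ) ^ 2 := by nlinarith
    rw [div_le_iff₀ hη0] at h1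
    rw [← mul_div_assoc, div_le_iff₀ (by positivity)]; linarith
  set T := max 1 (E * (4 * A) * K / η) with hTd
  have hT1 : 1 ≤ T := le_max_left _ _
  have hT2 : E * (4 * A) * K / η ≤ T := le_max_right _ _
  set θ := η / (E * (M + 1)) with hθ
  have hθ0 : 0 < θ := by positivity
  set D := (1 + ε) ^ 2 / (1 - 2 * ε) ^ 2 * ((1 + ε) ^ 2 * (2 * C) + (1 + 1 / ε) * (16 * (B : ℝ) ^ 4 * b / a)) + 24 with hD
  have hlog : Tendsto (fun N : ℕ => Real.log N) atTop atTop :=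
    Real.tendsto_log_atTop.comp tendsto_natCast_atTop_atTop
  have hlo := (Real.isLittleO_log_id_atTop.comp_tendsto (tendsto_natCast_atTop_atTop (R := ℝ))).def
    (show 0 < 1 / (A * (T * (2 * B)) ^ 2) by have : 0 < T := by linarith
                                             positivity)
  filter_upwards [hlo, hlog.eventually_ge_atTop (1 / A), hlog.eventually_ge_atTop (4 * b * A / θ ^ 2),
    hlog.eventually_ge_atTop (D / η), hlog.eventually_ge_atTop 1, eventually_gt_atTop 0] with N h1 h2 h3 h4 h5 hN
  have hN' : (0 : ℝ) < N := by exact_mod_cast hN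
  set L := Real.log N with hL
  have hL0 : 0 < L := by linarith
  have hT0 : 0 < T := by linarith
  have hbig : A * (T * (2 * B)) ^ 2 * L ≤ N := by
    simp only [Function.comp, id, Real.norm_eq_abs, Nat.abs_cast] at h1
    have h1' := (le_abs_self _).trans h1
    rw [one_div, inv_mul_eq_div, le_div_iff₀ (by positivity)] at h1'
    linarith
  have hAL : 1 ≤ A * L := by rw [div_le_iff₀ hA0] at h2; linarith
  obtain ⟨m, hm, hn1, hn2, hGT, hmN, hGN⟩ := choose_m B N hB A L T hT1 hA0 hAL hbig
  have hmain := exp_bound2 hn hN B m M hB hm hM ε δ l C _ hε hε4 hδ hδε hl.le hl1 hδK hBK (hLam m hm) rfl hlb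
  have hG0 : 0 < ((B * m : ℕ) : ℝ) := by linarith
  set G := ((B * m : ℕ) : ℝ)
  set n := (N : ℝ) / G ^ 2
  have hn0 : 0 < n := by positivity
  have hm' : (0 : ℝ) < m := by exact_mod_cast hm
  have hlm : Real.log m ≤ L / 2 := by
    have := Real.log_le_log (by positivity) hmN
    rw [Real.log_pow] at this
    push_cast at this; linarith
  have b1 : n / (M : ℝ) ^ 2 * E ≤ η * L := by
    calc n / (M : ℝ) ^ 2 * E ≤ (4 * A * L) / (M : ℝ) ^ 2 * E := by gcongr
      _ = E * (4 * A / (M : ℝ) ^ 2) * L := by ring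
      _ ≤ _ := mul_le_mul_of_nonneg_right hM2 hL0.le
  have b2 : (M + 1) * Real.sqrt (b * n) * E ≤ η * L := by
    have hs : Real.sqrt (b * n) ≤ θ * L := by
      apply Real.sqrt_le_iff.2
      refine ⟨by positivity, ?_⟩
      rw [div_le_iff₀ (by positivity)] at h3
      calc b * n ≤ b * (4 * A * L) := mul_le_mul_of_nonneg_left hn2 hb.le
        _ = (4 * b * A) * L := by ring
        _ ≤ (L * θ ^ 2) * L := mul_le_mul_of_nonneg_right h3 hL0.le
        _ = _ := by ring
    calc (M + 1) * Real.sqrt (b * n) * E ≤ (M + 1) * (θ * L) * E := by gcongr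
      _ = η * L := by rw [hθ]; field_simp
  have b3 : n * K / G * E ≤ η * L := by
    have : E * (4 * A) * K / η ≤ G := hT2.trans hGT
    rw [div_le_iff₀ hη0] at this
    rw [div_mul_eq_mul_div, div_le_iff₀ hG0]
    calc n * K * E ≤ (4 * A * L) * K * E := by gcongr
      _ = (E * (4 * A) * K) * L := by ring
      _ ≤ (G * η) * L := mul_le_mul_of_nonneg_right this hL0.le
      _ = _ := by ring
  have b4 : 24 * N * G ^ 2 * Real.exp (-(γ * n)) ≤ 24 := by
    have x1 : Real.exp (-(γ * n)) ≤ Real.exp (-(3 * L)) := by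
      apply Real.exp_le_exp.2
      have := mul_le_mul_of_nonneg_left hn1 hγ0.le
      nlinarith
    have x2 : Real.exp (-(3 * L)) = 1 / (N : ℝ) ^ 3 := by
      rw [Real.exp_neg, one_div, show 3 * L = L + L + L by ring, Real.exp_add, Real.exp_add, hL, Real.exp_log hN']
      ring_nf
    have hN1 : (1 : ℝ) ≤ N := by exact_mod_cast hN
    rw [x2] at x1
    calc 24 * (N : ℝ) * G ^ 2 * Real.exp (-(γ * n)) ≤ 24 * (N : ℝ) * (N : ℝ) * (1 / (N : ℝ) ^ 3) := by gcongr
      _ = 24 / (N : ℝ) := by field_simp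
      _ ≤ 24 := div_le_self (by norm_num) hN1
  have b5 : D ≤ η * L := by rw [div_le_iff₀ hη0] at h4; linarith
  have hq0 : 0 ≤ (1 + ε) ^ 2 / (1 - 2 * ε) ^ 2 := by positivity
  have b6 : (1 + ε) ^ 2 / (1 - 2 * ε) ^ 2 * ((1 + ε) ^ 2 * (2 * ((1 + ε) * Real.log m / (2 * Real.pi)))) ≤
      (1 + ε) ^ 5 / (1 - 2 * ε) ^ 2 * (L / (2 * Real.pi)) := by
    calc _ ≤ (1 + ε) ^ 2 / (1 - 2 * ε) ^ 2 * ((1 + ε) ^ 2 * (2 * ((1 + ε) * (L / 2) / (2 * Real.pi)))) := by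
          gcongr
      _ = _ := by ring
  have hfin : ∫ p, matchCost p.1 p.2 ∂(P2 μ N) ≤
      (1 + ε) ^ 5 / (1 - 2 * ε) ^ 2 * (L / (2 * Real.pi)) + 4 * (η * L) := by
    refine hmain.trans ?_
    have : (1 + ε) ^ 2 / (1 - 2 * ε) ^ 2 * ((1 + ε) ^ 2 * (2 * ((1 + ε) * Real.log m / (2 * Real.pi) + C)) +
        (1 + 1 / ε) * (16 * (B : ℝ) ^ 4 * b / a)) =
        (1 + ε) ^ 2 / (1 - 2 * ε) ^ 2 * ((1 + ε) ^ 2 * (2 * ((1 + ε) * Real.log m / (2 * Real.pi)))) + (D - 24) := by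
      rw [hD]; ring
    rw [this]
    linarith
  calc _ ≤ 2 * Real.pi / L * ((1 + ε) ^ 5 / (1 - 2 * ε) ^ 2 * (L / (2 * Real.pi)) + 4 * (η * L)) :=
        mul_le_mul_of_nonneg_left hfin (by positivity)
    _ = _ := by
      rw [hη]
      generalize (1 + ε) ^ 5 / (1 - 2 * ε) ^ 2 = z
      field_simp

lemma limsup_le_one (hn : Nice μ a b K) :
    limsup (fun N : ℕ => 2 * Real.pi / Real.log N * ∫ p, matchCost p.1 p.2 ∂(P2 μ N)) atTop ≤ 1 := by
  have hpos : ∀ N : ℕ, 0 ≤ 2 * Real.pi / Real.log N * ∫ p, matchCost p.1 p.2 ∂(P2 μ N) := by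
    intro N
    have h1 : 0 ≤ Real.log N := Real.log_natCast_nonneg N
    have h2 : 0 ≤ ∫ p, matchCost p.1 p.2 ∂(P2 μ N) := integral_nonneg fun p => matchCost_nonneg _ _
    have := Real.pi_pos
    positivity
  have key : ∀ ε : ℝ, 0 < ε → ε ≤ 1 / 4 →
      limsup (fun N : ℕ => 2 * Real.pi / Real.log N * ∫ p, matchCost p.1 p.2 ∂(P2 μ N)) atTop ≤
        (1 + ε) ^ 5 / (1 - 2 * ε) ^ 2 + 4 * ε := by
    intro ε h1 h2
    exact limsup_le_of_le (isCoboundedUnder_le_of_le atTop (x := 0) hpos) (ev_bound hn ε h1 h2)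
  have hcont : Tendsto (fun ε : ℝ => (1 + ε) ^ 5 / (1 - 2 * ε) ^ 2 + 4 * ε) (𝓝[>] 0) (𝓝 1) := by
    have : ContinuousAt (fun ε : ℝ => (1 + ε) ^ 5 / (1 - 2 * ε) ^ 2 + 4 * ε) 0 := by
      refine ContinuousAt.add (ContinuousAt.div (by fun_prop) (by fun_prop) (by norm_num)) (by fun_prop)
    have h := this.tendsto.mono_left (nhdsWithin_le_nhds (s := Set.Ioi 0))
    simpa using h
  refine ge_of_tendsto hcont ?_
  filter_upwards [Ioc_mem_nhdsGT (show (0 : ℝ) < 1 / 4 by norm_num)] with ε hε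
  exact key ε hε.1 hε.2

end

end Part16

/-- limsup_{N→∞} (2π / log N) · E_μ[C_N] ≤ 1, where the expectation is taken
with respect to the 2N-fold product of the measure `μ` with Lipschitz,
strictly positive density `ρ` on the unit square. -/
theorem matching_cost_upper_bound
    (ρ : E2 → ℝ) (a : ℝ) (ha : 0 < a)
    (hlip : ∃ K : ℝ≥0, LipschitzOnWith K ρ unitSq)
    (hpos : ∀ x ∈ unitSq, a ≤ ρ x)
    (hint : ∫ x in unitSq, ρ x = 1)
    (μ : Measure E2)
    (hμ : μ = (volume.restrict unitSq).withDensity fun x => ENNReal.ofReal (ρ x))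
    (hprob : IsProbabilityMeasure μ) :
    limsup (fun N : ℕ =>
        (2 * Real.pi / Real.log N) *
          ∫ p : (Fin N → E2) × (Fin N → E2), matchCost p.1 p.2
            ∂((Measure.pi fun _ => μ).prod (Measure.pi fun _ => μ)))
      atTop ≤ 1 := by
  obtain ⟨b, K, hn⟩ := nice_of ρ a ha hlip hpos μ hμ
  exact limsup_le_one hn
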